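/- Let k be an algebraically closed field and let S = V(f) ⊆ P³ be a smooth surface of degree d > 3. If the set of lines on S has cardinality exactly d²(d²−3d+3), then k has positive characteristic p, there exists e ≥ 1 with d = pᵉ+1, and f is projectively equivalent to the Fermat form x^{pᵉ+1}+y^{pᵉ+1}+z^{pᵉ+1}+w^{pᵉ+1}, i.e., there exist an invertible 4×4 matrix A over k and a nonzero scalar c such that f(A·v) = c·(v₀^{pᵉ+1}+v₁^{pᵉ+1}+v₂^{pᵉ+1}+v₃^{pᵉ+1}) for all v ∈ k⁴. -/

import Mathlib

open MvPolynomial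

/-- `W` is a line (2-dimensional linear subspace of `k⁴`) lying on the surface `V(f) ⊆ P³`. -/
def IsLineOn {k : Type*} [Field k] (f : MvPolynomial (Fin 4) k)
    (W : Submodule k (Fin 4 → k)) : Prop :=
  Module.finrank k W = 2 ∧ ∀ v ∈ W, MvPolynomial.eval v f = 0

/-- `f` is a nonzero homogeneous polynomial of degree `d` in `k[x,y,z,w]` such that `f` and its
four partial derivatives have no common zero in `k⁴ ∖ {0}`; i.e. `V(f) ⊆ P³` is a smooth
surface of degree `d`. -/
def IsSmoothSurface {k : Type*} [Field k] (f : MvPolynomial (Fin 4) k) (d : ℕ) : Prop :=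
  f ≠ 0 ∧ f.IsHomogeneous d ∧
    ∀ v : Fin 4 → k, v ≠ 0 →
      ¬ (MvPolynomial.eval v f = 0 ∧
         ∀ i : Fin 4, MvPolynomial.eval v (MvPolynomial.pderiv i f) = 0)

section Polarization

variable {k σ R S : Type*} [CommRing k] [CommRing R] [Algebra k R] [CommRing S] [Algebra k S]

/-- A homogeneous polynomial of degree `d` sends degree one elements of a multiplicative family of
submodules to degree `d` elements. -/
theorem aeval_mem_of_isHomogeneous {f : MvPolynomial σ k} {d : ℕ} (hf : f.IsHomogeneous d)
    (D : ℕ → Submodule k R) (h1 : (1 : R) ∈ D 0)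
    (hmul : ∀ a b x y, x ∈ D a → y ∈ D b → x * y ∈ D (a + b))
    (y : σ → R) (hy : ∀ m, y m ∈ D 1) : aeval y f ∈ D d := by
  have hpow : ∀ (m : σ) (e : ℕ), y m ^ e ∈ D e := by
    intro m e
    induction e with
    | zero => simpa using h1
    | succ e ih => rw [pow_succ]; exact hmul _ _ _ _ ih (hy m)
  have hprod : ∀ (s : σ →₀ ℕ) (t : Finset σ), ∏ m ∈ t, y m ^ s m ∈ D (∑ m ∈ t, s m) := by
    classical
    intro s t
    induction t using Finset.induction_on with
    | empty => simpa using h1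
    | insert a t ha ih =>
      rw [Finset.prod_insert ha, Finset.sum_insert ha]
      exact hmul _ _ _ _ (hpow _ _) ih
  rw [aeval_def, eval₂_eq]
  refine Submodule.sum_mem _ fun s hs => ?_
  rw [← Algebra.smul_def]
  refine Submodule.smul_mem _ _ ?_
  have := hprod s s.support
  have hd : ∑ m ∈ s.support, s m = d := by
    have := hf (mem_support_iff.1 hs)
    rw [← this, Finsupp.weight_apply, Finsupp.sum]; simp
  rwa [hd] at this

theorem aeval_smul_of_isHomogeneous {f : MvPolynomial σ k} {d : ℕ} (hf : f.IsHomogeneous d)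
    (c : R) (y : σ → R) : aeval (c • y) f = c ^ d * aeval y f := by
  let D : ℕ → Submodule k (R × R) := fun e =>
    { carrier := {p | p.2 = c ^ e * p.1}
      add_mem' := by
        rintro a b ha hb; simp only [Set.mem_ofPred_eq] at *; simp [ha, hb, mul_add]
      zero_mem' := by simp
      smul_mem' := by
        rintro a b hb; simp only [Set.mem_ofPred_eq] at *; simp [hb] }
  have h := aeval_mem_of_isHomogeneous hf D (by simp [D]) (by
    intro a b x y hx hy
    change x.2 = _ at hx
    change y.2 = _ at hy
    change x.2 * y.2 = c ^ (a + b) * (x.1 * y.1)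
    rw [hx, hy]; ring) (fun m => (y m, c * y m)) (by intro m; simp [D])
  change ((aeval _ f : R × R)).2 = c ^ d * ((aeval _ f : R × R)).1 at h
  have e1 := DFunLike.congr_fun (comp_aeval (fun m => (y m, c * y m)) (AlgHom.fst k R R)) f
  have e2 := DFunLike.congr_fun (comp_aeval (fun m => (y m, c * y m)) (AlgHom.snd k R R)) f
  simp only [AlgHom.comp_apply, AlgHom.fst_apply, AlgHom.snd_apply] at e1 e2
  rw [e1, e2] at h
  exact h

/-- The polynomial `f (x + s v)` in the variable `s`. -/
noncomputable def linePoly (f : MvPolynomial σ k) (x v : σ → R) : Polynomial R :=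
  aeval (fun m => Polynomial.C (x m) + Polynomial.X * Polynomial.C (v m)) f

/-- The `j`-th polar form: the coefficient of `s ^ j` in `f (x + s v)`. -/
noncomputable def pol (f : MvPolynomial σ k) (j : ℕ) (x v : σ → R) : R :=
  (linePoly f x v).coeff j

theorem map_linePoly (f : MvPolynomial σ k) (x v : σ → R) (φ : R →ₐ[k] S) :
    (linePoly f x v).map (φ : R →+* S) = linePoly f (fun m => φ (x m)) (fun m => φ (v m)) := by
  have := DFunLike.congr_fun (comp_aeval
    (fun m => Polynomial.C (x m) + Polynomial.X * Polynomial.C (v m)) (Polynomial.mapAlgHom φ)) f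
  simp only [AlgHom.comp_apply] at this
  rw [linePoly, linePoly]
  refine Eq.trans this ?_
  simp

theorem map_pol (f : MvPolynomial σ k) (j : ℕ) (x v : σ → R) (φ : R →ₐ[k] S) :
    φ (pol f j x v) = pol f j (fun m => φ (x m)) (fun m => φ (v m)) := by
  rw [pol, pol, ← map_linePoly]; simp

theorem eval_linePoly (f : MvPolynomial σ k) (x v : σ → R) (s : R) :
    (linePoly f x v).eval s = aeval (x + s • v) f := by
  have := DFunLike.congr_fun (comp_aeval
    (fun m => Polynomial.C (x m) + Polynomial.X * Polynomial.C (v m))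
    ((Polynomial.aeval s).restrictScalars k)) f
  simp only [AlgHom.comp_apply, AlgHom.restrictScalars_apply] at this
  rw [linePoly, ← Polynomial.coe_aeval_eq_eval]
  refine Eq.trans this ?_
  congr 2
  ext m; simp [Polynomial.aeval_def]; ring

/-- Polar forms respect a multiplicative family of submodules. -/
theorem pol_mem {f : MvPolynomial σ k} {d : ℕ} (hf : f.IsHomogeneous d)
    (D : ℕ → Submodule k R) (h1 : (1 : R) ∈ D 0)
    (hmul : ∀ a b x y, x ∈ D a → y ∈ D b → x * y ∈ D (a + b)) (a b : ℕ)
    (x v : σ → R) (hx : ∀ m, x m ∈ D a) (hv : ∀ m, v m ∈ D b) (j : ℕ) (hj : j ≤ d) :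
    pol f j x v ∈ D ((d - j) * a + j * b) := by
  let E : ℕ → Submodule k (Polynomial R) := fun e =>
    { carrier := {p | ∀ i j, i + j = e → p.coeff j ∈ D (i * a + j * b)} ⊓ {p | p.natDegree ≤ e}
      add_mem' := by
        rintro p q ⟨hp, hp'⟩ ⟨hq, hq'⟩
        refine ⟨fun i j h => ?_, Polynomial.natDegree_add_le_of_degree_le hp' hq'⟩
        rw [Polynomial.coeff_add]; exact Submodule.add_mem _ (hp i j h) (hq i j h)
      zero_mem' := ⟨fun i j h => by simp, by simp⟩
      smul_mem' := by
        rintro c p ⟨hp, hp'⟩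
        refine ⟨fun i j h => ?_, (Polynomial.natDegree_smul_le c p).trans hp'⟩
        rw [Polynomial.coeff_smul]; exact Submodule.smul_mem _ _ (hp i j h) }
  have h := aeval_mem_of_isHomogeneous hf E ⟨fun i j h => by
      obtain ⟨rfl, rfl⟩ : i = 0 ∧ j = 0 := by omega
      simpa using h1, by simp⟩ (by
    rintro a' b' p q ⟨hp, hp'⟩ ⟨hq, hq'⟩
    refine ⟨fun i j h => ?_, Polynomial.natDegree_mul_le_of_le hp' hq'⟩
    rw [Polynomial.coeff_mul]
    refine Submodule.sum_mem _ fun z hz => ?_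
    have hz := Finset.HasAntidiagonal.mem_antidiagonal.1 hz
    by_cases h1 : z.1 ≤ a'
    · by_cases h2 : z.2 ≤ b'
      · have := hmul _ _ _ _ (hp (a' - z.1) z.1 (by omega)) (hq (b' - z.2) z.2 (by omega))
        convert this using 2
        rw [← hz, show i = (a' - z.1) + (b' - z.2) by omega]; ring
      · have : q.coeff z.2 = 0 :=
          Polynomial.coeff_eq_zero_of_natDegree_lt (lt_of_le_of_lt hq' (by omega))
        simp [this]
    · have : p.coeff z.1 = 0 :=
        Polynomial.coeff_eq_zero_of_natDegree_lt (lt_of_le_of_lt hp' (by omega))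
      simp [this])
    (fun m => Polynomial.C (x m) + Polynomial.X * Polynomial.C (v m)) (by
      intro m
      refine ⟨fun i j h => ?_, ?_⟩
      · rcases (by omega : (i = 1 ∧ j = 0) ∨ (i = 0 ∧ j = 1)) with ⟨rfl, rfl⟩ | ⟨rfl, rfl⟩
        · simpa using hx m
        · simpa [Polynomial.coeff_C] using hv m
      · simp only [Set.mem_ofPred_eq]; compute_degree)
  exact h.1 (d - j) j (by omega)

theorem natDegree_linePoly_le {f : MvPolynomial σ k} {d : ℕ} (hf : f.IsHomogeneous d)
    (x v : σ → R) : (linePoly f x v).natDegree ≤ d := by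
  have h := aeval_mem_of_isHomogeneous hf (R := Polynomial R) (fun e =>
    (Polynomial.degreeLE R e).restrictScalars k) (by
      simp [Polynomial.mem_degreeLE]) (by
    intro a b p q hp hq
    simp only [Submodule.restrictScalars_mem, Polynomial.mem_degreeLE] at *
    push_cast
    exact Polynomial.degree_mul_le_of_le hp hq)
    (fun m => Polynomial.C (x m) + Polynomial.X * Polynomial.C (v m)) (by
      intro m
      simp only [Submodule.restrictScalars_mem, Polynomial.mem_degreeLE]
      compute_degree
      simp)
  simp only [Submodule.restrictScalars_mem, Polynomial.mem_degreeLE] at h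
  exact Polynomial.natDegree_le_of_degree_le h

theorem pol_eq_zero_of_lt {f : MvPolynomial σ k} {d : ℕ} (hf : f.IsHomogeneous d)
    (x v : σ → R) {j : ℕ} (hj : d < j) : pol f j x v = 0 :=
  Polynomial.coeff_eq_zero_of_natDegree_lt (lt_of_le_of_lt (natDegree_linePoly_le hf x v) hj)

theorem aeval_add_smul {f : MvPolynomial σ k} {d : ℕ} (hf : f.IsHomogeneous d)
    (x v : σ → R) (s : R) :
    aeval (x + s • v) f = ∑ j ∈ Finset.range (d + 1), pol f j x v * s ^ j := by
  rw [← eval_linePoly, Polynomial.eval_eq_sum_range'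
    (Nat.lt_succ_of_le (natDegree_linePoly_le hf x v))]
  rfl

theorem linePoly_reflect {f : MvPolynomial σ k} {d : ℕ} (hf : f.IsHomogeneous d)
    (x v : σ → R) : linePoly f v x = (linePoly f x v).reflect d := by
  let D : ℕ → Submodule k (Polynomial R × Polynomial R) := fun e =>
    { carrier := {p | p.1.natDegree ≤ e ∧ p.2 = p.1.reflect e}
      add_mem' := by
        rintro a b ⟨ha, ha'⟩ ⟨hb, hb'⟩
        exact ⟨Polynomial.natDegree_add_le_of_degree_le ha hb, by simp [ha', hb']⟩
      zero_mem' := by simp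
      smul_mem' := by
        rintro c b ⟨hb, hb'⟩
        refine ⟨(Polynomial.natDegree_smul_le c _).trans hb, ?_⟩
        ext n
        simp [hb', Polynomial.coeff_reflect] }
  have h := aeval_mem_of_isHomogeneous hf D (by simp [D]) (by
    rintro a b x y ⟨hx, hx'⟩ ⟨hy, hy'⟩
    refine ⟨Polynomial.natDegree_mul_le_of_le hx hy, ?_⟩
    change x.2 * y.2 = _
    rw [hx', hy']
    exact (Polynomial.reflect_mul _ _ hx hy).symm)
    (fun m => (Polynomial.C (x m) + Polynomial.X * Polynomial.C (v m),
      Polynomial.C (v m) + Polynomial.X * Polynomial.C (x m))) (by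
      intro m
      refine ⟨by simp only; compute_degree, ?_⟩
      ext n
      rcases n with _ | _ | n <;> simp)
  have h := h.2
  have e1 := DFunLike.congr_fun (comp_aeval (fun m =>
    (Polynomial.C (x m) + Polynomial.X * Polynomial.C (v m),
      Polynomial.C (v m) + Polynomial.X * Polynomial.C (x m)))
      (AlgHom.fst k (Polynomial R) (Polynomial R))) f
  have e2 := DFunLike.congr_fun (comp_aeval (fun m =>
    (Polynomial.C (x m) + Polynomial.X * Polynomial.C (v m),
      Polynomial.C (v m) + Polynomial.X * Polynomial.C (x m)))
      (AlgHom.snd k (Polynomial R) (Polynomial R))) f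
  simp only [AlgHom.comp_apply, AlgHom.fst_apply, AlgHom.snd_apply] at e1 e2
  rw [e1, e2] at h
  exact h

theorem pol_swap {f : MvPolynomial σ k} {d : ℕ} (hf : f.IsHomogeneous d)
    (x v : σ → R) {j : ℕ} (hj : j ≤ d) : pol f j x v = pol f (d - j) v x := by
  rw [pol, pol, linePoly_reflect hf v x, Polynomial.coeff_reflect, Polynomial.revAt_le hj]

theorem pol_smul_right (f : MvPolynomial σ k) (x v : σ → R) (c : R) (j : ℕ) :
    pol f j x (c • v) = c ^ j * pol f j x v := by
  have h : linePoly f x (c • v) = (linePoly f x v).comp (Polynomial.C c * Polynomial.X) := by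
    have := DFunLike.congr_fun (comp_aeval
      (fun m => Polynomial.C (x m) + Polynomial.X * Polynomial.C (v m))
      ((Polynomial.aeval (Polynomial.C c * Polynomial.X : Polynomial R)).restrictScalars k)) f
    simp only [AlgHom.comp_apply, AlgHom.restrictScalars_apply] at this
    rw [linePoly, linePoly, Polynomial.comp, ← Polynomial.algebraMap_eq, ← Polynomial.aeval_def]
    refine Eq.trans ?_ this.symm
    congr 2
    ext1 m
    simp [Polynomial.aeval_def]; ring
  rw [pol, h, Polynomial.comp_C_mul_X_coeff, pol, mul_comm]

theorem pol_smul_left {f : MvPolynomial σ k} {d : ℕ} (hf : f.IsHomogeneous d) (x v : σ → R)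
    (c : R) {j : ℕ} (hj : j ≤ d) : pol f j (c • x) v = c ^ (d - j) * pol f j x v := by
  rw [pol_swap hf _ _ hj, pol_smul_right, ← pol_swap hf _ _ hj]

theorem pol_zero (f : MvPolynomial σ k) (x v : σ → R) : pol f 0 x v = aeval x f := by
  have := eval_linePoly f x v 0
  rw [← Polynomial.coeff_zero_eq_eval_zero] at this
  simpa [pol] using this

theorem pol_top {f : MvPolynomial σ k} {d : ℕ} (hf : f.IsHomogeneous d) (x v : σ → R) :
    pol f d x v = aeval v f := by
  rw [pol_swap hf _ _ le_rfl, Nat.sub_self, pol_zero]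

theorem pol_one_eq_sum [Fintype σ] (f : MvPolynomial σ k) (x v : σ → R) :
    pol f 1 x v = ∑ m, v m * aeval x (pderiv m f) := by
  classical
  induction f using MvPolynomial.induction_on with
  | C a => simp [pol, linePoly, Polynomial.algebraMap_apply]
  | add p q hp hq =>
    have : pol (p + q) 1 x v = pol p 1 x v + pol q 1 x v := by simp [pol, linePoly]
    rw [this, hp, hq, ← Finset.sum_add_distrib]
    simp [mul_add]
  | mul_X p n hp =>
    have h0 := pol_zero p x v
    have : pol (p * X n) 1 x v = pol p 1 x v * x n + pol p 0 x v * v n := by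
      simp only [pol, linePoly, map_mul, aeval_X, Polynomial.mul_coeff_one]
      simp [Polynomial.coeff_C]; ring
    rw [this, hp, h0]
    simp only [Derivation.leibniz, pderiv_X, smul_eq_mul, map_add, map_mul, aeval_X, mul_add,
      Finset.sum_add_distrib, Finset.sum_mul]
    rw [add_comm]
    congr 1
    · simp [Pi.single_apply, Finset.sum_ite_eq, mul_comm, apply_ite]
    · refine Finset.sum_congr rfl fun i _ => by ring

theorem pol_one_add [Fintype σ] (f : MvPolynomial σ k) (x v w : σ → R) :
    pol f 1 x (v + w) = pol f 1 x v + pol f 1 x w := by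
  simp [pol_one_eq_sum, add_mul, Finset.sum_add_distrib]

theorem pol_one_smul (f : MvPolynomial σ k) (x v : σ → R) (c : R) :
    pol f 1 x (c • v) = c * pol f 1 x v := by
  rw [pol_smul_right, pow_one]

theorem pol_eq_zero_of_forall [Infinite k] [IsDomain k] (f : MvPolynomial σ k) (x v : σ → k)
    (h : ∀ s : k, aeval (x + s • v) f = 0) (j : ℕ) : pol f j x v = 0 := by
  have : linePoly f x v = 0 := Polynomial.funext fun s => by
    rw [eval_linePoly, h, Polynomial.eval_zero]
  rw [pol, this, Polynomial.coeff_zero]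

end Polarization

section CommonZeros

variable {k σ : Type*} [Field k]

theorem homogeneousComponent_mul_totalDegree (g h : MvPolynomial σ k) :
    homogeneousComponent (g.totalDegree + h.totalDegree) (g * h) =
      homogeneousComponent g.totalDegree g * homogeneousComponent h.totalDegree h := by
  have e : g * h = (∑ i ∈ Finset.range (g.totalDegree + 1), homogeneousComponent i g) *
      ∑ j ∈ Finset.range (h.totalDegree + 1), homogeneousComponent j h := by
    rw [sum_homogeneousComponent, sum_homogeneousComponent]
  rw [e, Finset.sum_mul_sum, map_sum]
  rw [Finset.sum_eq_single g.totalDegree]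
  · rw [map_sum, Finset.sum_eq_single h.totalDegree]
    · rw [homogeneousComponent_of_mem
        ((homogeneousComponent_isHomogeneous _ _).mul (homogeneousComponent_isHomogeneous _ _)),
        if_pos rfl]
    · intro j hj hne
      rw [homogeneousComponent_of_mem
        ((homogeneousComponent_isHomogeneous _ _).mul (homogeneousComponent_isHomogeneous _ _)),
        if_neg (by omega)]
    · intro h; simp at h
  · intro i hi hne
    rw [map_sum]
    refine Finset.sum_eq_zero fun j hj => ?_
    rw [Finset.mem_range] at hi hj
    rw [homogeneousComponent_of_mem
        ((homogeneousComponent_isHomogeneous _ _).mul (homogeneousComponent_isHomogeneous _ _)),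
        if_neg (by omega)]
  · intro h; simp at h

/-- The prime ideal generated by the first `j` variables. -/
noncomputable def coordIdeal (k : Type*) [Field k] (n j : ℕ) : Ideal (MvPolynomial (Fin n) k) :=
  RingHom.ker (aeval (fun m : Fin n => if m.val < j then (0 : MvPolynomial (Fin n) k) else X m) :
    MvPolynomial (Fin n) k →ₐ[k] MvPolynomial (Fin n) k)

instance (n j : ℕ) : (coordIdeal k n j).IsPrime := RingHom.ker_isPrime _

theorem coordIdeal_lt {n j : ℕ} (hj : j < n) : coordIdeal k n j < coordIdeal k n (j + 1) := by
  refine lt_of_le_of_ne ?_ ?_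
  · intro p hp
    rw [coordIdeal, RingHom.mem_ker] at *
    have := congrArg (aeval (fun m : Fin n =>
      if m.val < j + 1 then (0 : MvPolynomial (Fin n) k) else X m)) hp
    rw [← AlgHom.comp_apply, comp_aeval, map_zero] at this
    have hfun : (fun m : Fin n => if m.val < j + 1 then (0 : MvPolynomial (Fin n) k) else X m) =
        fun i => aeval (fun m : Fin n => if m.val < j + 1 then (0 : MvPolynomial (Fin n) k)
          else X m) (if i.val < j then (0 : MvPolynomial (Fin n) k) else X i) := by
      ext1 m
      by_cases h : m.val < j
      · simp [h, Nat.lt_succ_of_lt h]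
      · simp [h]
    rw [hfun]
    exact this
  · intro h
    have h1 : (X ⟨j, hj⟩ : MvPolynomial (Fin n) k) ∈ coordIdeal k n (j + 1) := by
      simp [coordIdeal, RingHom.mem_ker]
    rw [← h] at h1
    simp [coordIdeal, RingHom.mem_ker] at h1

theorem le_height_coordIdeal {n j : ℕ} (hj : j ≤ n) : (j : ℕ∞) ≤ (coordIdeal k n j).height := by
  induction j with
  | zero => simp
  | succ j ih =>
    have := Ideal.height_add_one_le_of_lt_of_isPrime (coordIdeal_lt (k := k) (j := j) (n := n) hj)
    refine le_trans ?_ this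
    push_cast
    gcongr
    exact ih (by omega)

variable [IsAlgClosed k]

theorem exists_common_zero {n : ℕ} (hn : 3 ≤ n) (g h : MvPolynomial (Fin n) k)
    (hg : eval 0 g = 0) (hh : eval 0 h = 0) : ∃ v ≠ 0, eval v g = 0 ∧ eval v h = 0 := by
  by_contra! hcon
  have hmem : ∀ p : MvPolynomial (Fin n) k, p ∈ coordIdeal k n n ↔ eval 0 p = 0 := by
    intro p
    have hfun : (fun m : Fin n => if m.val < n then (0 : MvPolynomial (Fin n) k) else X m) =
        fun m => C 0 := by
      ext1 m; simp
    have : aeval (fun m : Fin n => if m.val < n then (0 : MvPolynomial (Fin n) k) else X m) p =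
        C (eval 0 p) := by
      rw [hfun]
      have := DFunLike.congr_fun (comp_aeval (0 : Fin n → k)
        (Algebra.ofId k (MvPolynomial (Fin n) k))) p
      rw [AlgHom.comp_apply] at this
      exact this.symm
    rw [coordIdeal, RingHom.mem_ker, this, C_eq_zero]
  have hmin : coordIdeal k n n ∈ (Ideal.span {g, h}).minimalPrimes := by
    refine ⟨⟨inferInstance, ?_⟩, ?_⟩
    · rw [Ideal.span_le]
      rintro p (rfl | rfl)
      · exact (hmem _).2 hg
      · exact (hmem _).2 hh
    · rintro Q ⟨hQ, hQ'⟩ hle p hp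
      rw [← IsPrime.vanishingIdeal_zeroLocus (K := k) Q, mem_vanishingIdeal_iff]
      intro v hv
      rw [mem_zeroLocus_iff] at hv
      have h1 := hv g (hQ' (Ideal.subset_span (by simp)))
      have h2 := hv h (hQ' (Ideal.subset_span (by simp)))
      have : v = 0 := by
        by_contra hne
        exact hcon v hne (by simpa [aeval_eq_eval] using h1) (by simpa [aeval_eq_eval] using h2)
      rw [this]
      simpa [aeval_eq_eval] using (hmem p).1 hp
  have h2 := Ideal.height_le_card_of_mem_minimalPrimes_span (Set.toFinite _) hmin
  have h3 := le_height_coordIdeal (k := k) (le_refl n)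
  have h4 : ({g, h} : Set (MvPolynomial (Fin n) k)).ncard ≤ 2 := by
    refine (Set.ncard_insert_le _ _).trans ?_
    simp
  have h5 : (n : ℕ∞) ≤ (2 : ℕ) := h3.trans (h2.trans (by exact_mod_cast h4))
  have : n ≤ 2 := by exact_mod_cast h5
  omega

end CommonZeros

section Smooth

variable {k : Type*} [Field k] {f : MvPolynomial (Fin 4) k} {d : ℕ}

theorem eval_zero_of_isHomogeneous {σ : Type*} {g : MvPolynomial σ k} {a : ℕ}
    (hg : g.IsHomogeneous a) (ha : a ≠ 0) : eval 0 g = 0 := by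
  have := aeval_smul_of_isHomogeneous hg (0 : k) 0
  simpa [ha, aeval_eq_eval] using this

theorem IsSmoothSurface.exists_pol_ne_zero (hf : IsSmoothSurface f d) {x : Fin 4 → k}
    (hx : x ≠ 0) (h : aeval x f = 0) : ∃ u, pol f 1 x u ≠ 0 := by
  by_contra! hcon
  refine hf.2.2 x hx ⟨by simpa [aeval_eq_eval] using h, fun i => ?_⟩
  have := hcon (Pi.single i 1)
  rw [pol_one_eq_sum] at this
  simpa [Pi.single_apply, aeval_eq_eval] using this

theorem IsSmoothSurface.prime [IsAlgClosed k] (hf : IsSmoothSurface f d) (hd : d ≠ 0) :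
    Prime f := by
  rw [← UniqueFactorizationMonoid.irreducible_iff_prime]
  refine ⟨?_, ?_⟩
  · intro hu
    have h0 := eval_zero_of_isHomogeneous hf.2.1 hd
    have := hu.map (eval (0 : Fin 4 → k))
    rw [h0] at this
    exact not_isUnit_zero this
  · intro g h hgh
    have hg0 : g ≠ 0 := fun h0 => hf.1 (by rw [hgh, h0, zero_mul])
    have hh0 : h ≠ 0 := fun h0 => hf.1 (by rw [hgh, h0, mul_zero])
    have hdeg : g.totalDegree + h.totalDegree = d := by
      rw [← totalDegree_mul_of_isDomain hg0 hh0, ← hgh, hf.2.1.totalDegree hf.1]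
    have hfac := homogeneousComponent_mul_totalDegree g h
    rw [hdeg, ← hgh, homogeneousComponent_of_mem hf.2.1, if_pos rfl] at hfac
    have hunit : ∀ p : MvPolynomial (Fin 4) k, p ≠ 0 → p.totalDegree = 0 → IsUnit p := by
      intro p hp hp'
      rw [totalDegree_eq_zero_iff_eq_C] at hp'
      rw [hp'] at hp ⊢
      exact (IsUnit.mk0 _ (fun h => hp (by rw [h, C_0]))).map C
    by_cases ha : g.totalDegree = 0
    · exact Or.inl (hunit g hg0 ha)
    by_cases hb : h.totalDegree = 0
    · exact Or.inr (hunit h hh0 hb)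
    exfalso
    obtain ⟨v, hv, h1, h2⟩ := exists_common_zero (by norm_num) _ _
      (eval_zero_of_isHomogeneous (homogeneousComponent_isHomogeneous _ g) ha)
      (eval_zero_of_isHomogeneous (homogeneousComponent_isHomogeneous _ h) hb)
    refine hf.2.2 v hv ⟨?_, fun i => ?_⟩
    · rw [hfac, map_mul, h1, zero_mul]
    · rw [hfac, Derivation.leibniz]
      simp [h1, h2]

end Smooth

section Bezout

variable {κ : Type*} [Field κ]

theorem finrank_restrictTotalDegree_fin_two (m : ℕ) :
    Module.finrank κ (restrictTotalDegree (Fin 2) κ m) * 2 = (m + 1) * (m + 2) := by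
  classical
  have hb := Module.finrank_eq_nat_card_basis
    (basisRestrictSupport κ {n : Fin 2 →₀ ℕ | (n.sum fun _ e => e) ≤ m})
  have hset : {n : Fin 2 →₀ ℕ | (n.sum fun _ e => e) ≤ m} =
      ((Finset.range (m + 1)).biUnion fun j =>
        Finset.finsuppAntidiag (Finset.univ : Finset (Fin 2)) j : Finset (Fin 2 →₀ ℕ)) := by
    ext n
    simp [Finsupp.sum_fintype]
  have hcard : ((Finset.range (m + 1)).biUnion fun j =>
        Finset.finsuppAntidiag (Finset.univ : Finset (Fin 2)) j).card * 2 = (m + 1) * (m + 2) := by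
    rw [Finset.card_biUnion]
    · simp only [Finset.card_finsuppAntidiag_nat_eq_choose, Finset.card_univ, Fintype.card_fin]
      have : ∀ j, (2 + j - 1).choose j = j + 1 := by
        intro j
        rw [show 2 + j - 1 = j + 1 by omega, Nat.choose_succ_self_right]
      simp only [this]
      clear hset hb this
      induction m with
      | zero => simp
      | succ m ih => rw [Finset.sum_range_succ, add_mul, ih]; ring
    · intro i _ j _ hij
      rw [Function.onFun, Finset.disjoint_left]
      intro n h1 h2
      simp only [Finset.mem_finsuppAntidiag] at h1 h2
      exact hij (h1.1.symm.trans h2.1)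
  rw [restrictTotalDegree, hb, hset, ← hcard]
  congr 1
  rw [Nat.card_coe_set_eq, Set.ncard_coe_finset]

theorem exists_separating {σ : Type*} (P : Finset (σ → κ)) (p : σ → κ) (hp : p ∉ P) :
    ∃ Q : MvPolynomial σ κ, Q.totalDegree ≤ P.card ∧ eval p Q ≠ 0 ∧ ∀ q ∈ P, eval q Q = 0 := by
  classical
  induction P using Finset.induction_on with
  | empty => exact ⟨1, by simp⟩
  | insert a P ha ih =>
    obtain ⟨Q, h1, h2, h3⟩ := ih (fun h => hp (Finset.mem_insert_of_mem h))
    have hne : p ≠ a := fun h => hp (h ▸ Finset.mem_insert_self _ _)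
    obtain ⟨i, hi⟩ := Function.ne_iff.1 hne
    refine ⟨Q * (X i - C (a i)), ?_, ?_, ?_⟩
    · rw [Finset.card_insert_of_notMem ha]
      refine (totalDegree_mul _ _).trans (add_le_add h1 ?_)
      exact (totalDegree_sub_C_le _ _).trans (by simp)
    · simp [h2, sub_ne_zero.2 hi]
    · intro q hq
      rcases Finset.mem_insert.1 hq with rfl | hq
      · simp
      · simp [h3 q hq]

theorem finrank_map_mul {σ : Type*} (F : MvPolynomial σ κ) (hF : F ≠ 0)
    (V : Submodule κ (MvPolynomial σ κ)) :
    Module.finrank κ (V.map (LinearMap.mulLeft κ F)) = Module.finrank κ V :=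
  (V.equivMapOfInjective _ (mul_right_injective₀ hF)).finrank_eq.symm

/-- A weak form of Bézout's theorem in the affine plane. -/
theorem card_le_of_prime_of_not_dvd (F G : MvPolynomial (Fin 2) κ) (hF : Prime F) (hFG : ¬ F ∣ G)
    (P : Finset (Fin 2 → κ)) (hP : ∀ p ∈ P, eval p F = 0 ∧ eval p G = 0) :
    P.card ≤ F.totalDegree * G.totalDegree := by
  classical
  set a := F.totalDegree with ha
  set b := G.totalDegree with hb
  have hF0 : F ≠ 0 := hF.ne_zero
  have hG0 : G ≠ 0 := fun h => hFG (h ▸ dvd_zero F)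
  let V := restrictTotalDegree (Fin 2) κ
  obtain ⟨c, hc⟩ : ∃ c, c = P.card := ⟨_, rfl⟩
  let W1 := (V (b + c)).map (LinearMap.mulLeft κ F)
  let W2 := (V (a + c)).map (LinearMap.mulLeft κ G)
  have hinf : W1 ⊓ W2 ≤ (V c).map (LinearMap.mulLeft κ (F * G)) := by
    rintro _ ⟨⟨u, hu, rfl⟩, ⟨w, hw, hw'⟩⟩
    simp only [LinearMap.mulLeft_apply] at hw' ⊢
    have : F ∣ w := ((hF.dvd_mul).1 (Dvd.intro u hw'.symm)).resolve_left hFG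
    obtain ⟨z, rfl⟩ := this
    refine ⟨z, ?_, ?_⟩
    · rcases eq_or_ne z 0 with rfl | hz
      · exact Submodule.zero_mem _
      · have := (mem_restrictTotalDegree _ _ _).1 hw
        rw [totalDegree_mul_of_isDomain hF0 hz] at this
        exact (mem_restrictTotalDegree _ _ _).2 (by omega)
    · rw [LinearMap.mulLeft_apply, ← hw']; ring
  let ev : MvPolynomial (Fin 2) κ →ₗ[κ] (P → κ) :=
    LinearMap.pi fun p => (aeval p.1 : MvPolynomial (Fin 2) κ →ₐ[κ] κ).toLinearMap
  have hev : ∀ Q p, ev Q p = eval p.1 Q := fun Q p => by simp [ev, aeval_eq_eval]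
  have hsup : W1 ⊔ W2 ≤ (V (a + b + c)) ⊓ LinearMap.ker ev := by
    refine sup_le ?_ ?_
    · rintro _ ⟨u, hu, rfl⟩
      refine ⟨(mem_restrictTotalDegree _ _ _).2 ?_, ?_⟩
      · have := (mem_restrictTotalDegree _ _ _).1 hu
        exact (totalDegree_mul _ _).trans (by omega)
      · ext p
        rw [hev]; simp [(hP p.1 p.2).1]
    · rintro _ ⟨u, hu, rfl⟩
      refine ⟨(mem_restrictTotalDegree _ _ _).2 ?_, ?_⟩
      · have := (mem_restrictTotalDegree _ _ _).1 hu
        exact (totalDegree_mul _ _).trans (by omega)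
      · ext p
        rw [hev]; simp [(hP p.1 p.2).2]
  let ev' : V (a + b + c) →ₗ[κ] (P → κ) := ev.comp (V (a + b + c)).subtype
  have hsurj : LinearMap.range ev' = ⊤ := by
    rw [eq_top_iff, ← (Pi.basisFun κ P).span_eq, Submodule.span_le]
    rintro _ ⟨p, rfl⟩
    obtain ⟨Q, h1, h2, h3⟩ := exists_separating (P.erase p.1) p.1 (Finset.notMem_erase _ _)
    have hle := Finset.card_erase_le (s := P) (a := p.1)
    refine ⟨(eval p.1 Q)⁻¹ • ⟨Q, (mem_restrictTotalDegree _ _ _).2 (by omega)⟩, ?_⟩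
    ext q
    rw [map_smul, Pi.smul_apply, LinearMap.comp_apply, hev]
    by_cases hq : q = p
    · subst hq; simp [h2]
    · have : eval q.1 Q = 0 := h3 _ (Finset.mem_erase.2 ⟨fun h => hq (Subtype.ext h), q.2⟩)
      simp [this, hq]
  have hrank := LinearMap.finrank_range_add_finrank_ker ev'
  rw [hsurj, finrank_top, Module.finrank_fintype_fun_eq_card, Fintype.card_coe] at hrank
  have hker : Module.finrank κ (W1 ⊔ W2 : Submodule κ _) ≤
      Module.finrank κ (LinearMap.ker ev') := by
    have e : (LinearMap.ker ev').map (V (a + b + c)).subtype =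
        (V (a + b + c)) ⊓ LinearMap.ker ev := by
      rw [LinearMap.ker_comp, Submodule.map_comap_subtype]
    rw [← Submodule.finrank_map_subtype_eq (V (a + b + c)) (LinearMap.ker ev'), e]
    have : Module.Finite κ (V (a + b + c) ⊓ LinearMap.ker ev : Submodule κ _) :=
      Submodule.finiteDimensional_of_le inf_le_left
    exact Submodule.finrank_mono hsup
  have hdim := Submodule.finrank_sup_add_finrank_inf_eq W1 W2
  have hinf' := Submodule.finrank_mono hinf
  rw [finrank_map_mul _ (mul_ne_zero hF0 hG0)] at hinf'
  rw [finrank_map_mul _ hF0, finrank_map_mul _ hG0] at hdim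
  have d1 := finrank_restrictTotalDegree_fin_two (κ := κ) (a + b + c)
  have d2 := finrank_restrictTotalDegree_fin_two (κ := κ) (b + c)
  have d3 := finrank_restrictTotalDegree_fin_two (κ := κ) (a + c)
  have d4 := finrank_restrictTotalDegree_fin_two (κ := κ) c
  simp only [V] at *
  nlinarith

end Bezout

section SkewLines

variable {k : Type*} [Field k]

theorem exists_basis_of_disjoint (b : Module.Basis (Fin 4) k (Fin 4 → k))
    {M : Submodule k (Fin 4 → k)} (hM : Module.finrank k M = 2)
    (hdis : M ⊓ Submodule.span k {b 2, b 3} = ⊥) :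
    ∃ α β γ δ : k, b 0 + α • b 2 + γ • b 3 ∈ M ∧ b 1 + β • b 2 + δ • b 3 ∈ M ∧
      ∀ v ∈ M, v = b.repr v 0 • (b 0 + α • b 2 + γ • b 3) +
        b.repr v 1 • (b 1 + β • b 2 + δ • b 3) := by
  have hL : Module.finrank k (Submodule.span k {b 2, b 3}) = 2 := by
    have hli : LinearIndependent k ![b 2, b 3] := by
      have := b.linearIndependent.comp ![2, 3] (by decide)
      convert this using 1
      ext i; fin_cases i <;> rfl
    have := finrank_span_eq_card hli
    rwa [Matrix.range_cons_cons_empty, Fintype.card_fin] at this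
  have htop : M ⊔ Submodule.span k {b 2, b 3} = ⊤ := by
    apply Submodule.eq_top_of_finrank_eq
    have := Submodule.finrank_sup_add_finrank_inf_eq M (Submodule.span k {b 2, b 3})
    rw [hdis, finrank_bot, hM, hL] at this
    simpa using this
  have key : ∀ v : Fin 4 → k, ∃ s t : k, v + s • b 2 + t • b 3 ∈ M := by
    intro v
    have hv : v ∈ M ⊔ Submodule.span k {b 2, b 3} := htop ▸ Submodule.mem_top
    obtain ⟨m, hm, l, hl, rfl⟩ := Submodule.mem_sup.1 hv
    obtain ⟨s, t, rfl⟩ := Submodule.mem_span_pair.1 hl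
    refine ⟨-s, -t, ?_⟩
    convert hm using 1
    module
  obtain ⟨α, γ, h0⟩ := key (b 0)
  obtain ⟨β, δ, h1⟩ := key (b 1)
  refine ⟨α, β, γ, δ, h0, h1, fun v hv => ?_⟩
  have hmem : v - b.repr v 0 • (b 0 + α • b 2 + γ • b 3) -
      b.repr v 1 • (b 1 + β • b 2 + δ • b 3) ∈ M ⊓ Submodule.span k {b 2, b 3} := by
    refine ⟨M.sub_mem (M.sub_mem hv (M.smul_mem _ h0)) (M.smul_mem _ h1), ?_⟩
    have hs := b.sum_repr v
    rw [Fin.sum_univ_four] at hs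
    rw [SetLike.mem_coe, Submodule.mem_span_pair]
    refine ⟨b.repr v 2 - b.repr v 0 * α - b.repr v 1 * β,
      b.repr v 3 - b.repr v 0 * γ - b.repr v 1 * δ, ?_⟩
    nth_rw 7 [← hs]
    module
  rw [hdis, Submodule.mem_bot] at hmem
  rw [sub_sub, sub_eq_zero] at hmem
  exact hmem

/-- The linear change of variables attached to a basis. -/
noncomputable def basisChange (b : Module.Basis (Fin 4) k (Fin 4 → k)) :
    MvPolynomial (Fin 4) k ≃ₐ[k] MvPolynomial (Fin 4) k :=
  AlgEquiv.ofAlgHom (aeval fun m => ∑ j, C (b j m) * X j)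
    (aeval fun j => ∑ m, C (b.repr (Pi.single m 1) j) * X m)
    (by
      ext1 j
      have h : ∀ l, ∑ m, b.repr (Pi.single m 1) j * b l m = if l = j then 1 else 0 := by
        intro l
        have h1 : b l = ∑ m, b l m • (Pi.single m (1 : k) : Fin 4 → k) := by
          ext i; simp [Finset.sum_apply, Pi.single_apply]
        have h2 := congrArg (fun v => b.repr v j) h1
        simp only [map_sum, map_smul, Finsupp.coe_finsetSum, Finset.sum_apply, Finsupp.smul_apply,
          smul_eq_mul, Module.Basis.repr_self, Finsupp.single_apply] at h2
        rw [h2]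
        exact Finset.sum_congr rfl fun i _ => mul_comm _ _
      simp only [AlgHom.comp_apply, aeval_X, map_sum, map_mul, AlgHom.id_apply, algHom_C,
        algebraMap_eq, Finset.mul_sum]
      rw [Finset.sum_comm]
      simp only [← mul_assoc, ← C_mul, ← Finset.sum_mul, ← map_sum, h]
      simp)
    (by
      ext1 m
      have h : ∀ l, ∑ j, b j m * b.repr (Pi.single l 1) j = if m = l then 1 else 0 := by
        intro l
        have h2 := congrFun (b.sum_repr (Pi.single l 1)) m
        simp only [Finset.sum_apply, Pi.smul_apply, smul_eq_mul, Pi.single_apply] at h2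
        rw [← h2]
        exact Finset.sum_congr rfl fun i _ => mul_comm _ _
      simp only [AlgHom.comp_apply, aeval_X, map_sum, map_mul, AlgHom.id_apply, algHom_C,
        algebraMap_eq, Finset.mul_sum]
      rw [Finset.sum_comm]
      simp only [← mul_assoc, ← C_mul, ← Finset.sum_mul, ← map_sum, h]
      simp)

/-- Coordinates of the generic point of the family of planes through the line
`span {b 2, b 3}`. -/
noncomputable def skewPoint (b : Module.Basis (Fin 4) k (Fin 4 → k)) :
    MvPolynomial (Fin 4) k ≃ₐ[k] MvPolynomial (Fin 2) (MvPolynomial (Fin 2) k) :=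
  (basisChange b).trans ((renameEquiv k (finSumFinEquiv (m := 2) (n := 2)).symm).trans
    ((renameEquiv k (Equiv.sumComm (Fin 2) (Fin 2))).trans (sumAlgEquiv k (Fin 2) (Fin 2))))

theorem skewPoint_apply (b : Module.Basis (Fin 4) k (Fin 4 → k)) (R : MvPolynomial (Fin 4) k) :
    skewPoint b R = aeval (fun m => C (X 0 * C (b 0 m) + X 1 * C (b 1 m)) +
      (X 0 * C (C (b 2 m)) + X 1 * C (C (b 3 m)))) R := by
  have : (skewPoint b).toAlgHom = aeval (fun m => C (X 0 * C (b 0 m) + X 1 * C (b 1 m)) +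
      (X 0 * C (C (b 2 m)) + X 1 * C (C (b 3 m)))) := by
    ext1 m
    have e0 : (finSumFinEquiv (m := 2) (n := 2)).symm 0 = Sum.inl 0 := rfl
    have e1 : (finSumFinEquiv (m := 2) (n := 2)).symm 1 = Sum.inl 1 := rfl
    have e2 : (finSumFinEquiv (m := 2) (n := 2)).symm 2 = Sum.inr 0 := rfl
    have e3 : (finSumFinEquiv (m := 2) (n := 2)).symm 3 = Sum.inr 1 := rfl
    simp [skewPoint, basisChange, Fin.sum_univ_four, e0, e1, e2, e3]
    ring
  exact DFunLike.congr_fun this R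

end SkewLines

section

attribute [local instance] MvPolynomial.algebraMvPolynomial

theorem prime_map_fractionRing {σ A κ : Type*} [CommRing A] [IsDomain A] [Field κ] [Algebra A κ]
    [IsFractionRing A κ] {g : MvPolynomial σ A} (hg : Prime g) (h : ∀ a, g ∣ C a → a = 0) :
    Prime (map (algebraMap A κ) g) ∧
      ∀ r, map (algebraMap A κ) g ∣ map (algebraMap A κ) r → g ∣ r := by
  have hloc : IsLocalization ((nonZeroDivisors A).map (C (σ := σ))) (MvPolynomial σ κ) :=
    MvPolynomial.isLocalization _ κ
  have hp : (Ideal.span {g}).IsPrime := (Ideal.span_singleton_prime hg.ne_zero).2 hg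
  have hdis : Disjoint (((nonZeroDivisors A).map (C (σ := σ)) : Submonoid (MvPolynomial σ A)) :
      Set (MvPolynomial σ A)) (Ideal.span {g} : Ideal (MvPolynomial σ A)) := by
    rw [Set.disjoint_left]
    rintro _ ⟨a, ha, rfl⟩ hm
    exact nonZeroDivisors.ne_zero ha (h a (Ideal.mem_span_singleton.1 hm))
  have hp' := IsLocalization.isPrime_of_isPrime_disjoint _ (MvPolynomial σ κ) _ hp hdis
  have hu := IsLocalization.under_map_of_isPrime_disjoint _ (MvPolynomial σ κ) hp hdis
  have ham : (algebraMap (MvPolynomial σ A) (MvPolynomial σ κ)) = map (algebraMap A κ) := rfl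
  rw [Ideal.map_span, Set.image_singleton, ham] at hp'
  constructor
  · refine (Ideal.span_singleton_prime ?_).1 hp'
    intro h0
    exact hg.ne_zero (MvPolynomial.map_injective _ (IsFractionRing.injective A κ)
      (by rw [h0, map_zero]))
  · intro r hr
    rw [← Ideal.mem_span_singleton, ← hu, Ideal.mem_comap, Ideal.map_span, Set.image_singleton, ham,
      Ideal.mem_span_singleton]
    exact hr
end

section SkewLinesBound

variable {k : Type*} [Field k]

theorem totalDegree_aeval_le {σ τ A : Type*} [CommRing A] [Algebra k A]
    (y : σ → MvPolynomial τ A) (hy : ∀ m, (y m).totalDegree ≤ 1) (R : MvPolynomial σ k) :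
    (aeval y R).totalDegree ≤ R.totalDegree := by
  rw [← sum_homogeneousComponent R, map_sum, sum_homogeneousComponent R]
  refine (totalDegree_finsetSum _ _).trans (Finset.sup_le fun i hi => ?_)
  have := aeval_mem_of_isHomogeneous (homogeneousComponent_isHomogeneous i R)
    (fun e => (restrictTotalDegree τ A e).restrictScalars k) (by simp [mem_restrictTotalDegree])
    (by
      intro a b x y hx hy
      simp only [Submodule.restrictScalars_mem, mem_restrictTotalDegree] at *
      exact (totalDegree_mul _ _).trans (add_le_add hx hy)) y
    (by simpa [mem_restrictTotalDegree] using hy)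
  simp only [Submodule.restrictScalars_mem, mem_restrictTotalDegree] at this
  exact this.trans (Nat.lt_succ_iff.1 (Finset.mem_range.1 hi))

theorem totalDegree_skewPoint_le (b : Module.Basis (Fin 4) k (Fin 4 → k))
    (R : MvPolynomial (Fin 4) k) : (skewPoint b R).totalDegree ≤ R.totalDegree := by
  rw [skewPoint_apply]
  refine totalDegree_aeval_le _ (fun m => ?_) R
  refine (totalDegree_add _ _).trans (max_le ((totalDegree_C _).le.trans zero_le_one)
    ((totalDegree_add _ _).trans (max_le ?_ ?_)))
  all_goals
    refine (totalDegree_mul _ _).trans ?_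
    rw [totalDegree_C, add_zero]
    exact (totalDegree_X _).le

theorem totalDegree_skewPoint_le_pred [Infinite k] (b : Module.Basis (Fin 4) k (Fin 4 → k))
    {f : MvPolynomial (Fin 4) k} {d : ℕ} (hf : f.IsHomogeneous d)
    (hL : ∀ v ∈ Submodule.span k {b 2, b 3}, eval v f = 0) :
    (skewPoint b f).totalDegree ≤ d - 1 := by
  set U : Fin 4 → MvPolynomial (Fin 2) (MvPolynomial (Fin 2) k) :=
    fun m => C (X 0 * C (b 0 m) + X 1 * C (b 1 m))
  set V : Fin 4 → MvPolynomial (Fin 2) (MvPolynomial (Fin 2) k) :=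
    fun m => X 0 * C (C (b 2 m)) + X 1 * C (C (b 3 m))
  have h1 : skewPoint b f =
      aeval (U + (1 : MvPolynomial (Fin 2) (MvPolynomial (Fin 2) k)) • V) f := by
    rw [skewPoint_apply, one_smul]; rfl
  have hV : aeval V f = 0 := by
    let W : Fin 4 → MvPolynomial (Fin 2) k := fun m => X 0 * C (b 2 m) + X 1 * C (b 3 m)
    have hW : aeval W f = 0 := by
      apply MvPolynomial.funext
      intro t
      rw [map_zero, ← aeval_eq_eval, ← AlgHom.comp_apply, comp_aeval, aeval_eq_eval]
      apply hL
      rw [Submodule.mem_span_pair]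
      refine ⟨t 0, t 1, ?_⟩
      ext m
      simp [W]
    have hVW : V = fun m => (mapAlgHom (Algebra.ofId k (MvPolynomial (Fin 2) k))) (W m) := by
      ext1 m
      simp [V, W, algebraMap_eq]
    rw [hVW, ← comp_aeval, AlgHom.comp_apply, hW, map_zero]
  rw [h1, aeval_add_smul hf, Finset.sum_range_succ, pol_top hf, hV, zero_mul, add_zero]
  refine (totalDegree_finsetSum _ _).trans (Finset.sup_le fun j hj => ?_)
  have hjd := Finset.mem_range.1 hj
  have := pol_mem hf
    (fun e => (restrictTotalDegree (Fin 2) (MvPolynomial (Fin 2) k) e).restrictScalars k)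
    (by simp [mem_restrictTotalDegree])
    (by
      intro a b x y hx hy
      simp only [Submodule.restrictScalars_mem, mem_restrictTotalDegree] at *
      exact (totalDegree_mul _ _).trans (add_le_add hx hy)) 0 1 U V
    (by
      intro m
      simp only [Submodule.restrictScalars_mem, mem_restrictTotalDegree, U]
      exact (totalDegree_C _).le)
    (by
      intro m
      simp only [Submodule.restrictScalars_mem, mem_restrictTotalDegree, V]
      refine (totalDegree_add _ _).trans (max_le ?_ ?_)
      all_goals
        refine (totalDegree_mul _ _).trans ?_
        rw [totalDegree_C, add_zero]
        exact (totalDegree_X _).le) j hjd.le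
  simp only [Submodule.restrictScalars_mem, mem_restrictTotalDegree, mul_zero, zero_add, mul_one]
    at this
  rw [one_pow, mul_one]
  omega

theorem exists_point_of_disjoint [Infinite k] (b : Module.Basis (Fin 4) k (Fin 4 → k))
    {M : Submodule k (Fin 4 → k)} (hM : Module.finrank k M = 2)
    (hdis : M ⊓ Submodule.span k {b 2, b 3} = ⊥) :
    ∃ q : Fin 2 → MvPolynomial (Fin 2) k,
      (∀ v, v ∈ M ↔ b.repr v 2 = eval ![b.repr v 0, b.repr v 1] (q 0) ∧
        b.repr v 3 = eval ![b.repr v 0, b.repr v 1] (q 1)) ∧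
      ∀ R : MvPolynomial (Fin 4) k, (∀ v ∈ M, v ≠ 0 → eval v R = 0) →
        eval q (skewPoint b R) = 0 := by
  obtain ⟨α, β, γ, δ, h0, h1, h⟩ := exists_basis_of_disjoint b hM hdis
  refine ⟨![C α * X 0 + C β * X 1, C γ * X 0 + C δ * X 1],
    fun v => ⟨fun hv => ?_, ?_⟩, fun R hR => ?_⟩
  · have h2 := congrArg (fun v => b.repr v 2) (h v hv)
    have h3 := congrArg (fun v => b.repr v 3) (h v hv)
    simp only [map_add, map_smul, Finsupp.add_apply, Finsupp.smul_apply, Module.Basis.repr_self,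
      smul_eq_mul, Finsupp.single_apply] at h2 h3
    constructor
    · simp at h2 ⊢
      rw [h2]; ring
    · simp at h3 ⊢
      rw [h3]; ring
  · rintro ⟨h2, h3⟩
    simp at h2 h3
    have hs := b.sum_repr v
    rw [Fin.sum_univ_four, h2, h3] at hs
    rw [← hs]
    convert M.add_mem (M.smul_mem (b.repr v 0) h0) (M.smul_mem (b.repr v 1) h1) using 1
    module
  · rw [skewPoint_apply]
    set m0 := b 0 + α • b 2 + γ • b 3
    set m1 := b 1 + β • b 2 + δ • b 3
    have e : ∀ t : Fin 2 → k, eval t (eval ![C α * X 0 + C β * X 1, C γ * X 0 + C δ * X 1]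
        (aeval (fun m => C (X 0 * C (b 0 m) + X 1 * C (b 1 m)) +
          (X 0 * C (C (b 2 m)) + X 1 * C (C (b 3 m))) :
            Fin 4 → MvPolynomial (Fin 2) (MvPolynomial (Fin 2) k)) R)) =
        eval (t 0 • m0 + t 1 • m1) R := by
      intro t
      let q : Fin 2 → MvPolynomial (Fin 2) k := ![C α * X 0 + C β * X 1, C γ * X 0 + C δ * X 1]
      have h2 : ∀ p, eval t (eval q p) = ((aeval t).comp ((aeval q :
          MvPolynomial (Fin 2) (MvPolynomial (Fin 2) k) →ₐ[MvPolynomial (Fin 2) k]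
            MvPolynomial (Fin 2) k).restrictScalars k)) p := fun _ => rfl
      rw [h2, ← AlgHom.comp_apply, comp_aeval, aeval_eq_eval]
      congr 2
      ext m
      simp [m0, m1, q]
      ring
    have hX : X 0 * (eval ![C α * X 0 + C β * X 1, C γ * X 0 + C δ * X 1]
        (aeval (fun m => C (X 0 * C (b 0 m) + X 1 * C (b 1 m)) +
          (X 0 * C (C (b 2 m)) + X 1 * C (C (b 3 m))) :
            Fin 4 → MvPolynomial (Fin 2) (MvPolynomial (Fin 2) k)) R)) = 0 := by
      apply MvPolynomial.funext
      intro t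
      rw [map_mul, e, eval_X, map_zero]
      by_cases ht : t 0 = 0
      · rw [ht, zero_mul]
      · rw [hR, mul_zero]
        · exact M.add_mem (M.smul_mem _ h0) (M.smul_mem _ h1)
        · intro h0
          apply ht
          have := congrArg (fun v => b.repr v 0) h0
          simpa [m0, m1] using this
    exact (mul_eq_zero.1 hX).resolve_left (X_ne_zero 0)

end SkewLinesBound

theorem card_skew_lines_le {k : Type*} [Field k] [Infinite k]
    (b : Module.Basis (Fin 4) k (Fin 4 → k)) {f R : MvPolynomial (Fin 4) k} {d : ℕ}
    (hf : f.IsHomogeneous d) (hprime : Prime f) (hR : ¬ f ∣ R)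
    (hL : ∀ v ∈ Submodule.span k {b 2, b 3}, eval v f = 0)
    (T : Finset (Submodule k (Fin 4 → k))) (hT : ∀ M ∈ T, IsLineOn f M)
    (hdis : ∀ M ∈ T, M ⊓ Submodule.span k {b 2, b 3} = ⊥)
    (hTR : ∀ M ∈ T, ∀ v ∈ M, v ≠ 0 → eval v R = 0) :
    T.card ≤ (d - 1) * R.totalDegree := by
  classical
  rcases T.eq_empty_or_nonempty with rfl | ⟨M₀, hM₀⟩
  · simp
  let A := MvPolynomial (Fin 2) k
  let κ := FractionRing A
  let φ := algebraMap A κ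
  have hφ : Function.Injective φ := IsFractionRing.injective A κ
  choose! q hq hq' using fun M (hM : M ∈ T) =>
    exists_point_of_disjoint b (hT M hM).1 (hdis M hM)
  have hf0 : ∀ M ∈ T, eval (q M) (skewPoint b f) = 0 := fun M hM =>
    hq' M hM f fun v hv _ => (hT M hM).2 v hv
  have hp : Prime (skewPoint b f) := (MulEquiv.prime_iff (skewPoint b)).2 hprime
  obtain ⟨hp', hdvd⟩ := prime_map_fractionRing (κ := κ) hp (by
    rintro a ⟨r, hr⟩
    have := congrArg (eval (q M₀)) hr
    rwa [eval_C, map_mul, hf0 M₀ hM₀, zero_mul] at this)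
  have hndvd : ¬ map φ (skewPoint b f) ∣ map φ (skewPoint b R) := fun h =>
    hR ((map_dvd_iff (skewPoint b)).1 (hdvd _ h))
  have heval : ∀ M g, eval (fun i => φ (q M i)) (map φ g) = φ (eval (q M) g) := by
    intro M g
    rw [eval_map, eval₂_comp]
    rfl
  have hinj : Set.InjOn (fun M i => φ (q M i)) (T : Set (Submodule k (Fin 4 → k))) := by
    intro M hM M' hM' h
    have hqq : q M = q M' := funext fun i => hφ (congrFun h i)
    ext v
    rw [hq M hM, hq M' hM', hqq]
  have := card_le_of_prime_of_not_dvd _ _ hp' hndvd (T.image fun M i => φ (q M i)) (by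
    intro p hp
    obtain ⟨M, hM, rfl⟩ := Finset.mem_image.1 hp
    rw [heval, heval, hf0 M hM, hq' M hM R (hTR M hM), map_zero]
    exact ⟨rfl, rfl⟩)
  rw [Finset.card_image_of_injOn hinj] at this
  refine this.trans (Nat.mul_le_mul ?_ ?_)
  · exact (Finset.sup_mono (support_map_subset _ _)).trans (totalDegree_skewPoint_le_pred b hf hL)
  · exact (Finset.sup_mono (support_map_subset _ _)).trans (totalDegree_skewPoint_le b R)

open Finset in
theorem SimpleGraph.exists_card_not_adj {V : Type*} [Fintype V] [DecidableEq V] (G : SimpleGraph V)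
    [DecidableRel G.Adj] {n : ℕ} (hn : 1 ≤ n)
    (hcard : Fintype.card V = n ^ 4 + n ^ 3 + n + 1)
    (hadj : ∀ v w, G.Adj v w → #{u | G.Adj v u ∧ G.Adj w u} ≤ n - 1)
    (hnon : ∀ v w, v ≠ w → ¬ G.Adj v w → #{u | G.Adj v u ∧ G.Adj w u} ≤ n ^ 2 + 1) :
    ∃ v, n ^ 4 ≤ #{w | w ≠ v ∧ ¬ G.Adj v w} := by
  have : Nonempty V := Fintype.card_pos_iff.1 (by omega)
  obtain ⟨v, hv⟩ := G.exists_minimal_degree_vertex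
  refine ⟨v, ?_⟩
  set κ := G.degree v with hκ
  set T : Finset V := {w | w ≠ v ∧ ¬ G.Adj v w} with hT
  have hdeg : ∀ w, κ ≤ G.degree w := fun w => hv ▸ G.minDegree_le_degree w
  have hsplit : #T + κ + 1 = Fintype.card V := by
    have h1 : (univ : Finset V) = insert v (T ∪ G.neighborFinset v) := by
      ext w
      by_cases h : w = v <;> by_cases h' : G.Adj v w <;> simp [hT, h, h']
    rw [← card_univ, h1, card_insert_of_notMem, card_union_of_disjoint, hκ,
      G.card_neighborFinset_eq_degree]
    · rw [Finset.disjoint_left]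
      intro w hw hw'
      simp [hT] at hw hw'
      exact hw.2 hw'
    · simp [hT]
  have hcount := Finset.sum_card_bipartiteAbove_eq_sum_card_bipartiteBelow
    (s := G.neighborFinset v) (t := T) (fun r m => G.Adj r m)
  have hlow : κ * (κ - n) ≤
      ∑ r ∈ G.neighborFinset v, #(T.bipartiteAbove (fun r m => G.Adj r m) r) := by
    rw [hκ, ← G.card_neighborFinset_eq_degree, ← smul_eq_mul]
    refine card_nsmul_le_sum _ _ _ fun r hr => ?_
    rw [G.card_neighborFinset_eq_degree, ← hκ]
    rw [SimpleGraph.mem_neighborFinset] at hr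
    have h1 : G.neighborFinset r ⊆ insert v (({u | G.Adj v u ∧ G.Adj r u} : Finset V) ∪
        T.bipartiteAbove (fun r m => G.Adj r m) r) := by
      intro w hw
      rw [SimpleGraph.mem_neighborFinset] at hw
      by_cases h : w = v <;> by_cases h' : G.Adj v w <;> simp [hT, h, h', hw, mem_bipartiteAbove]
    have h2 := (card_le_card h1).trans ((card_insert_le _ _).trans
      (Nat.add_le_add_right (card_union_le _ _) 1))
    have h3 := hadj v r hr
    have h4 := hdeg r
    rw [G.card_neighborFinset_eq_degree] at h2
    omega
  have hupp : ∑ m ∈ T, #((G.neighborFinset v).bipartiteBelow (fun r m => G.Adj r m) m) ≤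
      #T * (n ^ 2 + 1) := by
    rw [← smul_eq_mul]
    refine sum_le_card_nsmul _ _ _ fun m hm => ?_
    simp only [hT, mem_filter, mem_univ, true_and] at hm
    refine le_trans (card_le_card ?_) (hnon v m hm.1.symm hm.2)
    intro u hu
    simp only [mem_bipartiteBelow, SimpleGraph.mem_neighborFinset, mem_filter, mem_univ,
      true_and] at hu ⊢
    exact ⟨hu.1, hu.2.symm⟩
  have key : κ * (κ - n) ≤ #T * (n ^ 2 + 1) := hlow.trans (hcount.trans_le hupp)
  by_contra! hlt
  have h1 : n ^ 3 + n + 1 ≤ κ := by omega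
  have h2 : (n ^ 3 + n + 1) * (n ^ 3 + 1) ≤ κ * (κ - n) := Nat.mul_le_mul h1 (by omega)
  have h3 : #T * (n ^ 2 + 1) ≤ n ^ 4 * (n ^ 2 + 1) := Nat.mul_le_mul_right _ hlt.le
  have h4 : n ^ 4 * (n ^ 2 + 1) < (n ^ 3 + n + 1) * (n ^ 3 + 1) := by
    ring_nf
    have : 0 < n ^ 3 := by positivity
    omega
  omega

section Planes

variable {k : Type*} [Field k]

theorem Submodule.exists_mem_forall_notMem [Infinite k] {V : Type*} [AddCommGroup V] [Module k V]
    (E : Submodule k V) (s : Finset (Submodule k V)) (h : ∀ P ∈ s, ¬ E ≤ P) :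
    ∃ u ∈ E, ∀ P ∈ s, u ∉ P := by
  classical
  have := Subspace.biUnion_ne_univ_of_top_notMem (k := k) (E := E)
    (s := s.image fun P => P.comap E.subtype) (by
      intro ht
      obtain ⟨P, hP, hPt⟩ := Finset.mem_image.1 ht
      exact h P hP fun x hx => (hPt ▸ Submodule.mem_top : (⟨x, hx⟩ : E) ∈ P.comap E.subtype))
  obtain ⟨u, hu⟩ := (Set.ne_univ_iff_exists_notMem _).1 this
  refine ⟨u, u.2, fun P hP huP => hu ?_⟩
  simp only [Set.mem_iUnion]
  exact ⟨_, Finset.mem_image_of_mem _ hP, huP⟩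

variable {f : MvPolynomial (Fin 4) k} {d : ℕ}

theorem IsLineOn.pol_eq_zero [Infinite k] {M : Submodule k (Fin 4 → k)} (hM : IsLineOn f M)
    {x v : Fin 4 → k} (hx : x ∈ M) (hv : v ∈ M) (j : ℕ) : pol f j x v = 0 :=
  pol_eq_zero_of_forall f x v (fun s => by
    simpa [aeval_eq_eval] using hM.2 _ (M.add_mem hx (M.smul_mem s hv))) j

theorem finrank_sup_of_inf_eq_bot {M L : Submodule k (Fin 4 → k)} (hM : Module.finrank k M = 2)
    (hL : Module.finrank k L = 2) (h : M ⊓ L = ⊥) : M ⊔ L = ⊤ := by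
  apply Submodule.eq_top_of_finrank_eq
  have := Submodule.finrank_sup_add_finrank_inf_eq M L
  rw [h, finrank_bot, hM, hL] at this
  simpa using this

theorem finrank_inf_of_ne {M L : Submodule k (Fin 4 → k)} (hM : Module.finrank k M = 2)
    (hL : Module.finrank k L = 2) (hne : M ≠ L) (h : M ⊓ L ≠ ⊥) :
    Module.finrank k ↥(M ⊓ L) = 1 ∧ Module.finrank k ↥(M ⊔ L) = 3 := by
  have h1 := Submodule.finrank_sup_add_finrank_inf_eq M L
  have h2 : Module.finrank k ↥(M ⊓ L) ≠ 0 := fun h0 => h (Submodule.finrank_eq_zero.1 h0)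
  have h3 : Module.finrank k ↥(M ⊓ L) < 2 := by
    by_contra! h3
    have e1 := Submodule.eq_of_le_of_finrank_le (inf_le_left : M ⊓ L ≤ M) (hM ▸ h3)
    have e2 := Submodule.eq_of_le_of_finrank_le (inf_le_right : M ⊓ L ≤ L) (hL ▸ h3)
    exact hne (e1.symm.trans e2)
  omega

/-- The tangent hyperplane at `x`, as a linear form. -/
noncomputable def polarForm (f : MvPolynomial (Fin 4) k) (x : Fin 4 → k) : (Fin 4 → k) →ₗ[k] k where
  toFun v := pol f 1 x v
  map_add' := pol_one_add f x
  map_smul' c v := pol_one_smul f x v c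

@[simp]
theorem polarForm_apply (x v : Fin 4 → k) : polarForm f x v = pol f 1 x v := rfl

theorem IsSmoothSurface.polarForm_ne_zero (hf : IsSmoothSurface f d) {x : Fin 4 → k} (hx : x ≠ 0)
    (h : eval x f = 0) : polarForm f x ≠ 0 := by
  obtain ⟨u, hu⟩ := hf.exists_pol_ne_zero hx (by rwa [aeval_eq_eval])
  exact fun h0 => hu (DFunLike.congr_fun h0 u)

theorem IsLineOn.le_ker_polarForm [Infinite k] {M : Submodule k (Fin 4 → k)} (hM : IsLineOn f M)
    {x : Fin 4 → k} (hx : x ∈ M) : M ≤ LinearMap.ker (polarForm f x) :=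
  fun _ hv => hM.pol_eq_zero hx hv 1

theorem exists_eval_ne_zero_of_finrank_eq_three [IsAlgClosed k] (hf : IsSmoothSurface f d)
    (hd : 2 ≤ d) {E : Submodule k (Fin 4 → k)} (hE : Module.finrank k E = 3) :
    ∃ v ∈ E, eval v f ≠ 0 := by
  by_contra! hcon
  obtain ⟨w, hw⟩ : ∃ w, w ∉ E := by
    by_contra! h
    have : E = ⊤ := Submodule.eq_top_iff'.2 h
    rw [this, finrank_top] at hE
    simp at hE
  let b : Module.Basis (Fin 3) k E := Module.finBasisOfFinrankEq k E hE
  let y : Fin 4 → MvPolynomial (Fin 3) k := fun m => ∑ i, C ((b i : Fin 4 → k) m) * X i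
  let g : MvPolynomial (Fin 3) k := pol f 1 y fun m => C (w m)
  have hev : ∀ t : Fin 3 → k, eval t g = pol f 1 (∑ i, t i • (b i : Fin 4 → k)) w := by
    intro t
    rw [← aeval_eq_eval]
    change (aeval t : _ →ₐ[k] k) g = _
    rw [map_pol]
    congr 1
    · ext m; simp [y, mul_comm]
    · ext m; simp
  have hmem : ∀ t : Fin 3 → k, ∑ i, t i • (b i : Fin 4 → k) ∈ E := fun t =>
    E.sum_mem fun i _ => E.smul_mem _ (b i).2
  obtain ⟨t, ht, ht0, -⟩ := exists_common_zero (k := k) le_rfl g 0 (by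
    rw [hev]
    have := pol_smul_left hf.2.1 0 w (0 : k) (j := 1) (by omega)
    rw [zero_smul, zero_pow (by omega), zero_mul] at this
    simpa using this) (by simp)
  set x := ∑ i, t i • (b i : Fin 4 → k) with hx
  have hx0 : x ≠ 0 := by
    intro h0
    apply ht
    have : ∑ i, t i • b i = 0 := by
      apply Subtype.ext
      simpa [hx] using h0
    exact funext (Fintype.linearIndependent_iff.1 b.linearIndependent t this)
  apply hf.polarForm_ne_zero hx0 (hcon x (hmem t))
  have hker : E ≤ LinearMap.ker (polarForm f x) := fun v hv =>
    pol_eq_zero_of_forall f x v (fun s => by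
      simpa [aeval_eq_eval] using hcon _ (E.add_mem (hmem t) (E.smul_mem s hv))) 1
  have hw' : w ∈ LinearMap.ker (polarForm f x) := by
    rw [hev] at ht0
    exact ht0
  rw [← LinearMap.ker_eq_top]
  apply Submodule.eq_top_of_finrank_eq
  have hlt : E < LinearMap.ker (polarForm f x) :=
    lt_of_le_of_ne hker fun h => hw (h ▸ hw')
  have h1 := Submodule.finrank_lt_finrank_of_lt hlt
  have h2 := Submodule.finrank_le (LinearMap.ker (polarForm f x))
  rw [Module.finrank_fin_fun] at *
  omega

theorem card_lines_in_plane_le [IsAlgClosed k] (hf : IsSmoothSurface f d)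
    (hd : 2 ≤ d) {E : Submodule k (Fin 4 → k)} (hE : Module.finrank k E = 3)
    (T : Finset (Submodule k (Fin 4 → k))) (hT : ∀ M ∈ T, IsLineOn f M) (hTE : ∀ M ∈ T, M ≤ E) :
    T.card ≤ d := by
  classical
  obtain ⟨v, hvE, hv⟩ := exists_eval_ne_zero_of_finrank_eq_three hf hd hE
  obtain ⟨u, huE, hu⟩ := E.exists_mem_forall_notMem
    (T.offDiag.image fun p => (p.1 ⊓ p.2) ⊔ Submodule.span k {v}) (by
      intro P hP hle
      obtain ⟨⟨M, M'⟩, hp, rfl⟩ := Finset.mem_image.1 hP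
      obtain ⟨hM, hM', hne⟩ := Finset.mem_offDiag.1 hp
      have h1 := Submodule.finrank_mono hle
      have h2 := Submodule.finrank_add_le_finrank_add_finrank (M ⊓ M') (Submodule.span k {v})
      have h3 := finrank_span_le_card (R := k) ({v} : Set (Fin 4 → k))
      have h4 : Module.finrank k ↥(M ⊓ M') ≤ 1 := by
        by_cases hb : M ⊓ M' = ⊥
        · rw [hb, finrank_bot]; omega
        · exact (finrank_inf_of_ne (hT M hM).1 (hT M' hM').1 hne hb).1.le
      simp at h3
      dsimp only at h1
      omega)
  have hex : ∀ M ∈ T, ∃ s : k, u + s • v ∈ M := by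
    intro M hM
    have hvM : v ∉ M := fun h => hv ((hT M hM).2 v h)
    have hlt : M < M ⊔ Submodule.span k {v} :=
      lt_of_le_of_ne le_sup_left fun h => hvM (by
        rw [h]; exact Submodule.mem_sup_right (Submodule.mem_span_singleton_self v))
    have hle : M ⊔ Submodule.span k {v} ≤ E :=
      sup_le (hTE M hM) ((Submodule.span_singleton_le_iff_mem v E).2 hvE)
    have heq : M ⊔ Submodule.span k {v} = E := by
      apply Submodule.eq_of_le_of_finrank_le hle
      have := Submodule.finrank_lt_finrank_of_lt hlt
      rw [(hT M hM).1] at this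
      omega
    rw [← heq] at huE
    obtain ⟨m, hm, w, hw, rfl⟩ := Submodule.mem_sup.1 huE
    obtain ⟨c, rfl⟩ := Submodule.mem_span_singleton.1 hw
    exact ⟨-c, by simpa using hm⟩
  choose! s hs using hex
  have hcoeff : (linePoly f u v).coeff d ≠ 0 := by
    change pol f d u v ≠ 0
    rw [pol_top hf.2.1, aeval_eq_eval]
    exact hv
  have hne : linePoly f u v ≠ 0 := fun h => hcoeff (by rw [h, Polynomial.coeff_zero])
  have hinj : Set.InjOn s (T : Set (Submodule k (Fin 4 → k))) := by
    intro M hM M' hM' h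
    by_contra hMM
    refine hu _ (Finset.mem_image.2 ⟨(M, M'), Finset.mem_offDiag.2 ⟨hM, hM', hMM⟩, rfl⟩) ?_
    have : u = (u + s M • v) + (-s M) • v := by module
    rw [this]
    refine Submodule.add_mem_sup ⟨hs M hM, ?_⟩
      (Submodule.smul_mem _ _ (Submodule.mem_span_singleton_self v))
    rw [h]
    exact hs M' hM'
  rw [← Finset.card_image_of_injOn hinj]
  refine le_trans ?_ (natDegree_linePoly_le hf.2.1 u v)
  refine le_trans ?_ (Polynomial.card_roots' _)
  refine le_trans (Finset.card_le_card ?_) (Multiset.toFinset_card_le _)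
  intro a ha
  obtain ⟨M, hM, rfl⟩ := Finset.mem_image.1 ha
  rw [Multiset.mem_toFinset, Polynomial.mem_roots hne, Polynomial.IsRoot, eval_linePoly,
    aeval_eq_eval]
  exact (hT M hM).2 _ (hs M hM)

theorem card_common_neighbors_le [IsAlgClosed k] (hf : IsSmoothSurface f d)
    (hd : 2 ≤ d) {L R : Submodule k (Fin 4 → k)} (hL : IsLineOn f L) (hR : IsLineOn f R)
    (hne : L ≠ R) (hLR : L ⊓ R ≠ ⊥)
    (T : Finset (Submodule k (Fin 4 → k))) (hT : ∀ M ∈ T, IsLineOn f M)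
    (hTL : ∀ M ∈ T, L ≠ M ∧ L ⊓ M ≠ ⊥) (hTR : ∀ M ∈ T, R ≠ M ∧ R ⊓ M ≠ ⊥) :
    T.card + 2 ≤ d := by
  classical
  have hE := (finrank_inf_of_ne hL.1 hR.1 hne hLR).2
  have hle : ∀ M ∈ T, M ≤ L ⊔ R := by
    intro M hM
    have h1 := finrank_inf_of_ne hL.1 (hT M hM).1 (hTL M hM).1 (hTL M hM).2
    have h2 := finrank_inf_of_ne hR.1 (hT M hM).1 (hTR M hM).1 (hTR M hM).2
    by_cases hpt : L ⊓ M = R ⊓ M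
    · obtain ⟨x, hx, hx0⟩ := Submodule.exists_mem_ne_zero_of_ne_bot (hTL M hM).2
      have hxR := (hpt ▸ hx : x ∈ R ⊓ M).1
      have hker : Module.finrank k (LinearMap.ker (polarForm f x)) < 4 := by
        have := Submodule.finrank_lt (s := LinearMap.ker (polarForm f x))
          (fun h => hf.polarForm_ne_zero hx0 (hL.2 x hx.1) (LinearMap.ker_eq_top.1 h))
        simpa using this
      have heq : L ⊔ R = LinearMap.ker (polarForm f x) :=
        Submodule.eq_of_le_of_finrank_le
          (sup_le (hL.le_ker_polarForm hx.1) (hR.le_ker_polarForm hxR)) (by omega)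
      rw [heq]
      exact (hT M hM).le_ker_polarForm hx.2
    · have h3 : (L ⊓ M) ⊔ (R ⊓ M) = M := by
        apply Submodule.eq_of_le_of_finrank_le (sup_le inf_le_right inf_le_right)
        rw [(hT M hM).1]
        have hlt : L ⊓ M < (L ⊓ M) ⊔ (R ⊓ M) := by
          refine lt_of_le_of_ne le_sup_left fun h => hpt ?_
          have : R ⊓ M ≤ L ⊓ M := by rw [h]; exact le_sup_right
          exact (Submodule.eq_of_le_of_finrank_le this (by omega)).symm
        have := Submodule.finrank_lt_finrank_of_lt hlt
        omega
      rw [← h3]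
      exact sup_le_sup inf_le_left inf_le_left
  have := card_lines_in_plane_le hf hd hE (insert L (insert R T))
    (by simpa [hL, hR] using hT)
    (by simpa using hle)
  rwa [Finset.card_insert_of_notMem, Finset.card_insert_of_notMem] at this
  · exact fun h => (hTR R h).1 rfl
  · rw [Finset.mem_insert, not_or]
    exact ⟨hne, fun h => (hTL L h).1 rfl⟩

end Planes

section Transversals

variable {k : Type*} [Field k]

theorem Submodule.exists_span_pair_eq [Infinite k] {V : Type*} [AddCommGroup V] [Module k V]
    {W : Submodule k V} (hW : Module.finrank k W = 2)
    (T : Finset (Submodule k V)) (hT : ∀ P ∈ T, ¬ W ≤ P) :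
    ∃ p q, Submodule.span k {p, q} = W ∧ LinearIndependent k ![p, q] ∧ ∀ P ∈ T, p ∉ P := by
  classical
  have : FiniteDimensional k W := Module.finite_of_finrank_pos (by omega)
  have hbot : ¬ W ≤ ⊥ := fun h => by
    rw [le_bot_iff.1 h, finrank_bot] at hW
    omega
  obtain ⟨p, hp, hpT⟩ := W.exists_mem_forall_notMem (insert ⊥ T) (by
    intro P hP
    rcases Finset.mem_insert.1 hP with rfl | hP
    · exact hbot
    · exact hT P hP)
  obtain ⟨q, hq, hqp⟩ := W.exists_mem_forall_notMem {Submodule.span k {p}} (by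
    intro P hP hle
    rw [Finset.mem_singleton.1 hP] at hle
    have h1 := Submodule.finrank_mono hle
    have h2 := finrank_span_le_card (R := k) ({p} : Set V)
    simp at h2
    omega)
  have hp0 : p ≠ 0 := fun h => hpT ⊥ (Finset.mem_insert_self _ _) (h ▸ Submodule.zero_mem _)
  have hli : LinearIndependent k ![p, q] := by
    rw [LinearIndependent.pair_iff' hp0]
    intro a ha
    exact hqp _ (Finset.mem_singleton_self _) (Submodule.mem_span_singleton.2 ⟨a, ha⟩)
  refine ⟨p, q, ?_, hli, fun P hP => hpT P (Finset.mem_insert_of_mem hP)⟩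
  apply Submodule.eq_of_le_of_finrank_le
  · rw [Submodule.span_le]
    rintro x (rfl | rfl)
    · exact hp
    · exact hq
  · have := finrank_span_eq_card hli
    rw [Matrix.range_cons_cons_empty, Fintype.card_fin] at this
    omega

/-- The point of the line through `q₀` and `q₁` at which the tangent hyperplane at `p`
meets it. -/
noncomputable def tangentPoint {σ R : Type*} [CommRing R] [Algebra k R] (f : MvPolynomial σ k)
    (q₀ q₁ p : σ → R) : σ → R :=
  pol f 1 p q₁ • q₀ - pol f 1 p q₀ • q₁

theorem tangentPoint_smul {σ R : Type*} [CommRing R] [Algebra k R] {f : MvPolynomial σ k} {d : ℕ}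
    (hf : f.IsHomogeneous d) (hd : 1 ≤ d) (q₀ q₁ p : σ → R) (c : R) :
    tangentPoint f q₀ q₁ (c • p) = c ^ (d - 1) • tangentPoint f q₀ q₁ p := by
  rw [tangentPoint, tangentPoint, pol_smul_left hf _ _ _ hd, pol_smul_left hf _ _ _ hd, smul_sub,
    mul_smul, mul_smul]

/-- The polar form at the point `tangentPoint f q₀ q₁ (p₁ + s p₀)`, as a polynomial in `s`. -/
noncomputable def tangentPoly (f : MvPolynomial (Fin 4) k) (q₀ q₁ p₀ p₁ w : Fin 4 → k) :
    Polynomial k :=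
  pol f 1 (tangentPoint f (fun m => Polynomial.C (q₀ m)) (fun m => Polynomial.C (q₁ m))
    (fun m => Polynomial.C (p₁ m) + Polynomial.X * Polynomial.C (p₀ m)))
    (fun m => Polynomial.C (w m))

theorem eval_tangentPoly (f : MvPolynomial (Fin 4) k) (q₀ q₁ p₀ p₁ w : Fin 4 → k) (s : k) :
    (tangentPoly f q₀ q₁ p₀ p₁ w).eval s = pol f 1 (tangentPoint f q₀ q₁ (p₁ + s • p₀)) w := by
  rw [tangentPoly, ← Polynomial.coe_aeval_eq_eval]
  change (Polynomial.aeval s : _ →ₐ[k] k) _ = _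
  rw [map_pol]
  congr 1
  · ext m
    simp only [tangentPoint, Pi.sub_apply, Pi.smul_apply, smul_eq_mul, map_sub, map_mul, map_pol]
    simp [Pi.add_def, Pi.smul_def, mul_comm s]
  · ext m; simp

theorem natDegree_tangentPoly_le {f : MvPolynomial (Fin 4) k} {d : ℕ} (hf : f.IsHomogeneous d)
    (hd : 1 ≤ d) (q₀ q₁ p₀ p₁ w : Fin 4 → k) :
    (tangentPoly f q₀ q₁ p₀ p₁ w).natDegree ≤ (d - 1) * (d - 1) := by
  let D : ℕ → Submodule k (Polynomial k) := fun e => Polynomial.degreeLE k e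
  have hD : ∀ e p, p ∈ D e ↔ p.natDegree ≤ e := fun e p => by
    simp only [D, Polynomial.mem_degreeLE]
    exact Polynomial.natDegree_le_iff_degree_le.symm
  have h1 : (1 : Polynomial k) ∈ D 0 := by simp [hD]
  have hmul : ∀ a b x y, x ∈ D a → y ∈ D b → x * y ∈ D (a + b) := by
    intro a b x y hx hy
    rw [hD] at *
    exact Polynomial.natDegree_mul_le_of_le hx hy
  have hC : ∀ c : k, Polynomial.C c ∈ D 0 := by simp [hD]
  have hp : ∀ w : Fin 4 → k, pol f 1 (fun m => Polynomial.C (p₁ m) +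
      Polynomial.X * Polynomial.C (p₀ m)) (fun m => Polynomial.C (w m)) ∈ D (d - 1) := by
    intro w
    have := pol_mem hf D h1 hmul 1 0 (fun m => Polynomial.C (p₁ m) +
      Polynomial.X * Polynomial.C (p₀ m)) (fun m => Polynomial.C (w m)) (by
        intro m
        rw [hD]
        refine Polynomial.natDegree_add_le_of_degree_le (by simp) ?_
        refine (Polynomial.natDegree_mul_C_le _ _).trans Polynomial.natDegree_X_le)
      (fun m => hC _) 1 hd
    simpa using this
  have := pol_mem hf D h1 hmul (d - 1) 0 (tangentPoint f (fun m => Polynomial.C (q₀ m))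
    (fun m => Polynomial.C (q₁ m))
    (fun m => Polynomial.C (p₁ m) + Polynomial.X * Polynomial.C (p₀ m)))
    (fun m => Polynomial.C (w m)) (by
      intro m
      refine (D (d - 1)).sub_mem ?_ ?_
      · simpa using hmul _ _ _ _ (hp q₁) (hC (q₀ m))
      · simpa using hmul _ _ _ _ (hp q₀) (hC (q₁ m))) (fun m => hC _) 1 hd
  rw [hD, mul_zero, add_zero] at this
  exact this

theorem Polynomial.eval_zero_eq_zero_of_forall_ne [Infinite k] (P : Polynomial k) (c : k) (N : ℕ)
    (hN : N ≠ 0) (h : ∀ t, t ≠ 0 → P.eval t = c * t ^ N) : P.eval 0 = 0 := by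
  have : P = Polynomial.C c * Polynomial.X ^ N := by
    apply Polynomial.eq_of_infinite_eval_eq
    refine ((Set.finite_singleton (0 : k)).infinite_compl).mono fun t ht => ?_
    simpa using h t ht
  rw [this]
  simp [hN]

variable {f : MvPolynomial (Fin 4) k} {d : ℕ}

theorem tangentPoint_mem {W : Submodule k (Fin 4 → k)} {q₀ q₁ : Fin 4 → k}
    (hW : Submodule.span k {q₀, q₁} = W) (p : Fin 4 → k) : tangentPoint f q₀ q₁ p ∈ W := by
  rw [← hW]
  exact sub_mem (Submodule.smul_mem _ _ (Submodule.subset_span (by simp)))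
    (Submodule.smul_mem _ _ (Submodule.subset_span (by simp)))

theorem polarForm_eq_zero_of_sup_eq_top {x : Fin 4 → k} {W₁ W₂ : Submodule k (Fin 4 → k)}
    (h : W₁ ⊔ W₂ = ⊤) (h₁ : W₁ ≤ LinearMap.ker (polarForm f x))
    (h₂ : W₂ ≤ LinearMap.ker (polarForm f x)) : polarForm f x = 0 := by
  rw [← LinearMap.ker_eq_top, ← top_le_iff, ← h]
  exact sup_le h₁ h₂

theorem tangentPoint_ne_zero [Infinite k] (hf : IsSmoothSurface f d)
    {W₁ W₂ : Submodule k (Fin 4 → k)} (h₁ : IsLineOn f W₁) (h₂ : IsLineOn f W₂)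
    (hdis : W₁ ⊓ W₂ = ⊥) {q₀ q₁ : Fin 4 → k} (hq : Submodule.span k {q₀, q₁} = W₂)
    (hli : LinearIndependent k ![q₀, q₁]) {p : Fin 4 → k} (hp : p ∈ W₁) (hp0 : p ≠ 0) :
    tangentPoint f q₀ q₁ p ≠ 0 := by
  intro h0
  have h := LinearIndependent.pair_iff.1 hli (pol f 1 p q₁) (-pol f 1 p q₀) (by
    rw [neg_smul, ← sub_eq_add_neg]; exact h0)
  apply hf.polarForm_ne_zero hp0 (h₁.2 p hp)
  apply polarForm_eq_zero_of_sup_eq_top (finrank_sup_of_inf_eq_bot h₁.1 h₂.1 hdis)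
    (h₁.le_ker_polarForm hp)
  rw [← hq, Submodule.span_le]
  rintro x (rfl | rfl)
  · simpa using h.2
  · simpa using h.1

theorem exists_pol_tangentPoint_ne_zero [IsAlgClosed k] (hf : IsSmoothSurface f d) (hd : 3 ≤ d)
    {W₁ W₂ : Submodule k (Fin 4 → k)} (h₁ : IsLineOn f W₁) (h₂ : IsLineOn f W₂)
    (hdis : W₁ ⊓ W₂ = ⊥) {p₀ p₁ q₀ q₁ : Fin 4 → k} (hp : Submodule.span k {p₀, p₁} = W₁)
    (hpli : LinearIndependent k ![p₀, p₁])
    (hq : Submodule.span k {q₀, q₁} = W₂) (hli : LinearIndependent k ![q₀, q₁]) :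
    ∃ s : k, pol f 1 (tangentPoint f q₀ q₁ (p₁ + s • p₀)) (p₁ + s • p₀) ≠ 0 := by
  by_contra! hcon
  have hp₀ : p₀ ∈ W₁ := hp ▸ Submodule.subset_span (by simp)
  have hp₁ : p₁ ∈ W₁ := hp ▸ Submodule.subset_span (by simp)
  have key : ∀ p ∈ W₁, p ≠ 0 → pol f 1 (tangentPoint f q₀ q₁ p) p₀ = 0 →
      pol f 1 (tangentPoint f q₀ q₁ p) p₁ = 0 → False := by
    intro p hpW hp0 e0 e1
    have hmem := tangentPoint_mem (f := f) hq p
    apply hf.polarForm_ne_zero (tangentPoint_ne_zero hf h₁ h₂ hdis hq hli hpW hp0) (h₂.2 _ hmem)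
    apply polarForm_eq_zero_of_sup_eq_top (finrank_sup_of_inf_eq_bot h₁.1 h₂.1 hdis) _
      (h₂.le_ker_polarForm hmem)
    rw [← hp, Submodule.span_le]
    rintro x (rfl | rfl)
    · exact e0
    · exact e1
  have hne : ∀ s : k, p₁ + s • p₀ ≠ 0 := by
    intro s h0
    have := LinearIndependent.pair_iff.1 hpli s 1 (by rw [one_smul, add_comm]; exact h0)
    exact one_ne_zero this.2
  have hrel : ∀ s : k, pol f 1 (tangentPoint f q₀ q₁ (p₁ + s • p₀)) p₁ =
      -s * pol f 1 (tangentPoint f q₀ q₁ (p₁ + s • p₀)) p₀ := by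
    intro s
    have := hcon s
    rw [pol_one_add, pol_one_smul] at this
    linear_combination this
  obtain ⟨c, hc⟩ : ∃ c, ∀ s : k, pol f 1 (tangentPoint f q₀ q₁ (p₁ + s • p₀)) p₀ = c := by
    have hdeg : (tangentPoly f q₀ q₁ p₀ p₁ p₀).degree = 0 ∨ tangentPoly f q₀ q₁ p₀ p₁ p₀ = 0 := by
      by_contra! hdeg
      obtain ⟨s, hs⟩ := IsAlgClosed.exists_root _ hdeg.1
      rw [Polynomial.IsRoot, eval_tangentPoly] at hs
      refine key _ (W₁.add_mem hp₁ (W₁.smul_mem s hp₀)) (hne s) hs ?_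
      rw [hrel, hs, mul_zero]
    rcases hdeg with hdeg | hdeg
    · refine ⟨(tangentPoly f q₀ q₁ p₀ p₁ p₀).coeff 0, fun s => ?_⟩
      rw [← eval_tangentPoly, Polynomial.eq_C_of_degree_eq_zero hdeg]
      simp
    · exact ⟨0, fun s => by rw [← eval_tangentPoly, hdeg, Polynomial.eval_zero]⟩
  have hd2 : 2 ≤ (d - 1) * (d - 1) := by
    have : 2 * 2 ≤ (d - 1) * (d - 1) := Nat.mul_le_mul (by omega) (by omega)
    omega
  have hrev : ∀ (t : k) (w : Fin 4 → k), t ≠ 0 → pol f 1 (tangentPoint f q₀ q₁ (p₀ + t • p₁)) w =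
      t ^ ((d - 1) * (d - 1)) * pol f 1 (tangentPoint f q₀ q₁ (p₁ + t⁻¹ • p₀)) w := by
    intro t w ht
    have : p₀ + t • p₁ = t • (p₁ + t⁻¹ • p₀) := by
      rw [smul_add, smul_smul, mul_inv_cancel₀ ht, one_smul, add_comm]
    rw [this, tangentPoint_smul hf.2.1 (by omega), pol_smul_left hf.2.1 _ _ _ (by omega), ← pow_mul]
  refine key p₀ hp₀ (hpli.ne_zero 0) ?_ ?_
  · have := Polynomial.eval_zero_eq_zero_of_forall_ne (tangentPoly f q₀ q₁ p₁ p₀ p₀) c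
      ((d - 1) * (d - 1)) (by omega) (by
        intro t ht
        rw [eval_tangentPoly, hrev t _ ht, hc, mul_comm])
    simpa [eval_tangentPoly] using this
  · have := Polynomial.eval_zero_eq_zero_of_forall_ne (tangentPoly f q₀ q₁ p₁ p₀ p₁) (-c)
      ((d - 1) * (d - 1) - 1) (by omega) (by
        intro t ht
        rw [eval_tangentPoly, hrev t _ ht, hrel, hc]
        obtain ⟨N, hN⟩ : ∃ N, (d - 1) * (d - 1) = N + 1 := ⟨(d - 1) * (d - 1) - 1, by omega⟩
        rw [hN, Nat.add_sub_cancel, pow_succ]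
        field_simp)
    simpa [eval_tangentPoly] using this

theorem card_transversals_le [IsAlgClosed k] (hf : IsSmoothSurface f d) (hd : 3 ≤ d)
    {W₁ W₂ : Submodule k (Fin 4 → k)} (h₁ : IsLineOn f W₁) (h₂ : IsLineOn f W₂)
    (hdis : W₁ ⊓ W₂ = ⊥) (T : Finset (Submodule k (Fin 4 → k))) (hT : ∀ M ∈ T, IsLineOn f M)
    (hT₁ : ∀ M ∈ T, W₁ ⊓ M ≠ ⊥) (hT₂ : ∀ M ∈ T, W₂ ⊓ M ≠ ⊥) :
    T.card ≤ (d - 1) ^ 2 + 1 := by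
  classical
  obtain ⟨p₀, p₁, hp, hpli, hpT⟩ := Submodule.exists_span_pair_eq h₁.1 T (by
    intro M hM hle
    have : W₁ = M := Submodule.eq_of_le_of_finrank_le hle (by rw [h₁.1, (hT M hM).1])
    exact hT₂ M hM (by rw [← this, inf_comm, hdis]))
  obtain ⟨q₀, q₁, hq, hqli, -⟩ := Submodule.exists_span_pair_eq h₂.1 ∅ (by simp)
  have hp₀ : p₀ ∈ W₁ := hp ▸ Submodule.subset_span (by simp)
  have hp₁ : p₁ ∈ W₁ := hp ▸ Submodule.subset_span (by simp)
  have hne : ∀ s : k, p₁ + s • p₀ ≠ 0 := by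
    intro s h0
    have := LinearIndependent.pair_iff.1 hpli s 1 (by rw [one_smul, add_comm]; exact h0)
    exact one_ne_zero this.2
  have hex : ∀ M ∈ T, ∃ s : k, p₁ + s • p₀ ∈ M := by
    intro M hM
    obtain ⟨x, hx, hx0⟩ := Submodule.exists_mem_ne_zero_of_ne_bot (hT₁ M hM)
    have hxW := hx.1
    rw [SetLike.mem_coe, ← hp, Submodule.mem_span_pair] at hxW
    obtain ⟨a, b, rfl⟩ := hxW
    have hb : b ≠ 0 := by
      rintro rfl
      rw [zero_smul, add_zero] at hx hx0
      have ha : a ≠ 0 := by rintro rfl; simp at hx0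
      exact hpT M hM ((M.smul_mem_iff ha).1 hx.2)
    refine ⟨b⁻¹ * a, ?_⟩
    have := M.smul_mem b⁻¹ hx.2
    rwa [smul_add, smul_smul, smul_smul, inv_mul_cancel₀ hb, one_smul, add_comm] at this
  choose! s hs using hex
  have htan : ∀ M ∈ T, tangentPoint f q₀ q₁ (p₁ + s M • p₀) ∈ M := by
    intro M hM
    obtain ⟨y, hy, hy0⟩ := Submodule.exists_mem_ne_zero_of_ne_bot (hT₂ M hM)
    have hyW := hy.1
    rw [SetLike.mem_coe, ← hq, Submodule.mem_span_pair] at hyW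
    obtain ⟨c, e, rfl⟩ := hyW
    have h0 := (hT M hM).pol_eq_zero (hs M hM) hy.2 1
    rw [pol_one_add, pol_one_smul, pol_one_smul] at h0
    rw [tangentPoint]
    set a := pol f 1 (p₁ + s M • p₀) q₀
    set b := pol f 1 (p₁ + s M • p₀) q₁
    by_cases hc : c = 0
    · subst hc
      have he : e ≠ 0 := by rintro rfl; simp at hy0
      have hb : b = 0 := by simpa [he] using h0
      rw [zero_smul, zero_add] at hy
      rw [hb, zero_smul, zero_sub]
      exact M.neg_mem (M.smul_mem _ ((M.smul_mem_iff he).1 hy.2))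
    · rw [← M.smul_mem_iff hc]
      have : c • (b • q₀ - a • q₁) = b • (c • q₀ + e • q₁) := by
        rw [smul_sub, smul_smul, smul_smul, smul_add, smul_smul, smul_smul,
          eq_neg_of_add_eq_zero_left h0, neg_smul, sub_neg_eq_add, mul_comm c b, mul_comm e b]
      rw [this]
      exact M.smul_mem _ hy.2
  have hinj : Set.InjOn s (T : Set (Submodule k (Fin 4 → k))) := by
    intro M hM M' hM' h
    by_contra hMM
    have e1 : p₁ + s M • p₀ ∈ M ⊓ M' := ⟨hs M hM, h ▸ hs M' hM'⟩
    have e2 : tangentPoint f q₀ q₁ (p₁ + s M • p₀) ∈ M ⊓ M' := ⟨htan M hM, h ▸ htan M' hM'⟩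
    have hW : p₁ + s M • p₀ ∈ W₁ := W₁.add_mem hp₁ (W₁.smul_mem _ hp₀)
    have hfr := (finrank_inf_of_ne (hT M hM).1 (hT M' hM').1 hMM (fun hb =>
      hne (s M) ((Submodule.mem_bot k).1 (hb ▸ e1)))).1
    obtain ⟨c, hc⟩ := (finrank_eq_one_iff_of_nonzero' (⟨_, e1⟩ : ↥(M ⊓ M'))
      (fun h0 => hne (s M) (congrArg Subtype.val h0))).1 hfr ⟨_, e2⟩
    have hc' : c • (p₁ + s M • p₀) = tangentPoint f q₀ q₁ (p₁ + s M • p₀) :=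
      congrArg Subtype.val hc
    apply tangentPoint_ne_zero hf h₁ h₂ hdis hq hqli hW (hne (s M))
    rw [← Submodule.mem_bot k, ← hdis]
    exact ⟨hc' ▸ W₁.smul_mem c hW, tangentPoint_mem hq _⟩
  let θ := tangentPoly f q₀ q₁ p₀ p₁ p₁ + Polynomial.X * tangentPoly f q₀ q₁ p₀ p₁ p₀
  have hθ : ∀ t : k, θ.eval t =
      pol f 1 (tangentPoint f q₀ q₁ (p₁ + t • p₀)) (p₁ + t • p₀) := by
    intro t
    simp only [θ, Polynomial.eval_add, Polynomial.eval_mul, Polynomial.eval_X, eval_tangentPoly]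
    rw [pol_one_add, pol_one_smul]
  have hθ0 : θ ≠ 0 := by
    obtain ⟨t, ht⟩ := exists_pol_tangentPoint_ne_zero hf hd h₁ h₂ hdis hp hpli hq hqli
    rw [← hθ] at ht
    rintro h0
    rw [h0] at ht
    simp at ht
  have hdeg : θ.natDegree ≤ (d - 1) ^ 2 + 1 := by
    rw [sq]
    refine Polynomial.natDegree_add_le_of_degree_le
      ((natDegree_tangentPoly_le hf.2.1 (by omega) _ _ _ _ _).trans (Nat.le_succ _)) ?_
    rw [add_comm]
    exact Polynomial.natDegree_mul_le_of_le Polynomial.natDegree_X_le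
      (natDegree_tangentPoly_le hf.2.1 (by omega) _ _ _ _ _)
  rw [← Finset.card_image_of_injOn hinj]
  refine le_trans ?_ ((Polynomial.card_roots' _).trans hdeg)
  refine le_trans (Finset.card_le_card ?_) (Multiset.toFinset_card_le _)
  intro a ha
  obtain ⟨M, hM, rfl⟩ := Finset.mem_image.1 ha
  rw [Multiset.mem_toFinset, Polynomial.mem_roots hθ0, Polynomial.IsRoot, hθ]
  exact (hT M hM).pol_eq_zero (htan M hM) (hs M hM) 1

end Transversals

theorem exists_many_skew_lines {k : Type*} [Field k] [IsAlgClosed k] {d : ℕ} (hd : 3 < d)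
    {f : MvPolynomial (Fin 4) k} (hf : IsSmoothSurface f d)
    (hcount : {W : Submodule k (Fin 4 → k) | IsLineOn f W}.ncard =
      d ^ 2 * (d ^ 2 - 3 * d + 3)) :
    {W : Submodule k (Fin 4 → k) | IsLineOn f W}.Finite ∧ ∃ L, IsLineOn f L ∧
      ∃ T : Finset (Submodule k (Fin 4 → k)), (d - 1) ^ 4 ≤ T.card ∧
        ∀ M ∈ T, IsLineOn f M ∧ M ⊓ L = ⊥ := by
  classical
  obtain ⟨n, rfl⟩ : ∃ n, d = n + 1 := ⟨d - 1, by omega⟩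
  have hN : (n + 1) ^ 2 * ((n + 1) ^ 2 - 3 * (n + 1) + 3) = n ^ 4 + n ^ 3 + n + 1 := by
    obtain ⟨m, rfl⟩ : ∃ m, n = m + 3 := ⟨n - 3, by omega⟩
    have : (m + 3 + 1) ^ 2 - 3 * (m + 3 + 1) + 3 = m ^ 2 + 5 * m + 7 := by
      have : (m + 3 + 1) ^ 2 = m ^ 2 + 5 * m + 4 + 3 * (m + 3 + 1) := by ring
      omega
    rw [this]
    ring
  have hfin : {W : Submodule k (Fin 4 → k) | IsLineOn f W}.Finite := by
    apply Set.finite_of_ncard_ne_zero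
    rw [hcount, hN]
    omega
  refine ⟨hfin, ?_⟩
  have : Fintype {W : Submodule k (Fin 4 → k) | IsLineOn f W} := hfin.fintype
  let V := {W : Submodule k (Fin 4 → k) | IsLineOn f W}
  have hV : ∀ M : V, IsLineOn f (M : Submodule k (Fin 4 → k)) := fun M => M.2
  let G : SimpleGraph V :=
    { Adj := fun L M => (L : Submodule k (Fin 4 → k)) ≠ M ∧ (L : Submodule k (Fin 4 → k)) ⊓ M ≠ ⊥
      symm := ⟨fun L M h => ⟨h.1.symm, by rw [inf_comm]; exact h.2⟩⟩
      loopless := ⟨fun L h => h.1 rfl⟩ }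
  have hadj : ∀ L M : V, G.Adj L M ↔ (L : Submodule k (Fin 4 → k)) ≠ M ∧
    (L : Submodule k (Fin 4 → k)) ⊓ M ≠ ⊥ := fun L M => Iff.rfl
  obtain ⟨L, hL⟩ := G.exists_card_not_adj (n := n) (by omega)
    (by rw [← hN, ← hcount, Set.ncard_eq_toFinset_card', Set.toFinset_card])
    (by
      intro L R h
      have := card_common_neighbors_le hf (by omega) (hV L) (hV R) h.1 h.2
        (({u | G.Adj L u ∧ G.Adj R u} : Finset V).map (Function.Embedding.subtype _))
        (by
          intro M hM
          obtain ⟨M, -, rfl⟩ := Finset.mem_map.1 hM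
          exact hV M)
        (by
          intro M hM
          obtain ⟨M, hMG, rfl⟩ := Finset.mem_map.1 hM
          exact (Finset.mem_filter.1 hMG).2.1)
        (by
          intro M hM
          obtain ⟨M, hMG, rfl⟩ := Finset.mem_map.1 hM
          exact (Finset.mem_filter.1 hMG).2.2)
      rw [Finset.card_map] at this
      omega)
    (by
      intro L R hne h
      rw [hadj, not_and, not_not] at h
      have := card_transversals_le hf (by omega) (hV L) (hV R) (h fun h => hne (Subtype.ext h))
        (({u | G.Adj L u ∧ G.Adj R u} : Finset V).map (Function.Embedding.subtype _))
        (by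
          intro M hM
          obtain ⟨M, -, rfl⟩ := Finset.mem_map.1 hM
          exact hV M)
        (by
          intro M hM
          obtain ⟨M, hMG, rfl⟩ := Finset.mem_map.1 hM
          exact (Finset.mem_filter.1 hMG).2.1.2)
        (by
          intro M hM
          obtain ⟨M, hMG, rfl⟩ := Finset.mem_map.1 hM
          exact (Finset.mem_filter.1 hMG).2.2.2)
      rwa [Finset.card_map] at this)
  refine ⟨L, hV L, ({w | w ≠ L ∧ ¬ G.Adj L w} : Finset V).map (Function.Embedding.subtype _),
    by rwa [Finset.card_map], ?_⟩
  intro M hM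
  obtain ⟨M, hMG, rfl⟩ := Finset.mem_map.1 hM
  refine ⟨hV M, ?_⟩
  obtain ⟨h1, h2⟩ := (Finset.mem_filter.1 hMG).2
  rw [hadj, not_and, not_not] at h2
  rw [inf_comm]
  exact h2 fun h => h1 (Subtype.ext h.symm)

section PolarPolynomials

variable {σ : Type*} {k : Type*} [Field k]

/-- The `j`-th polar form in a fixed direction `v`, as a polynomial in the base point. -/
noncomputable def polPoly (f : MvPolynomial σ k) (j : ℕ) (v : σ → k) : MvPolynomial σ k :=
  pol f j X (fun m => C (v m))

theorem aeval_polPoly {R : Type*} [CommRing R] [Algebra k R] (f : MvPolynomial σ k) (j : ℕ)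
    (v : σ → k) (x : σ → R) :
    aeval x (polPoly f j v) = pol f j x (fun m => algebraMap k R (v m)) := by
  rw [polPoly, map_pol]
  simp [algHom_C]

theorem eval_polPoly (f : MvPolynomial σ k) (j : ℕ) (v x : σ → k) :
    eval x (polPoly f j v) = pol f j x v := by
  rw [← aeval_eq_eval, aeval_polPoly]
  rfl

theorem isHomogeneous_polPoly {f : MvPolynomial σ k} {d : ℕ} (hf : f.IsHomogeneous d) {j : ℕ}
    (hj : j ≤ d) (v : σ → k) : (polPoly f j v).IsHomogeneous (d - j) := by
  have := pol_mem hf (fun e => homogeneousSubmodule σ k e)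
    ((mem_homogeneousSubmodule _ _).2 (isHomogeneous_one σ k))
    (fun a b x y hx hy => by
      rw [mem_homogeneousSubmodule] at *
      exact hx.mul hy) 1 0 X (fun m => C (v m))
    (fun m => (mem_homogeneousSubmodule _ _).2 (isHomogeneous_X k m))
    (fun m => (mem_homogeneousSubmodule _ _).2 (isHomogeneous_C σ (v m))) j hj
  rwa [mem_homogeneousSubmodule, mul_one, mul_zero, add_zero] at this

end PolarPolynomials

section GoodPoint

variable {k : Type*} [Field k] {f : MvPolynomial (Fin 4) k} {d : ℕ}

/-- Polynomials over `k[z]` all of whose coefficients have degree at most `e`. -/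
def coeffDegreeLE (k : Type*) [Field k] (e : ℕ) : Submodule k (Polynomial (Polynomial k)) where
  carrier := {p | ∀ j, (p.coeff j).natDegree ≤ e}
  add_mem' {p q} hp hq j := by
    rw [Polynomial.coeff_add]
    exact Polynomial.natDegree_add_le_of_degree_le (hp j) (hq j)
  zero_mem' j := by simp
  smul_mem' c p hp j := by
    rw [Polynomial.coeff_smul]
    exact (Polynomial.natDegree_smul_le _ _).trans (hp j)

theorem mul_mem_coeffDegreeLE (a b : ℕ) (p q : Polynomial (Polynomial k))
    (hp : p ∈ coeffDegreeLE k a) (hq : q ∈ coeffDegreeLE k b) :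
    p * q ∈ coeffDegreeLE k (a + b) := by
  intro j
  rw [Polynomial.coeff_mul]
  exact Polynomial.natDegree_sum_le_of_forall_le _ _ fun x _ =>
    Polynomial.natDegree_mul_le_of_le (hp _) (hq _)

theorem Polynomial.eq_zero_of_aeval_div_eq_zero {K : Type*} [Field K] [Algebra (Polynomial k) K]
    [IsFractionRing (Polynomial k) K] (F : Polynomial (Polynomial k)) (a b : Polynomial k)
    (hab : IsCoprime a b) (hF : ∀ j, (F.coeff j).natDegree < b.natDegree)
    (h : aeval (algebraMap (Polynomial k) K a / algebraMap (Polynomial k) K b) F = 0) : F = 0 := by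
  set r := algebraMap (Polynomial k) K a / algebraMap (Polynomial k) K b
  have hb : algebraMap (Polynomial k) K b ≠ 0 := by
    rw [Ne, FaithfulSMul.algebraMap_eq_zero_iff]
    rintro rfl
    simpa using hF 0
  have hden : algebraMap (Polynomial k) K (IsFractionRing.den (Polynomial k) r) ≠ 0 := by
    rw [Ne, FaithfulSMul.algebraMap_eq_zero_iff]
    exact nonZeroDivisors.ne_zero (IsFractionRing.den (Polynomial k) r).2
  have h1 : IsFractionRing.num (Polynomial k) r * b =
      a * (IsFractionRing.den (Polynomial k) r : Polynomial k) := by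
    apply FaithfulSMul.algebraMap_injective (Polynomial k) K
    rw [map_mul, map_mul]
    have h2 := IsFractionRing.mk'_num_den (Polynomial k) r
    rw [IsFractionRing.mk'_eq_div] at h2
    rw [div_eq_iff hden] at h2
    rw [h2]
    simp only [r]
    field_simp
  have h3 : b ∣ (IsFractionRing.den (Polynomial k) r : Polynomial k) :=
    hab.symm.dvd_of_dvd_mul_left (Dvd.intro_left _ h1)
  have h4 := h3.trans (den_dvd_of_is_root h)
  by_contra hne
  have := Polynomial.natDegree_le_of_dvd h4 (by simpa using hne)
  exact absurd (hF F.natDegree) (by simpa using this)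

theorem IsLineOn.pol_eq_zero_of_forall_tangent [IsAlgClosed k] (hf : IsSmoothSurface f d)
    {i : ℕ} (hi : 2 ≤ i) (hid : i ≤ d)
    (hcon : ∀ x v, eval x f = 0 → pol f 1 x v = 0 → pol f i x v = 0)
    {M : Submodule k (Fin 4 → k)} (hM : IsLineOn f M) (v : Fin 4 → k) {x : Fin 4 → k}
    (hx : x ∈ M) (hx0 : x ≠ 0) : pol f i x v = 0 := by
  classical
  by_cases hv : v ∈ M
  · exact hM.pol_eq_zero hx hv i
  have hfin : FiniteDimensional k M := Module.finite_of_finrank_pos (by rw [hM.1]; omega)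
  obtain ⟨y, hyM, hy⟩ : ∃ y ∈ M, y ∉ Submodule.span k {x} := by
    by_contra! hc
    have := Submodule.finrank_mono (show M ≤ Submodule.span k {x} from hc)
    rw [hM.1, finrank_span_singleton hx0] at this
    omega
  have hxy : ∀ t : k, x + t • y ≠ 0 := by
    intro t ht
    rcases eq_or_ne t 0 with rfl | h
    · simp at ht; exact hx0 ht
    · apply hy
      rw [Submodule.mem_span_singleton]
      refine ⟨-t⁻¹, ?_⟩
      rw [eq_neg_of_add_eq_zero_left ht, neg_smul_neg, smul_smul, inv_mul_cancel₀ h, one_smul]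
  have hy0 : y ≠ 0 := fun h => hy (h ▸ zero_mem _)
  have hMv : Module.finrank k (M ⊔ Submodule.span k {v} : Submodule k (Fin 4 → k)) = 3 := by
    have := Submodule.finrank_sup_add_finrank_inf_eq M (Submodule.span k {v})
    have h0 : v ≠ 0 := fun h => hv (h ▸ zero_mem _)
    rw [hM.1, finrank_span_singleton h0] at this
    have h2 : M ⊓ Submodule.span k {v} = ⊥ :=
      (Submodule.disjoint_span_singleton' h0).2 hv |>.eq_bot
    rw [h2, finrank_bot] at this
    omega
  obtain ⟨u, -, hu⟩ := Submodule.exists_mem_forall_notMem (⊤ : Submodule k (Fin 4 → k))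
    {LinearMap.ker (polarForm f y), M ⊔ Submodule.span k {v}} (by
      intro P hP
      rw [top_le_iff]
      simp only [Finset.mem_insert, Finset.mem_singleton] at hP
      rcases hP with rfl | rfl
      · rw [LinearMap.ker_eq_top]
        exact hf.polarForm_ne_zero hy0 (hM.2 y hyM)
      · intro h
        rw [h, finrank_top] at hMv
        simp at hMv)
  have hu1 : pol f 1 y u ≠ 0 := fun h =>
    hu (LinearMap.ker (polarForm f y)) (by simp) h
  have hu2 : u ∉ M ⊔ Submodule.span k {v} := hu _ (by simp)
  have htop : M ⊔ Submodule.span k {v, u} = ⊤ := by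
    apply Submodule.eq_top_of_finrank_eq
    have hlt : M ⊔ Submodule.span k {v} < M ⊔ Submodule.span k {v, u} := by
      refine lt_of_le_of_ne (sup_le_sup_left (Submodule.span_mono (by simp)) _) fun h => hu2 ?_
      rw [h]
      exact Submodule.mem_sup_right (Submodule.subset_span (by simp))
    have h1 := Submodule.finrank_lt_finrank_of_lt hlt
    have h2 := Submodule.finrank_le (M ⊔ Submodule.span k {v, u})
    simp only [Module.finrank_fin_fun] at *
    omega
  have hxM : ∀ t : k, x + t • y ∈ M := fun t => M.add_mem hx (M.smul_mem _ hyM)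
  have hsing : ∀ t : k, pol f 1 (x + t • y) v = 0 → pol f 1 (x + t • y) u = 0 → False := by
    intro t h1 h2
    refine hf.polarForm_ne_zero (hxy t) (hM.2 _ (hxM t)) ?_
    rw [← LinearMap.ker_eq_top, ← top_le_iff, ← htop]
    refine sup_le (hM.le_ker_polarForm (hxM t)) ?_
    rw [Submodule.span_le]
    rintro w (rfl | rfl)
    · exact h1
    · exact h2
  set a := linePoly (polPoly f 1 v) x y with ha
  set b := linePoly (polPoly f 1 u) x y with hb
  have hae : ∀ t, a.eval t = pol f 1 (x + t • y) v := fun t => by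
    rw [ha, eval_linePoly, aeval_polPoly]; rfl
  have hbe : ∀ t, b.eval t = pol f 1 (x + t • y) u := fun t => by
    rw [hb, eval_linePoly, aeval_polPoly]; rfl
  have hbdeg : d - 1 ≤ b.natDegree := by
    apply Polynomial.le_natDegree_of_ne_zero
    change pol (polPoly f 1 u) (d - 1) x y ≠ 0
    rw [pol_top (isHomogeneous_polPoly hf.2.1 (by omega) u), aeval_polPoly]
    exact hu1
  have hcop : IsCoprime (-a) b := by
    rw [IsCoprime.neg_left_iff]
    by_contra hc
    rw [Polynomial.isCoprime_iff_aeval_ne_zero_of_isAlgClosed k k] at hc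
    push Not at hc
    obtain ⟨t, h1, h2⟩ := hc
    rw [Polynomial.coe_aeval_eq_eval] at h1 h2
    exact hsing t (by rw [← hae]; exact h1) (by rw [← hbe]; exact h2)
  let xz : Fin 4 → Polynomial k := fun m => Polynomial.C (x m) + Polynomial.X * Polynomial.C (y m)
  have hzero : pol f i xz (fun m => b * Polynomial.C (v m) - a * Polynomial.C (u m)) = 0 := by
    apply Polynomial.funext
    intro t
    have e := map_pol f i xz (fun m => b * Polynomial.C (v m) - a * Polynomial.C (u m))
      (Polynomial.aeval t : Polynomial k →ₐ[k] k)
    rw [Polynomial.coe_aeval_eq_eval] at e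
    rw [Polynomial.eval_zero, e]
    have e1 : (fun m => Polynomial.eval t (xz m)) = x + t • y := by
      ext m; simp [xz, mul_comm t]
    have e2 : (fun m => Polynomial.eval t (b * Polynomial.C (v m) - a * Polynomial.C (u m))) =
        b.eval t • v + (-a.eval t) • u := by ext m; simp [sub_eq_add_neg]
    rw [e1, e2]
    apply hcon _ _ (hM.2 _ (hxM t))
    rw [pol_one_add, pol_one_smul, pol_one_smul, ← hae, ← hbe]
    ring
  let F : Polynomial (Polynomial k) := pol f i (fun m => Polynomial.C (xz m))
    (fun m => Polynomial.C (Polynomial.C (v m)) + Polynomial.X * Polynomial.C (Polynomial.C (u m)))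
  have hFmem : F ∈ coeffDegreeLE k (d - i) := by
    have := pol_mem hf.2.1 (coeffDegreeLE k) (fun j => by
        rw [Polynomial.coeff_one]; split_ifs <;> simp) mul_mem_coeffDegreeLE 1 0
      (fun m => Polynomial.C (xz m))
      (fun m => Polynomial.C (Polynomial.C (v m)) +
        Polynomial.X * Polynomial.C (Polynomial.C (u m)))
      (fun m j => by
        rw [Polynomial.coeff_C]
        split_ifs
        · refine Polynomial.natDegree_add_le_of_degree_le (by simp) ?_
          exact (Polynomial.natDegree_mul_C_le _ _).trans Polynomial.natDegree_X_le
        · simp)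
      (fun m j => by
        rw [Polynomial.coeff_add]
        refine Polynomial.natDegree_add_le_of_degree_le ?_ ?_
        · rw [Polynomial.coeff_C]; split_ifs <;> simp
        · rw [Polynomial.coeff_mul_C, Polynomial.coeff_X]; split_ifs <;> simp) i hid
    rwa [mul_one, mul_zero, add_zero] at this
  have hF0 : F = 0 := by
    have hlt : ∀ j, (F.coeff j).natDegree < b.natDegree := fun j => (hFmem j).trans_lt (by omega)
    have hb0 : b ≠ 0 := by
      rintro h
      have := hlt 0
      simp [h] at this
    let K := FractionRing (Polynomial k)
    refine Polynomial.eq_zero_of_aeval_div_eq_zero (K := K) F (-a) b hcop hlt ?_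
    set r := algebraMap (Polynomial k) K (-a) / algebraMap (Polynomial k) K b with hr
    have hbK : algebraMap (Polynomial k) K b ≠ 0 := by
      rwa [Ne, FaithfulSMul.algebraMap_eq_zero_iff]
    have e := map_pol f i (fun m => Polynomial.C (xz m))
      (fun m => Polynomial.C (Polynomial.C (v m)) +
        Polynomial.X * Polynomial.C (Polynomial.C (u m)))
      ((Polynomial.aeval (R := Polynomial k) r).restrictScalars k)
    have e2 := map_pol f i xz (fun m => b * Polynomial.C (v m) - a * Polynomial.C (u m))
      (IsScalarTower.toAlgHom k (Polynomial k) K)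
    rw [hzero, map_zero] at e2
    change Polynomial.aeval r F = _ at e
    rw [e]
    have e3 : (fun m => (IsScalarTower.toAlgHom k (Polynomial k) K)
        (b * Polynomial.C (v m) - a * Polynomial.C (u m))) =
        algebraMap (Polynomial k) K b • fun m =>
          ((Polynomial.aeval (R := Polynomial k) r).restrictScalars k)
          (Polynomial.C (Polynomial.C (v m)) +
            Polynomial.X * Polynomial.C (Polynomial.C (u m))) := by
      ext m
      have hr2 : algebraMap (Polynomial k) K b * r = -algebraMap (Polynomial k) K a := by
        rw [hr, mul_div_cancel₀ _ hbK, map_neg]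
      simp
      linear_combination (-algebraMap (Polynomial k) K (Polynomial.C (u m))) * hr2
    rw [e3, pol_smul_right] at e2
    have := (mul_eq_zero.1 e2.symm).resolve_left (pow_ne_zero _ hbK)
    convert this using 2
    ext m
    simp
  have e := map_pol f i (fun m => Polynomial.C (xz m))
    (fun m => Polynomial.C (Polynomial.C (v m)) +
      Polynomial.X * Polynomial.C (Polynomial.C (u m)))
    ((Polynomial.aeval (R := k) (0 : k)).comp
      ((Polynomial.aeval (R := Polynomial k) (0 : Polynomial k)).restrictScalars k))
  rw [show pol f i _ _ = F from rfl, hF0, map_zero, eq_comm] at e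
  convert e using 2
  · ext m; simp [xz]
  · ext m; simp

theorem exists_basis_span_pair_eq {L M : Submodule k (Fin 4 → k)} (h : M ⊔ L = ⊤)
    {p₀ p₁ q₀ q₁ : Fin 4 → k} (hM : M = Submodule.span k {p₀, p₁})
    (hL : L = Submodule.span k {q₀, q₁}) :
    ∃ b : Module.Basis (Fin 4) k (Fin 4 → k), b 0 = p₀ ∧ b 1 = p₁ ∧ b 2 = q₀ ∧ b 3 = q₁ := by
  have htop : ⊤ ≤ Submodule.span k (Set.range ![p₀, p₁, q₀, q₁]) := by
    rw [← h, hM, hL, ← Submodule.span_union]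
    apply Submodule.span_mono
    rintro x ((rfl | rfl) | (rfl | rfl))
    exacts [⟨0, rfl⟩, ⟨1, rfl⟩, ⟨2, rfl⟩, ⟨3, rfl⟩]
  refine ⟨basisOfTopLeSpanOfCardEqFinrank _ htop (by simp), ?_, ?_, ?_, ?_⟩ <;>
  rw [coe_basisOfTopLeSpanOfCardEqFinrank] <;> rfl

theorem not_dvd_of_totalDegree_lt {σ : Type*} {f R : MvPolynomial σ k} (hR : R ≠ 0)
    (h : R.totalDegree < f.totalDegree) : ¬ f ∣ R := by
  rintro ⟨g, rfl⟩
  rw [totalDegree_mul_of_isDomain (left_ne_zero_of_mul hR) (right_ne_zero_of_mul hR)] at h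
  omega

/-- Some tangent line to the surface meets it with a nonzero `i`-th polar form. -/
theorem exists_tangent_pol_ne_zero [IsAlgClosed k] (hf : IsSmoothSurface f d) (hd : 3 < d)
    {L : Submodule k (Fin 4 → k)} (hL : IsLineOn f L) (T : Finset (Submodule k (Fin 4 → k)))
    (hTcard : (d - 1) ^ 4 ≤ T.card) (hT : ∀ M ∈ T, IsLineOn f M ∧ M ⊓ L = ⊥) {i : ℕ} (hi : 2 ≤ i)
    (hid : i < d) (hne : ∃ x v : Fin 4 → k, pol f i x v ≠ 0) :
    ∃ x v : Fin 4 → k, eval x f = 0 ∧ pol f 1 x v = 0 ∧ pol f i x v ≠ 0 := by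
  by_contra! hcon
  obtain ⟨x, v, hxv⟩ := hne
  have hTne : T.Nonempty := by
    rw [← Finset.card_pos]
    exact lt_of_lt_of_le (pow_pos (by omega) 4) hTcard
  obtain ⟨M, hM⟩ := hTne
  obtain ⟨q₀, q₁, hq, -, -⟩ := Submodule.exists_span_pair_eq hL.1 ∅ (by simp)
  obtain ⟨p₀, p₁, hp, -, -⟩ := Submodule.exists_span_pair_eq (hT M hM).1.1 ∅ (by simp)
  obtain ⟨b, -, -, hb2, hb3⟩ := exists_basis_span_pair_eq
    (finrank_sup_of_inf_eq_bot (hT M hM).1.1 hL.1 (hT M hM).2) hp.symm hq.symm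
  have hspan : Submodule.span k {b 2, b 3} = L := by rw [hb2, hb3, hq]
  have hR0 : polPoly f i v ≠ 0 := fun h => hxv (by rw [← eval_polPoly, h, map_zero])
  have hRdeg : (polPoly f i v).totalDegree = d - i :=
    (isHomogeneous_polPoly hf.2.1 hid.le v).totalDegree hR0
  have := card_skew_lines_le b hf.2.1 (hf.prime (by omega)) (R := polPoly f i v)
    (not_dvd_of_totalDegree_lt hR0 (by rw [hRdeg, hf.2.1.totalDegree hf.1]; omega))
    (by rw [hspan]; exact hL.2) T (fun M hM => (hT M hM).1)
    (by rw [hspan]; exact fun M hM => (hT M hM).2)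
    (fun M hM y hy hy0 => by
      rw [eval_polPoly]
      exact (hT M hM).1.pol_eq_zero_of_forall_tangent hf hi hid.le hcon v hy hy0)
  rw [hRdeg] at this
  have h1 : (d - 1) * (d - i) < (d - 1) ^ 4 := by
    calc (d - 1) * (d - i) < (d - 1) * (d - 1) :=
          Nat.mul_lt_mul_of_pos_left (by omega) (by omega)
      _ = (d - 1) ^ 2 := (sq _).symm
      _ ≤ (d - 1) ^ 4 := Nat.pow_le_pow_right (by omega) (by omega)
  omega

theorem exists_eval_ne_zero_of_prime [IsAlgClosed k] {σ : Type*} [Finite σ] {f : MvPolynomial σ k}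
    (hf : Prime f) (g : MvPolynomial σ k) (hg : ¬ f ∣ g) : ∃ x, eval x f = 0 ∧ eval x g ≠ 0 := by
  by_contra! h
  apply hg
  have hp : (Ideal.span {f}).IsPrime := (Ideal.span_singleton_prime hf.ne_zero).2 hf
  rw [← Ideal.mem_span_singleton, ← IsPrime.vanishingIdeal_zeroLocus (K := k) (Ideal.span {f})]
  rw [mem_vanishingIdeal_iff]
  intro x hx
  rw [aeval_eq_eval]
  apply h
  rw [mem_zeroLocus_iff] at hx
  simpa [aeval_eq_eval] using hx f (Ideal.mem_span_singleton_self f)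

end GoodPoint

section Frame

variable {k : Type*} [Field k] {f : MvPolynomial (Fin 4) k} {d : ℕ}

theorem pol_add_smul_self [Infinite k] {σ : Type*} {f : MvPolynomial σ k}
    (hf : f.IsHomogeneous d) {i : ℕ}
    (hi : i ≤ d) {x v : σ → k} (hlow : ∀ j < i, pol f j x v = 0) (s : k) :
    pol f i x (v + s • x) = pol f i x v := by
  have h1 : linePoly f (v + s • x) x = Polynomial.taylor s (linePoly f v x) := by
    apply Polynomial.funext
    intro t
    rw [Polynomial.taylor_eval, eval_linePoly, eval_linePoly]
    congr 2
    module
  have hdeg : (linePoly f v x).natDegree ≤ d - i := by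
    rw [Polynomial.natDegree_le_iff_coeff_eq_zero]
    intro m hm
    change pol f m v x = 0
    rcases le_or_gt m d with h | h
    · rw [pol_swap hf _ _ h]
      exact hlow _ (by omega)
    · exact pol_eq_zero_of_lt hf _ _ h
  rw [pol_swap hf _ _ hi, pol_swap hf x v hi, pol, pol, h1]
  rcases hdeg.lt_or_eq with h | h
  · rw [Polynomial.coeff_eq_zero_of_natDegree_lt h, Polynomial.coeff_eq_zero_of_natDegree_lt]
    rwa [Polynomial.natDegree_taylor]
  · rw [← h, Polynomial.coeff_taylor_natDegree, Polynomial.leadingCoeff]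

theorem pol_one_self {x : Fin 4 → k} [Infinite k] (hf : f.IsHomogeneous d) (hx : eval x f = 0) :
    pol f 1 x x = 0 := by
  apply pol_eq_zero_of_forall
  intro s
  have : x + s • x = (1 + s) • x := by module
  rw [this, aeval_smul_of_isHomogeneous hf, aeval_eq_eval, hx, mul_zero]

theorem exists_linear_form_vanishing {M : Submodule k (Fin 4 → k)} (hM : M ≠ ⊤) :
    ∃ g : MvPolynomial (Fin 4) k, g ≠ 0 ∧ g.totalDegree ≤ 1 ∧ ∀ v ∈ M, eval v g = 0 := by
  obtain ⟨φ, hφ, hle⟩ := Submodule.exists_le_ker_of_lt_top M hM.lt_top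
  have he : ∀ v, eval v (∑ m, C (φ (Pi.single m 1)) * X m) = φ v := by
    intro v
    conv_rhs => rw [pi_eq_sum_univ' v, map_sum]
    rw [map_sum]
    refine Finset.sum_congr rfl fun m _ => ?_
    rw [map_smul, map_mul, eval_C, eval_X, smul_eq_mul, mul_comm]
  refine ⟨∑ m, C (φ (Pi.single m 1)) * X m, ?_, ?_, fun v hv => ?_⟩
  · intro h
    apply hφ
    ext1 m
    ext
    change φ (Pi.single m 1) = 0
    rw [← he, h, map_zero]
  · refine (totalDegree_finsetSum _ _).trans (Finset.sup_le fun m _ => ?_)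
    refine (totalDegree_mul _ _).trans ?_
    rw [totalDegree_C, totalDegree_X]
  · rw [he]
    exact hle hv

/-- A point of the surface on no line, with a nonzero `i`-th polar form on its tangent plane. -/
theorem exists_base_point [IsAlgClosed k] (hf : IsSmoothSurface f d) (hd : 3 < d)
    (hfin : {W | IsLineOn f W}.Finite) {i : ℕ} (hid : i < d)
    {x₁ v₁ : Fin 4 → k} (hx₁ : eval x₁ f = 0) (hv₁ : pol f 1 x₁ v₁ = 0) (hxv : pol f i x₁ v₁ ≠ 0)
    {x₂ l : Fin 4 → k} (hx₂ : eval x₂ f = 0) (hl : pol f 1 x₂ l ≠ 0) :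
    ∃ x, eval x f = 0 ∧ pol f 1 x l ≠ 0 ∧ (∀ W, IsLineOn f W → x ∉ W) ∧
      ∃ v, pol f 1 x v = 0 ∧ pol f i x v ≠ 0 := by
  classical
  have hprime := hf.prime (by omega)
  have hx₁0 : x₁ ≠ 0 := by
    rintro rfl
    apply hxv
    have := pol_smul_left hf.2.1 0 v₁ (0 : k) hid.le
    rwa [smul_zero, zero_pow (by omega), zero_mul] at this
  obtain ⟨w, hw⟩ := hf.exists_pol_ne_zero hx₁0 (by rwa [aeval_eq_eval])
  have hndvd : ∀ (g : MvPolynomial (Fin 4) k) x, eval x f = 0 → eval x g ≠ 0 → ¬ f ∣ g := by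
    rintro g x hx hg ⟨r, rfl⟩
    rw [map_mul, hx, zero_mul] at hg
    exact hg rfl
  let h₁ : MvPolynomial (Fin 4) k :=
    pol f i X (fun m => polPoly f 1 w * C (v₁ m) - polPoly f 1 v₁ * C (w m))
  have hh₁ : ∀ x, eval x h₁ = pol f i x (pol f 1 x w • v₁ - pol f 1 x v₁ • w) := by
    intro x
    rw [← aeval_eq_eval]
    simp only [h₁]
    rw [map_pol]
    congr 1
    · ext m; simp
    · ext m; simp [aeval_eq_eval, eval_polPoly]
  have hne : ∀ M : Submodule k (Fin 4 → k), ∃ g : MvPolynomial (Fin 4) k, IsLineOn f M →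
      g ≠ 0 ∧ g.totalDegree ≤ 1 ∧ ∀ v ∈ M, eval v g = 0 := by
    intro M
    by_cases hM : IsLineOn f M
    · obtain ⟨g, hg⟩ := exists_linear_form_vanishing (M := M) (by
        rintro rfl
        have := hM.1
        simp at this)
      exact ⟨g, fun _ => hg⟩
    · exact ⟨0, fun h => absurd h hM⟩
  choose g hg using hne
  obtain ⟨x, hx, hxne⟩ := exists_eval_ne_zero_of_prime hprime
    (h₁ * polPoly f 1 l * ∏ M ∈ hfin.toFinset, g M) (by
      intro h
      rcases hprime.dvd_or_dvd h with h | h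
      · rcases hprime.dvd_or_dvd h with h | h
        · refine hndvd _ x₁ hx₁ ?_ h
          rw [hh₁, hv₁, zero_smul, sub_zero, pol_smul_right]
          exact mul_ne_zero (pow_ne_zero _ hw) hxv
        · refine hndvd _ x₂ hx₂ ?_ h
          rwa [eval_polPoly]
      · rw [hprime.dvd_finsetProd_iff] at h
        obtain ⟨M, hM, h⟩ := h
        rw [Set.Finite.mem_toFinset] at hM
        refine not_dvd_of_totalDegree_lt (hg M hM).1 ?_ h
        rw [hf.2.1.totalDegree hf.1]
        have := (hg M hM).2.1
        omega)
  rw [map_mul, map_mul, map_prod, hh₁, eval_polPoly] at hxne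
  refine ⟨x, hx, right_ne_zero_of_mul (left_ne_zero_of_mul hxne), fun W hW hxW => ?_,
    _, ?_, left_ne_zero_of_mul (left_ne_zero_of_mul hxne)⟩
  · have := right_ne_zero_of_mul hxne
    rw [Finset.prod_ne_zero_iff] at this
    exact this W (by simpa using hW) ((hg W hW).2.2 x hxW)
  · rw [sub_eq_add_neg, ← neg_smul, pol_one_add, pol_one_smul, pol_one_smul]
    ring

/-- A point of the line `L` in the kernel of a functional which does not vanish on `L`. -/
theorem exists_span_pair_mem_ker {V : Type*} [AddCommGroup V] [Module k V] (φ : V →ₗ[k] k)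
    {q₀ q₁ : V} (h : φ q₁ ≠ 0) :
    ∃ q, φ q = 0 ∧ Submodule.span k {q, q₁} = Submodule.span k {q₀, q₁} := by
  refine ⟨q₀ - (φ q₀ / φ q₁) • q₁, by simp [h], le_antisymm ?_ ?_⟩
  · rw [Submodule.span_le]
    rintro x (rfl | rfl)
    · exact sub_mem (Submodule.subset_span (by simp))
        (Submodule.smul_mem _ _ (Submodule.subset_span (by simp)))
    · exact Submodule.subset_span (by simp)
  · rw [Submodule.span_le]
    rintro x (rfl | rfl)
    · exact Submodule.mem_span_pair.2 ⟨1, φ x / φ q₁, by module⟩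
    · exact Submodule.subset_span (by simp)

theorem exists_pol_ne_zero_notMem [Infinite k] (hf : f.IsHomogeneous d) {i : ℕ} (hid : i ≤ d)
    {x : Fin 4 → k} {T P : Submodule k (Fin 4 → k)} (hTP : ¬ T ≤ P)
    (h : ∃ v ∈ T, pol f i x v ≠ 0) : ∃ r ∈ T, r ∉ P ∧ pol f i x r ≠ 0 := by
  obtain ⟨v, hvT, hv⟩ := h
  obtain ⟨r, hrT, hrP⟩ := SetLike.not_le_iff_exists.1 hTP
  by_cases hvP : v ∈ P
  · let p := linePoly (polPoly f (d - i) x) v r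
    have hp : ∀ t, p.eval t = pol f i x (v + t • r) := by
      intro t
      rw [eval_linePoly, aeval_eq_eval, eval_polPoly, pol_swap hf _ _ hid]
    have hp0 : Polynomial.X * p ≠ 0 := by
      apply mul_ne_zero Polynomial.X_ne_zero
      intro h0
      apply hv
      have := hp 0
      rw [h0, zero_smul, add_zero, Polynomial.eval_zero] at this
      exact this.symm
    obtain ⟨t, ht⟩ : ∃ t, (Polynomial.X * p).eval t ≠ 0 := by
      by_contra! hc
      exact hp0 (Polynomial.funext fun t => by rw [hc, Polynomial.eval_zero])
    rw [Polynomial.eval_mul, Polynomial.eval_X, hp] at ht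
    refine ⟨v + t • r, T.add_mem hvT (T.smul_mem _ hrT), fun hmem => hrP ?_,
      right_ne_zero_of_mul ht⟩
    rw [P.add_mem_iff_right hvP, P.smul_mem_iff (left_ne_zero_of_mul ht)] at hmem
    exact hmem
  · exact ⟨v, hvT, hvP, hv⟩

theorem exists_frame [IsAlgClosed k] (hf : IsSmoothSurface f d) {L : Submodule k (Fin 4 → k)}
    (hL : IsLineOn f L) {i : ℕ} (hid : i < d)
    (hlow : ∀ j, 2 ≤ j → j < i → ∀ x v : Fin 4 → k, pol f j x v = 0)
    {x l₀ l₁ : Fin 4 → k} (hl : Submodule.span k {l₀, l₁} = L) (hx : eval x f = 0)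
    (hxl : pol f 1 x l₁ ≠ 0) (hxW : ∀ W, IsLineOn f W → x ∉ W)
    (hv : ∃ v, pol f 1 x v = 0 ∧ pol f i x v ≠ 0) :
    ∃ b : Module.Basis (Fin 4) k (Fin 4 → k), b 3 = l₁ ∧ Submodule.span k {b 2, b 3} = L ∧
      eval (b 0) f = 0 ∧ pol f 1 (b 0) (b 1) = 0 ∧ pol f 1 (b 0) (b 2) = 0 ∧
      pol f 1 (b 0) (b 3) ≠ 0 ∧ pol f 1 (b 2) (b 1) ≠ 0 ∧
      ∀ s : k, pol f i (b 0) (b 1 + s • b 2) = 0 → eval (b 1 + s • b 2) f ≠ 0 := by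
  classical
  have hd : d ≠ 0 := by omega
  obtain ⟨q, hq, hspan⟩ := exists_span_pair_mem_ker (polarForm f x) (q₀ := l₀) hxl
  rw [hl] at hspan
  have hqL : q ∈ L := hspan ▸ Submodule.subset_span (by simp)
  have hx0 : x ≠ 0 := by
    rintro rfl
    exact hxW L hL (zero_mem L)
  have hq0 : q ≠ 0 := by
    rintro rfl
    have h1 := hL.1
    rw [← hspan] at h1
    have : Submodule.span k {(0 : Fin 4 → k), l₁} = Submodule.span k {l₁} := by simp
    rw [this] at h1
    have := finrank_span_le_card (R := k) ({l₁} : Set (Fin 4 → k))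
    rw [Set.toFinset_singleton, Finset.card_singleton] at this
    omega
  have hTP : ¬ LinearMap.ker (polarForm f x) ≤ Submodule.span k {x, q} := by
    intro h
    have h1 := Submodule.finrank_mono h
    have h2 := (polarForm f x).finrank_range_add_finrank_ker
    have h3 := Submodule.finrank_le (LinearMap.range (polarForm f x))
    have h4 := finrank_span_le_card (R := k) ({x, q} : Set (Fin 4 → k))
    have h5 := Finset.card_le_two (a := x) (b := q)
    simp at h2 h3 h4
    omega
  obtain ⟨r, hrT, hrP, hr⟩ := exists_pol_ne_zero_notMem hf.2.1 hid.le hTP hv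
  rw [LinearMap.mem_ker, polarForm_apply] at hrT
  rw [polarForm_apply] at hq
  have hxx : pol f 1 x x = 0 := pol_one_self hf.2.1 hx
  have hxq : ∀ a : k, a • x ∈ L → a = 0 := by
    intro a ha
    by_contra h
    exact hxW L hL ((L.smul_mem_iff h).1 ha)
  have hM : Module.finrank k (Submodule.span k {x, r}) = 2 := by
    rw [← Matrix.range_cons_cons_empty, finrank_span_eq_card]
    · simp
    rw [LinearIndependent.pair_iff]
    intro a b hab
    have hb : b = 0 := by
      by_contra hb
      apply hrP
      rw [Submodule.mem_span_pair]
      refine ⟨-(b⁻¹ * a), 0, ?_⟩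
      rw [zero_smul, add_zero, neg_smul, mul_smul, eq_neg_of_add_eq_zero_left hab, smul_neg,
        neg_neg, smul_smul, inv_mul_cancel₀ hb, one_smul]
    subst hb
    simpa [hx0] using hab
  have hML : Submodule.span k {x, r} ⊓ L = ⊥ := by
    rw [eq_bot_iff]
    rintro y ⟨hy1, hy2⟩
    obtain ⟨a, b, rfl⟩ := Submodule.mem_span_pair.1 hy1
    have hy3 := hy2
    rw [← hspan, SetLike.mem_coe, Submodule.mem_span_pair] at hy3
    obtain ⟨a', b', he⟩ := hy3
    have hb' : b' = 0 := by
      have := congrArg (polarForm f x) he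
      simpa [polarForm_apply, pol_one_add, pol_one_smul, hq, hxl, hxx, hrT] using this
    subst hb'
    have hb : b = 0 := by
      by_contra hb
      apply hrP
      rw [Submodule.mem_span_pair]
      refine ⟨-(b⁻¹ * a), b⁻¹ * a', ?_⟩
      have : a' • q = a • x + b • r := by simpa using he
      rw [mul_smul _ a', this, smul_add, smul_smul, smul_smul, inv_mul_cancel₀ hb]
      module
    subst hb
    rw [zero_smul, add_zero] at hy2 ⊢
    rw [hxq a hy2, zero_smul]
    exact zero_mem _
  have htop := finrank_sup_of_inf_eq_bot hM hL.1 hML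
  have hne : ∀ s : k, linePoly f (r + s • q) x ≠ 0 := by
    intro s h0
    have hz : ∀ t : k, eval (r + s • q + t • x) f = 0 := by
      intro t
      rw [← aeval_eq_eval, ← eval_linePoly, h0, Polynomial.eval_zero]
    have hline : IsLineOn f (Submodule.span k {x, r + s • q}) := by
      refine ⟨?_, fun v hv => ?_⟩
      · rw [← Matrix.range_cons_cons_empty, finrank_span_eq_card]
        · simp
        rw [LinearIndependent.pair_iff]
        intro a b hab
        have hb : b = 0 := by
          by_contra hb
          apply hrP
          rw [Submodule.mem_span_pair]
          refine ⟨-(b⁻¹ * a), -s, ?_⟩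
          rw [neg_smul, mul_smul, eq_neg_of_add_eq_zero_left hab, smul_neg,
            neg_neg, smul_smul, inv_mul_cancel₀ hb, one_smul]
          module
        subst hb
        simpa [hx0] using hab
      · obtain ⟨a, b, rfl⟩ := Submodule.mem_span_pair.1 hv
        rw [← aeval_eq_eval]
        rcases eq_or_ne b 0 with rfl | hb
        · rw [zero_smul, add_zero, aeval_smul_of_isHomogeneous hf.2.1, aeval_eq_eval, hx, mul_zero]
        · have : a • x + b • (r + s • q) = b • (r + s • q + (b⁻¹ * a) • x) := by
            rw [smul_add b (r + s • q), smul_smul b, mul_inv_cancel_left₀ hb]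
            abel
          rw [this, aeval_smul_of_isHomogeneous hf.2.1, aeval_eq_eval, hz, mul_zero]
    exact hxW _ hline (Submodule.subset_span (by simp))
  have hBne : Polynomial.C (pol f 1 q r) + Polynomial.X * Polynomial.C (pol f 1 q x) ≠ 0 := by
    intro h0
    have h1 : pol f 1 q r = 0 := by simpa using congrArg (Polynomial.eval 0) h0
    have h2 : pol f 1 q x = 0 := by simpa [h1] using congrArg (Polynomial.eval 1) h0
    refine hf.polarForm_ne_zero hq0 (hL.2 q hqL)
      (polarForm_eq_zero_of_sup_eq_top htop ?_ (hL.le_ker_polarForm hqL))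
    rw [Submodule.span_le]
    rintro y (rfl | rfl)
    · exact h2
    · exact h1
  let p := linePoly (polPoly f (d - i) x) r q
  have hp : ∀ t, p.eval t = pol f i x (r + t • q) := by
    intro t
    rw [eval_linePoly, aeval_eq_eval, eval_polPoly, pol_swap hf.2.1 _ _ hid.le]
  have hp0 : p ≠ 0 := by
    intro h0
    apply hr
    have := hp 0
    rw [h0, zero_smul, add_zero, Polynomial.eval_zero] at this
    exact this.symm
  obtain ⟨c, hc⟩ : ∃ c, ((Polynomial.C (pol f 1 q r) + Polynomial.X * Polynomial.C (pol f 1 q x)) *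
      ∏ s ∈ p.roots.toFinset, linePoly f (r + s • q) x).eval c ≠ 0 := by
    by_contra! hc
    exact mul_ne_zero hBne (Finset.prod_ne_zero_iff.2 fun s _ => hne s)
      (Polynomial.funext fun t => by rw [hc, Polynomial.eval_zero])
  rw [Polynomial.eval_mul, Polynomial.eval_prod] at hc
  have hspan' : Submodule.span k {x, r} = Submodule.span k {x, r + c • x} := by
    apply le_antisymm
    · rw [Submodule.span_le]
      rintro y (rfl | rfl)
      · exact Submodule.subset_span (by simp)
      · exact Submodule.mem_span_pair.2 ⟨-c, 1, by module⟩
    · rw [Submodule.span_le]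
      rintro y (rfl | rfl)
      · exact Submodule.subset_span (by simp)
      · exact Submodule.mem_span_pair.2 ⟨c, 1, by module⟩
  obtain ⟨b, hb0, hb1, hb2, hb3⟩ := exists_basis_span_pair_eq htop hspan' hspan.symm
  refine ⟨b, hb3, ?_⟩
  rw [hb0, hb1, hb2, hb3]
  refine ⟨hspan, hx, ?_, hq, hxl, ?_, fun s hs => ?_⟩
  · rw [pol_one_add, pol_one_smul, hxx, hrT, mul_zero, add_zero]
  · rw [pol_one_add, pol_one_smul]
    have := left_ne_zero_of_mul hc
    simpa [mul_comm c] using this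
  · have e : r + c • x + s • q = r + s • q + c • x := by abel
    rw [e] at hs ⊢
    rw [pol_add_smul_self hf.2.1 hid.le, ← hp] at hs
    · have := Finset.prod_ne_zero_iff.1 (right_ne_zero_of_mul hc) s (by simpa [hp0] using hs)
      rwa [eval_linePoly, aeval_eq_eval] at this
    · intro j hj
      rcases lt_or_ge j 2 with h | h
      · interval_cases j
        · rw [pol_zero, aeval_eq_eval, hx]
        · rw [pol_one_add, pol_one_smul, hrT, hq, mul_zero, add_zero]
      · exact hlow j h hj _ _

end Frame

section Resultant

open Polynomial in
theorem Polynomial.resultant_comp_linear {K : Type*} [Field K] {c : K} (hc : c ≠ 0) (e : K)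
    {P Q : Polynomial K} {m n : ℕ} (hP : P.natDegree ≤ m) (hQ : Q.natDegree ≤ n) :
    resultant (P.comp (C c * X + C e)) (Q.comp (C c * X + C e)) m n =
      c ^ (m * n) * resultant P Q m n := by
  have hcomp : ∀ P : Polynomial K, P.comp (C c * X + C e) =
      C (c ^ P.natDegree) * (taylor e P).scaleRoots c⁻¹ := by
    intro P
    have h1 : P.comp (C c * X + C e) = (taylor e P).comp (C c * X) := by
      rw [taylor_apply, comp_assoc]
      simp
    rw [h1]
    ext j
    rw [comp_C_mul_X_coeff, coeff_C_mul, coeff_scaleRoots, natDegree_taylor]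
    rcases le_or_gt j P.natDegree with hj | hj
    · rw [inv_pow, ← Nat.sub_add_cancel hj, pow_add, Nat.add_sub_cancel]
      field_simp
    · rw [coeff_eq_zero_of_natDegree_lt (by rwa [natDegree_taylor])]
      simp
  have hdeg : ∀ P : Polynomial K, (P.comp (C c * X + C e)).natDegree = P.natDegree := by
    intro P
    rw [natDegree_comp, natDegree_linear hc, mul_one]
  have hlead : ∀ P : Polynomial K, (P.comp (C c * X + C e)).coeff P.natDegree =
      c ^ P.natDegree * P.coeff P.natDegree := by
    intro P
    rw [hcomp, coeff_C_mul, coeff_scaleRoots, natDegree_taylor, Nat.sub_self, pow_zero, mul_one]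
    congr 1
    have := leadingCoeff_taylor (r := e) (f := P)
    rwa [leadingCoeff, leadingCoeff, natDegree_taylor] at this
  have hbase : resultant (P.comp (C c * X + C e)) (Q.comp (C c * X + C e)) P.natDegree
      Q.natDegree = c ^ (P.natDegree * Q.natDegree) * resultant P Q := by
    have h := resultant_scaleRoots (taylor e P) (taylor e Q) c⁻¹
    rw [resultant_taylor, natDegree_scaleRoots, natDegree_scaleRoots, natDegree_taylor,
      natDegree_taylor] at h
    rw [hcomp, hcomp, resultant_C_mul_left, resultant_C_mul_right, h]
    rw [← pow_mul, ← pow_mul, inv_pow, mul_comm Q.natDegree]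
    field_simp
  rcases hP.lt_or_eq with hP' | rfl
  · rcases hQ.lt_or_eq with hQ' | rfl
    · rw [resultant_eq_zero_of_lt_lt _ _ _ _ (by rwa [hdeg]) (by rwa [hdeg]),
        resultant_eq_zero_of_lt_lt _ _ _ _ hP' hQ', mul_zero]
    · obtain ⟨j, rfl⟩ := Nat.exists_eq_add_of_le hP
      rw [resultant_add_left_deg _ _ _ _ _ (hdeg P).le, resultant_add_left_deg _ _ _ _ _ le_rfl,
        hbase, hlead]
      ring
  · obtain ⟨j, rfl⟩ := Nat.exists_eq_add_of_le hQ
    rw [resultant_add_right_deg _ _ _ _ _ (hdeg Q).le, resultant_add_right_deg _ _ _ _ _ le_rfl,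
      hbase, hlead]
    ring

end Resultant

section TernaryResultant

theorem totalDegree_resultant_le {σ k : Type*} [CommRing k] {P Q : Polynomial (MvPolynomial σ k)}
    {a b : ℕ} (hP : ∀ j, (P.coeff j).totalDegree ≤ a) (hQ : ∀ j, (Q.coeff j).totalDegree ≤ b)
    (m n : ℕ) : (Polynomial.resultant P Q m n).totalDegree ≤ m * b + n * a := by
  rw [Polynomial.resultant, Matrix.det_apply]
  refine (totalDegree_finsetSum _ _).trans (Finset.sup_le fun s _ => ?_)
  refine (totalDegree_smul_le _ _).trans ?_
  refine (totalDegree_finsetProd _ _).trans ?_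
  rw [Fin.sum_univ_add]
  refine add_le_add ?_ ?_
  · refine (Finset.sum_le_card_nsmul _ _ b fun j _ => ?_).trans (by simp)
    simp only [Polynomial.sylvester, Matrix.of_apply, Fin.addCases_left]
    split_ifs
    · exact hQ _
    · simp
  · refine (Finset.sum_le_card_nsmul _ _ a fun j _ => ?_).trans (by simp)
    simp only [Polynomial.sylvester, Matrix.of_apply, Fin.addCases_right]
    split_ifs
    · exact hP _
    · simp

variable {A : Type*} [CommRing A]

theorem natDegree_aeval_le {σ : Type*} {F : MvPolynomial σ A} {m : ℕ} (hF : F.IsHomogeneous m)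
    {y : σ → Polynomial A} (hy : ∀ j, (y j).natDegree ≤ 1) : (aeval y F).natDegree ≤ m := by
  have h := aeval_mem_of_isHomogeneous hF (fun e => Polynomial.degreeLE A e) (by
      simp [Polynomial.mem_degreeLE]) (by
    intro a b p q hp hq
    simp only [Polynomial.mem_degreeLE] at *
    push_cast
    exact Polynomial.degree_mul_le_of_le hp hq) y (by
      intro j
      rw [Polynomial.mem_degreeLE]
      exact Polynomial.natDegree_le_iff_degree_le.1 (hy j))
  rw [Polynomial.mem_degreeLE] at h
  exact Polynomial.natDegree_le_iff_degree_le.2 h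

/-- The points `(b₃, b₃ t, - (b₁ + b₂ t))` of the plane `b₁ y₁ + b₂ y₂ + b₃ y₃ = 0`. -/
noncomputable def planePoint (b₁ b₂ b₃ : A) : Fin 3 → Polynomial A :=
  ![Polynomial.C b₃, Polynomial.C b₃ * Polynomial.X,
    -(Polynomial.C b₁ + Polynomial.C b₂ * Polynomial.X)]

theorem natDegree_planePoint_le (b₁ b₂ b₃ : A) (j : Fin 3) :
    (planePoint b₁ b₂ b₃ j).natDegree ≤ 1 := by
  fin_cases j
  · simp [planePoint]
  · exact by change (Polynomial.C b₃ * Polynomial.X).natDegree ≤ 1; compute_degree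
  · simp only [planePoint]
    change (-(Polynomial.C b₁ + Polynomial.C b₂ * Polynomial.X)).natDegree ≤ 1
    rw [Polynomial.natDegree_neg]
    compute_degree

theorem map_aeval_polynomial {σ B : Type*} [CommRing B] (φ : A →+* B) (F : MvPolynomial σ A)
    (y : σ → Polynomial A) :
    (aeval y F).map φ = aeval (fun j => (y j).map φ) (MvPolynomial.map φ F) := by
  induction F using MvPolynomial.induction_on with
  | C a => simp [Polynomial.algebraMap_eq]
  | add p q hp hq => simp [hp, hq]
  | mul_X p j hp => simp [hp]

/-- The points `(b₂, b₃ t - b₁, - b₂ t)` of the plane `b₁ y₁ + b₂ y₂ + b₃ y₃ = 0`. -/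
noncomputable def planePointSwap (b₁ b₂ b₃ : A) : Fin 3 → Polynomial A :=
  ![Polynomial.C b₂, Polynomial.C b₃ * Polynomial.X - Polynomial.C b₁,
    -(Polynomial.C b₂ * Polynomial.X)]

theorem resultant_aeval_map {σ B : Type*} [CommRing B] (φ : A →+* B)
    (F H : MvPolynomial σ A) (m n : ℕ) (y : σ → Polynomial A) :
    φ (Polynomial.resultant (aeval y F) (aeval y H) m n) =
      Polynomial.resultant (aeval (fun j => (y j).map φ) (MvPolynomial.map φ F))
        (aeval (fun j => (y j).map φ) (MvPolynomial.map φ H)) m n := by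
  rw [← Polynomial.resultant_map_map, map_aeval_polynomial, map_aeval_polynomial]

theorem map_planePoint {B : Type*} [CommRing B] (φ : A →+* B) (b₁ b₂ b₃ : A) :
    (fun j => (planePoint b₁ b₂ b₃ j).map φ) = planePoint (φ b₁) (φ b₂) (φ b₃) := by
  ext1 j; fin_cases j <;> simp [planePoint]

theorem map_planePointSwap {B : Type*} [CommRing B] (φ : A →+* B) (b₁ b₂ b₃ : A) :
    (fun j => (planePointSwap b₁ b₂ b₃ j).map φ) = planePointSwap (φ b₁) (φ b₂) (φ b₃) := by
  ext1 j; fin_cases j <;> simp [planePointSwap]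

theorem resultant_planePoint_field {K : Type*} [Field K] {F H : MvPolynomial (Fin 3) K} {m n : ℕ}
    (hF : F.IsHomogeneous m) (hH : H.IsHomogeneous n) (b₁ : K) {b₂ b₃ : K} (h₂ : b₂ ≠ 0)
    (h₃ : b₃ ≠ 0) :
    b₂ ^ (m * n) *
      Polynomial.resultant (aeval (planePoint b₁ b₂ b₃) F) (aeval (planePoint b₁ b₂ b₃) H) m n =
    b₃ ^ (m * n) *
      Polynomial.resultant (aeval (planePointSwap b₁ b₂ b₃) F)
        (aeval (planePointSwap b₁ b₂ b₃) H) m n := by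
  have hc : b₃ / b₂ ≠ 0 := div_ne_zero h₃ h₂
  have hcomp : ∀ {F : MvPolynomial (Fin 3) K} {m : ℕ}, F.IsHomogeneous m →
      (aeval (planePoint b₁ b₂ b₃) F).comp
        (Polynomial.C (b₃ / b₂) * Polynomial.X + Polynomial.C (- (b₁ / b₂))) =
      Polynomial.C ((b₃ / b₂) ^ m) * aeval (planePointSwap b₁ b₂ b₃) F := by
    intro F m hF
    rw [Polynomial.C_pow, ← aeval_smul_of_isHomogeneous hF]
    have := DFunLike.congr_fun (comp_aeval (planePoint b₁ b₂ b₃)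
      (Polynomial.aeval (R := K)
        (Polynomial.C (b₃ / b₂) * Polynomial.X + Polynomial.C (- (b₁ / b₂)) : Polynomial K))) F
    simp only [AlgHom.comp_apply] at this
    rw [Polynomial.comp, ← Polynomial.algebraMap_eq, ← Polynomial.aeval_def]
    refine this.trans ?_
    congr 2
    ext1 j
    have e1 : Polynomial.C b₃ = Polynomial.C (b₃ / b₂) * Polynomial.C b₂ := by
      rw [← Polynomial.C_mul, div_mul_cancel₀ _ h₂]
    have e2 : Polynomial.C b₁ = Polynomial.C (b₁ / b₂) * Polynomial.C b₂ := by
      rw [← Polynomial.C_mul, div_mul_cancel₀ _ h₂]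
    fin_cases j
    · simp [planePoint, planePointSwap, Polynomial.algebraMap_eq, e1]
    · simp [planePoint, planePointSwap, Polynomial.algebraMap_eq, e1, e2]; ring
    · simp [planePoint, planePointSwap, Polynomial.algebraMap_eq, e2]; ring
  have hres := Polynomial.resultant_comp_linear hc (- (b₁ / b₂))
    (natDegree_aeval_le hF (natDegree_planePoint_le b₁ b₂ b₃))
    (natDegree_aeval_le hH (natDegree_planePoint_le b₁ b₂ b₃))
  rw [hcomp hF, hcomp hH, Polynomial.resultant_C_mul_left, Polynomial.resultant_C_mul_right,
    ← pow_mul, ← pow_mul, mul_comm n m] at hres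
  have hres := mul_left_cancel₀ (pow_ne_zero _ hc) hres
  rw [← hres, div_pow]
  field_simp

theorem resultant_planePoint [IsDomain A] {F H : MvPolynomial (Fin 3) A} {m n : ℕ}
    (hF : F.IsHomogeneous m) (hH : H.IsHomogeneous n) (b₁ : A) {b₂ b₃ : A} (h₂ : b₂ ≠ 0)
    (h₃ : b₃ ≠ 0) :
    b₂ ^ (m * n) *
      Polynomial.resultant (aeval (planePoint b₁ b₂ b₃) F) (aeval (planePoint b₁ b₂ b₃) H) m n =
    b₃ ^ (m * n) *
      Polynomial.resultant (aeval (planePointSwap b₁ b₂ b₃) F)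
        (aeval (planePointSwap b₁ b₂ b₃) H) m n := by
  have hinj := IsFractionRing.injective A (FractionRing A)
  apply hinj
  rw [map_mul, map_mul, map_pow, map_pow, resultant_aeval_map, resultant_aeval_map,
    map_planePoint, map_planePointSwap]
  exact resultant_planePoint_field (hF.map _) (hH.map _) _
    ((map_ne_zero_iff _ hinj).2 h₂) ((map_ne_zero_iff _ hinj).2 h₃)

theorem pow_dvd_resultant_planePoint [IsDomain A] {F H : MvPolynomial (Fin 3) A} {m n : ℕ}
    (hF : F.IsHomogeneous m) (hH : H.IsHomogeneous n) (b₁ b₂ : A) {b₃ : A} (h₃ : b₃ ≠ 0) :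
    b₃ ^ (m * n) ∣ Polynomial.resultant (aeval (planePoint b₁ b₂ b₃) F)
      (aeval (planePoint b₁ b₂ b₃) H) m n := by
  have h := resultant_planePoint (hF.map (Polynomial.C)) (hH.map (Polynomial.C))
    (Polynomial.C b₁) (b₂ := Polynomial.X) (b₃ := Polynomial.C b₃) Polynomial.X_ne_zero
    (Polynomial.C_ne_zero.2 h₃)
  set r₂ := Polynomial.resultant (aeval (planePointSwap (Polynomial.C b₁) Polynomial.X
    (Polynomial.C b₃)) (map Polynomial.C F)) (aeval (planePointSwap (Polynomial.C b₁) Polynomial.X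
    (Polynomial.C b₃)) (map Polynomial.C H)) m n
  have hdvd : (Polynomial.X : Polynomial A) ^ (m * n) ∣ r₂ := by
    rw [Polynomial.X_pow_dvd_iff]
    intro j hj
    have h0 := Polynomial.X_pow_dvd_iff.1 (Dvd.intro _ h) j hj
    rw [← Polynomial.C_pow, Polynomial.coeff_C_mul] at h0
    exact (mul_eq_zero.1 h0).resolve_left (pow_ne_zero _ h₃)
  obtain ⟨ρ, hρ⟩ := hdvd
  rw [hρ, mul_left_comm] at h
  have h := mul_left_cancel₀ (pow_ne_zero _ Polynomial.X_ne_zero) h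
  have h' := congrArg (Polynomial.evalRingHom b₂) h
  rw [resultant_aeval_map, map_planePoint, map_map, map_map] at h'
  have hid : (Polynomial.evalRingHom b₂).comp Polynomial.C = RingHom.id A := by ext; simp
  have hC : ∀ a : A, Polynomial.evalRingHom b₂ (Polynomial.C a) = a := fun a => by simp
  have hX : Polynomial.evalRingHom b₂ Polynomial.X = b₂ := by simp
  rw [hid, map_id, map_id, hC, hC, hX, map_mul, map_pow, hC] at h'
  exact ⟨_, h'⟩

end TernaryResultant

section TernaryForms

variable {k : Type*} [Field k] {f : MvPolynomial (Fin 4) k} {d : ℕ}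

/-- The polar form `f_i(x; y₁ e₁ + y₂ e₂ + y₃ e₃)` as a ternary form in `y` over `k[x]`. -/
noncomputable def ternaryPol (f : MvPolynomial (Fin 4) k) (i : ℕ) (e₁ e₂ e₃ : Fin 4 → k) :
    MvPolynomial (Fin 3) (MvPolynomial (Fin 4) k) :=
  pol f i (fun m => C (X m))
    (fun m => e₁ m • X 0 + e₂ m • X 1 + e₃ m • X 2)

/-- The ternary form `(f(y₁ e₁ + y₂ e₂ + y₃ e₃) - f(y₂ e₂ + y₃ e₃)) / y₁` over `k[x]`. -/
noncomputable def ternaryQuot (f : MvPolynomial (Fin 4) k) (n : ℕ) (e₁ e₂ e₃ : Fin 4 → k) :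
    MvPolynomial (Fin 3) (MvPolynomial (Fin 4) k) :=
  ∑ j ∈ Finset.range (n + 1), X 0 ^ j * pol f (j + 1) (fun m => e₂ m • X 1 + e₃ m • X 2)
    (fun m => algebraMap k _ (e₁ m))

theorem aeval_smul_X (c : k) (j : Fin 3) (y : Fin 3 → Polynomial (MvPolynomial (Fin 4) k)) :
    aeval y (c • X j : MvPolynomial (Fin 3) (MvPolynomial (Fin 4) k)) = c • y j := by
  have h := map_smul ((aeval y).restrictScalars k) c
    (X j : MvPolynomial (Fin 3) (MvPolynomial (Fin 4) k))
  rwa [AlgHom.restrictScalars_apply, AlgHom.restrictScalars_apply, aeval_X] at h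

theorem isHomogeneous_ternaryPol (hf : f.IsHomogeneous d) {i : ℕ} (hi : i ≤ d)
    (e₁ e₂ e₃ : Fin 4 → k) : (ternaryPol f i e₁ e₂ e₃).IsHomogeneous i := by
  have := pol_mem hf (fun e => (homogeneousSubmodule (Fin 3) (MvPolynomial (Fin 4) k)
    e).restrictScalars k) ((mem_homogeneousSubmodule _ _).2 (isHomogeneous_one _ _))
    (fun a b x y hx hy => (mem_homogeneousSubmodule _ _).2
      (((mem_homogeneousSubmodule _ _).1 hx).mul ((mem_homogeneousSubmodule _ _).1 hy))) 0 1
    (fun m => C (X m)) (fun m => e₁ m • X 0 + e₂ m • X 1 + e₃ m • X 2)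
    (fun m => (mem_homogeneousSubmodule _ _).2 (isHomogeneous_C _ _))
    (fun m => by
      refine Submodule.add_mem _ (Submodule.add_mem _ ?_ ?_) ?_ <;>
      exact Submodule.smul_mem _ _ ((mem_homogeneousSubmodule _ _).2 (isHomogeneous_X _ _))) i hi
  rw [mul_zero, mul_one, zero_add] at this
  exact (mem_homogeneousSubmodule _ _).1 this

theorem isHomogeneous_ternaryQuot {n : ℕ} (hf : f.IsHomogeneous (n + 1))
    (e₁ e₂ e₃ : Fin 4 → k) : (ternaryQuot f n e₁ e₂ e₃).IsHomogeneous n := by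
  refine IsHomogeneous.sum _ _ _ fun j hj => ?_
  have hj := Finset.mem_range.1 hj
  have := pol_mem hf (fun e => (homogeneousSubmodule (Fin 3) (MvPolynomial (Fin 4) k)
    e).restrictScalars k) ((mem_homogeneousSubmodule _ _).2 (isHomogeneous_one _ _))
    (fun a b x y hx hy => (mem_homogeneousSubmodule _ _).2
      (((mem_homogeneousSubmodule _ _).1 hx).mul ((mem_homogeneousSubmodule _ _).1 hy))) 1 0
    (fun m => e₂ m • X 1 + e₃ m • X 2) (fun m => algebraMap k _ (e₁ m))
    (fun m => by
      refine Submodule.add_mem _ ?_ ?_ <;>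
      exact Submodule.smul_mem _ _ ((mem_homogeneousSubmodule _ _).2 (isHomogeneous_X _ _)))
    (fun m => (mem_homogeneousSubmodule _ _).2 (isHomogeneous_C _ _)) (j + 1) (by omega)
  have h2 := ((isHomogeneous_X_pow (R := MvPolynomial (Fin 4) k) (0 : Fin 3) j)).mul
    ((mem_homogeneousSubmodule _ _).1 this)
  convert h2 using 1
  omega

/-- Specialization of `k[x][t]` at a point and a parameter. -/
noncomputable def specialize (x : Fin 4 → k) (t : k) :
    Polynomial (MvPolynomial (Fin 4) k) →ₐ[k] k :=
  (Polynomial.aeval t).comp (Polynomial.mapAlgHom (aeval x))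

theorem specialize_apply (x : Fin 4 → k) (t : k) (p : Polynomial (MvPolynomial (Fin 4) k)) :
    specialize x t p = (p.map (eval x)).eval t := by
  rw [specialize, AlgHom.comp_apply, Polynomial.coe_aeval_eq_eval]
  rfl

theorem specialize_planePoint (x : Fin 4 → k) (t : k) (b₁ b₂ b₃ : MvPolynomial (Fin 4) k) :
    (fun j => specialize x t (planePoint b₁ b₂ b₃ j)) =
      ![eval x b₃, eval x b₃ * t, -(eval x b₁ + eval x b₂ * t)] := by
  ext1 j
  rw [specialize_apply]
  fin_cases j <;> simp [planePoint]

theorem eval_ternaryPol (i : ℕ) (e₁ e₂ e₃ x : Fin 4 → k) (t : k)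
    (y : Fin 3 → Polynomial (MvPolynomial (Fin 4) k)) {z : Fin 3 → k}
    (hz : (fun j => specialize x t (y j)) = z) :
    ((aeval y (ternaryPol f i e₁ e₂ e₃)).map (eval x)).eval t =
      pol f i x (z 0 • e₁ + z 1 • e₂ + z 2 • e₃) := by
  subst hz
  rw [← specialize_apply]
  have := map_pol (R := MvPolynomial (Fin 3) (MvPolynomial (Fin 4) k)) f i (fun m => C (X m))
    (fun m => e₁ m • X 0 + e₂ m • X 1 + e₃ m • X 2)
    ((specialize x t).comp ((aeval y).restrictScalars k))
  refine this.trans ?_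
  congr 1
  · ext1 m
    simp [specialize_apply, Polynomial.algebraMap_eq]
  · ext1 m
    simp [aeval_smul_X, mul_comm]

theorem eval_ternaryQuot (n : ℕ) (e₁ e₂ e₃ x : Fin 4 → k) (t : k)
    (y : Fin 3 → Polynomial (MvPolynomial (Fin 4) k)) {z : Fin 3 → k}
    (hz : (fun j => specialize x t (y j)) = z) :
    ((aeval y (ternaryQuot f n e₁ e₂ e₃)).map (eval x)).eval t =
      ∑ j ∈ Finset.range (n + 1), z 0 ^ j * pol f (j + 1) (z 1 • e₂ + z 2 • e₃) e₁ := by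
  subst hz
  rw [← specialize_apply, ternaryQuot, map_sum, map_sum]
  refine Finset.sum_congr rfl fun j _ => ?_
  rw [map_mul, map_mul, map_pow, map_pow, aeval_X]
  congr 1
  refine (map_pol (R := MvPolynomial (Fin 3) (MvPolynomial (Fin 4) k)) f (j + 1)
    (fun m => e₂ m • X 1 + e₃ m • X 2) (fun m => algebraMap k _ (e₁ m))
    ((specialize x t).comp ((aeval y).restrictScalars k))).trans ?_
  congr 1
  · ext1 m
    simp [aeval_smul_X, mul_comm]
  · ext1 m
    rw [AlgHom.commutes]; rfl

theorem mul_eval_ternaryQuot {n : ℕ} (hf : f.IsHomogeneous (n + 1)) (e₁ e₂ e₃ : Fin 4 → k)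
    (hL : ∀ v ∈ Submodule.span k {e₂, e₃}, eval v f = 0) (x : Fin 4 → k) (t : k)
    (y : Fin 3 → Polynomial (MvPolynomial (Fin 4) k)) {z : Fin 3 → k}
    (hz : (fun j => specialize x t (y j)) = z) :
    z 0 * ((aeval y (ternaryQuot f n e₁ e₂ e₃)).map (eval x)).eval t =
      eval (z 0 • e₁ + z 1 • e₂ + z 2 • e₃) f := by
  have h := aeval_add_smul hf (z 1 • e₂ + z 2 • e₃) e₁ (z 0)
  rw [Finset.sum_range_succ', pol_zero, aeval_eq_eval, aeval_eq_eval,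
    hL (z 1 • e₂ + z 2 • e₃) (Submodule.mem_span_pair.2 ⟨_, _, rfl⟩), zero_mul, add_zero] at h
  rw [eval_ternaryQuot _ _ _ _ _ _ _ hz, add_assoc, add_comm (z 0 • e₁), h, Finset.mul_sum]
  exact Finset.sum_congr rfl fun j _ => by ring

/-- Polynomials over `k[x]` all of whose coefficients have total degree at most `e`. -/
def coeffTotalDegreeLE (k : Type*) [Field k] (e : ℕ) :
    Submodule k (Polynomial (MvPolynomial (Fin 4) k)) where
  carrier := {p | ∀ j, (p.coeff j).totalDegree ≤ e}
  add_mem' {p q} hp hq j := by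
    rw [Polynomial.coeff_add]
    exact (totalDegree_add _ _).trans (max_le (hp j) (hq j))
  zero_mem' j := by simp
  smul_mem' c p hp j := by
    rw [Polynomial.coeff_smul]
    exact (totalDegree_smul_le _ _).trans (hp j)

theorem one_mem_coeffTotalDegreeLE : 1 ∈ coeffTotalDegreeLE k 0 := fun j => by
  rw [Polynomial.coeff_one]; split_ifs <;> simp

theorem C_mem_coeffTotalDegreeLE {e : ℕ} {a : MvPolynomial (Fin 4) k} (ha : a.totalDegree ≤ e) :
    Polynomial.C a ∈ coeffTotalDegreeLE k e := fun j => by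
  rw [Polynomial.coeff_C]; split_ifs
  · exact ha
  · simp

theorem X_mem_coeffTotalDegreeLE : Polynomial.X ∈ coeffTotalDegreeLE k 0 := fun j => by
  rw [Polynomial.coeff_X]; split_ifs <;> simp

theorem mul_mem_coeffTotalDegreeLE (a b : ℕ) (p q : Polynomial (MvPolynomial (Fin 4) k))
    (hp : p ∈ coeffTotalDegreeLE k a) (hq : q ∈ coeffTotalDegreeLE k b) :
    p * q ∈ coeffTotalDegreeLE k (a + b) := by
  intro j
  rw [Polynomial.coeff_mul]
  exact (totalDegree_finsetSum _ _).trans (Finset.sup_le fun x _ =>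
    (totalDegree_mul _ _).trans (add_le_add (hp _) (hq _)))

theorem planePoint_mem_coeffTotalDegreeLE {e : ℕ} {b₁ b₂ b₃ : MvPolynomial (Fin 4) k}
    (h₁ : b₁.totalDegree ≤ e) (h₂ : b₂.totalDegree ≤ e) (h₃ : b₃.totalDegree ≤ e) (j : Fin 3) :
    planePoint b₁ b₂ b₃ j ∈ coeffTotalDegreeLE k e := by
  fin_cases j
  · exact C_mem_coeffTotalDegreeLE h₃
  · exact mul_mem_coeffTotalDegreeLE e 0 _ _ (C_mem_coeffTotalDegreeLE h₃)
      X_mem_coeffTotalDegreeLE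
  · exact neg_mem (add_mem (C_mem_coeffTotalDegreeLE h₁)
      (mul_mem_coeffTotalDegreeLE e 0 _ _ (C_mem_coeffTotalDegreeLE h₂) X_mem_coeffTotalDegreeLE))

theorem ternaryPol_mem_coeffTotalDegreeLE (hf : f.IsHomogeneous d) {i : ℕ} (hi : i ≤ d)
    (e₁ e₂ e₃ : Fin 4 → k) {e : ℕ} {y : Fin 3 → Polynomial (MvPolynomial (Fin 4) k)}
    (hy : ∀ j, y j ∈ coeffTotalDegreeLE k e) :
    aeval y (ternaryPol f i e₁ e₂ e₃) ∈ coeffTotalDegreeLE k (d - i + i * e) := by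
  have h1 := map_pol (R := MvPolynomial (Fin 3) (MvPolynomial (Fin 4) k)) f i (fun m => C (X m))
    (fun m => e₁ m • X 0 + e₂ m • X 1 + e₃ m • X 2)
    ((aeval y).restrictScalars k)
  rw [show aeval y (ternaryPol f i e₁ e₂ e₃) = _ from h1, ← mul_one (d - i)]
  refine pol_mem hf (coeffTotalDegreeLE k) one_mem_coeffTotalDegreeLE mul_mem_coeffTotalDegreeLE
    1 e _ _ (fun m => ?_) (fun m => ?_) i hi
  · rw [AlgHom.restrictScalars_apply, aeval_C, Polynomial.algebraMap_eq]
    exact C_mem_coeffTotalDegreeLE (totalDegree_X _).le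
  · rw [map_add, map_add, map_smul, map_smul, map_smul]
    simp only [AlgHom.restrictScalars_apply, aeval_X]
    exact add_mem (add_mem (Submodule.smul_mem _ _ (hy 0)) (Submodule.smul_mem _ _ (hy 1)))
      (Submodule.smul_mem _ _ (hy 2))

theorem pow_mem_coeffTotalDegreeLE {e : ℕ} {p : Polynomial (MvPolynomial (Fin 4) k)}
    (hp : p ∈ coeffTotalDegreeLE k e) (j : ℕ) : p ^ j ∈ coeffTotalDegreeLE k (j * e) := by
  induction j with
  | zero => simpa using one_mem_coeffTotalDegreeLE
  | succ j ih =>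
    rw [pow_succ, add_mul, one_mul]
    exact mul_mem_coeffTotalDegreeLE _ _ _ _ ih hp

theorem ternaryQuot_mem_coeffTotalDegreeLE {n : ℕ} (hf : f.IsHomogeneous (n + 1))
    (e₁ e₂ e₃ : Fin 4 → k) {e : ℕ} {y : Fin 3 → Polynomial (MvPolynomial (Fin 4) k)}
    (hy : ∀ j, y j ∈ coeffTotalDegreeLE k e) :
    aeval y (ternaryQuot f n e₁ e₂ e₃) ∈ coeffTotalDegreeLE k (n * e) := by
  rw [ternaryQuot, map_sum]
  refine sum_mem fun j hj => ?_
  have hj := Finset.mem_range.1 hj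
  have h1 := map_pol (R := MvPolynomial (Fin 3) (MvPolynomial (Fin 4) k)) f (j + 1)
    (fun m => e₂ m • X 1 + e₃ m • X 2)
    (fun m => algebraMap k (MvPolynomial (Fin 3) (MvPolynomial (Fin 4) k)) (e₁ m))
    ((aeval y).restrictScalars k)
  simp only [AlgHom.restrictScalars_apply] at h1
  rw [map_mul, map_pow, aeval_X, h1]
  have h2 : n * e = j * e + ((n + 1 - (j + 1)) * e + (j + 1) * 0) := by
    rw [mul_zero, add_zero, ← add_mul]; congr 1; omega
  rw [h2]
  refine mul_mem_coeffTotalDegreeLE _ _ _ _ (pow_mem_coeffTotalDegreeLE (hy 0) j)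
    (pol_mem hf (coeffTotalDegreeLE k) one_mem_coeffTotalDegreeLE mul_mem_coeffTotalDegreeLE
    e 0 _ _ (fun m => ?_) (fun m => ?_) (j + 1) (by omega))
  · rw [map_add, aeval_smul_X, aeval_smul_X]
    exact add_mem (Submodule.smul_mem _ _ (hy 1)) (Submodule.smul_mem _ _ (hy 2))
  · have h3 := ((aeval y : MvPolynomial (Fin 3) (MvPolynomial (Fin 4) k)
      →ₐ[MvPolynomial (Fin 4) k] _).restrictScalars k).commutes (e₁ m)
    simp only [AlgHom.restrictScalars_apply] at h3
    rw [h3]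
    exact C_mem_coeffTotalDegreeLE (totalDegree_C _).le

end TernaryForms

section EliminationBound

theorem Polynomial.map_resultant_eq_zero {A B : Type*} [CommRing A] [CommRing B] (φ : A →+* B)
    {P Q : Polynomial A} {m n : ℕ} (hP : P.natDegree ≤ m) (hQ : Q.natDegree ≤ n) (hm : m ≠ 0)
    {t : B} (hPt : (P.map φ).eval t = 0) (hQt : (Q.map φ).eval t = 0) :
    φ (Polynomial.resultant P Q m n) = 0 := by
  obtain ⟨p, q, -, -, h⟩ := Polynomial.exists_mul_add_mul_eq_C_resultant P Q hP hQ (Or.inl hm)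
  have h := congrArg (fun p => (Polynomial.map φ p).eval t) h
  simpa [hPt, hQt] using h.symm

theorem Polynomial.resultant_ne_zero_of_forall {K : Type*} [Field K] [IsAlgClosed K]
    {P Q : Polynomial K} {m : ℕ} (hP : P.natDegree ≤ m) (hQ : Q ≠ 0)
    (h : ∀ t, P.eval t = 0 → Q.eval t ≠ 0) :
    Polynomial.resultant P Q m Q.natDegree ≠ 0 := by
  obtain ⟨j, rfl⟩ := Nat.exists_eq_add_of_le hP
  rw [Polynomial.resultant_add_left_deg _ _ _ _ _ le_rfl]
  refine mul_ne_zero (mul_ne_zero (pow_ne_zero _ (by simp)) (pow_ne_zero _ ?_))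
    (Polynomial.resultant_ne_zero _ _ ?_)
  · simpa using hQ
  · rw [Polynomial.isCoprime_iff_aeval_ne_zero_of_isAlgClosed K (K := K)]
    intro t
    by_cases ht : P.eval t = 0
    · right; simpa using h t ht
    · left; simpa using ht

variable {k : Type*} [Field k] {f : MvPolynomial (Fin 4) k} {n : ℕ}

theorem eval_eq_zero_of_eval_mul_eq_zero [Infinite k] {M : Submodule k (Fin 4 → k)}
    {R g : MvPolynomial (Fin 4) k} (hg : g.IsHomogeneous n) (h : ∀ v ∈ M, eval v R * eval v g = 0)
    {y : Fin 4 → k} (hy : y ∈ M) (hgy : eval y g ≠ 0) {x : Fin 4 → k} (hx : x ∈ M) :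
    eval x R = 0 := by
  have h1 : linePoly R x y * linePoly g x y = 0 := Polynomial.funext fun s => by
    rw [Polynomial.eval_mul, eval_linePoly, eval_linePoly, aeval_eq_eval,
      h _ (M.add_mem hx (M.smul_mem s hy)), Polynomial.eval_zero]
  have h2 : linePoly g x y ≠ 0 := by
    intro h0
    apply hgy
    have := pol_top hg x y
    rw [pol, h0, Polynomial.coeff_zero, aeval_eq_eval] at this
    exact this.symm
  have h3 := (mul_eq_zero.1 h1).resolve_right h2
  have h4 := eval_linePoly R x y 0
  rw [h3, zero_smul, add_zero, aeval_eq_eval, Polynomial.eval_zero] at h4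
  exact h4.symm

/-- The polar form of order `i` on the tangent plane at a generic point. -/
noncomputable def tangentPol (f : MvPolynomial (Fin 4) k) (i : ℕ) (e : Fin 4 → Fin 4 → k) :
    Polynomial (MvPolynomial (Fin 4) k) :=
  aeval (planePoint (polPoly f 1 (e 1)) (polPoly f 1 (e 2)) (polPoly f 1 (e 3)))
    (ternaryPol f i (e 1) (e 2) (e 3))

/-- The equation of the residual curve on the tangent plane at a generic point. -/
noncomputable def tangentQuot (f : MvPolynomial (Fin 4) k) (n : ℕ) (e : Fin 4 → Fin 4 → k) :
    Polynomial (MvPolynomial (Fin 4) k) :=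
  aeval (planePoint (polPoly f 1 (e 1)) (polPoly f 1 (e 2)) (polPoly f 1 (e 3)))
    (ternaryQuot f n (e 1) (e 2) (e 3))

theorem natDegree_tangentPol_le (hf : f.IsHomogeneous (n + 1)) {i : ℕ} (hi : i ≤ n + 1)
    (e : Fin 4 → Fin 4 → k) : (tangentPol f i e).natDegree ≤ i :=
  natDegree_aeval_le (isHomogeneous_ternaryPol hf hi _ _ _) (natDegree_planePoint_le _ _ _)

theorem natDegree_tangentQuot_le (hf : f.IsHomogeneous (n + 1)) (e : Fin 4 → Fin 4 → k) :
    (tangentQuot f n e).natDegree ≤ n :=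
  natDegree_aeval_le (isHomogeneous_ternaryQuot hf _ _ _) (natDegree_planePoint_le _ _ _)

theorem pow_dvd_resultant_tangentPol (hf : f.IsHomogeneous (n + 1)) {i : ℕ} (hi : i ≤ n + 1)
    (e : Fin 4 → Fin 4 → k) (h : polPoly f 1 (e 3) ≠ 0) :
    polPoly f 1 (e 3) ^ (i * n) ∣
      Polynomial.resultant (tangentPol f i e) (tangentQuot f n e) i n :=
  pow_dvd_resultant_planePoint (isHomogeneous_ternaryPol hf hi _ _ _)
    (isHomogeneous_ternaryQuot hf _ _ _) _ _ h

theorem totalDegree_resultant_tangentPol_le (hf : f.IsHomogeneous (n + 1)) {i : ℕ}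
    (hi : i ≤ n + 1) (e : Fin 4 → Fin 4 → k) :
    (Polynomial.resultant (tangentPol f i e) (tangentQuot f n e) i n).totalDegree ≤
      i * (n * n) + n * (n + 1 - i + i * n) := by
  have hβ : ∀ j, (polPoly f 1 (e j)).totalDegree ≤ n := fun j =>
    (isHomogeneous_polPoly hf (by omega) (e j)).totalDegree_le
  have hy := planePoint_mem_coeffTotalDegreeLE (hβ 1) (hβ 2) (hβ 3)
  exact totalDegree_resultant_le (ternaryPol_mem_coeffTotalDegreeLE hf hi _ _ _ hy)
    (ternaryQuot_mem_coeffTotalDegreeLE hf _ _ _ hy) i n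

theorem eval_tangentPol (i : ℕ) (e : Fin 4 → Fin 4 → k) (x : Fin 4 → k) (t : k) :
    ((tangentPol f i e).map (eval x)).eval t =
      pol f i x (pol f 1 x (e 3) • e 1 + (pol f 1 x (e 3) * t) • e 2 +
        (-(pol f 1 x (e 1) + pol f 1 x (e 2) * t)) • e 3) := by
  have h := eval_ternaryPol (f := f) i (e 1) (e 2) (e 3) x t _ (specialize_planePoint x t
    (polPoly f 1 (e 1)) (polPoly f 1 (e 2)) (polPoly f 1 (e 3)))
  rw [eval_polPoly, eval_polPoly, eval_polPoly] at h
  exact h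

theorem mul_eval_tangentQuot (hf : f.IsHomogeneous (n + 1)) (e : Fin 4 → Fin 4 → k)
    (hL : ∀ v ∈ Submodule.span k {e 2, e 3}, eval v f = 0) (x : Fin 4 → k) (t : k) :
    pol f 1 x (e 3) * ((tangentQuot f n e).map (eval x)).eval t =
      eval (pol f 1 x (e 3) • e 1 + (pol f 1 x (e 3) * t) • e 2 +
        (-(pol f 1 x (e 1) + pol f 1 x (e 2) * t)) • e 3) f := by
  have h := mul_eval_ternaryQuot hf (e 1) (e 2) (e 3) hL x t _ (specialize_planePoint x t
    (polPoly f 1 (e 1)) (polPoly f 1 (e 2)) (polPoly f 1 (e 3)))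
  rw [eval_polPoly, eval_polPoly, eval_polPoly] at h
  exact h

theorem eval_resultant_tangentPol_ne_zero [IsAlgClosed k] (hf : f.IsHomogeneous (n + 1)) {i : ℕ}
    (hin : i ≤ n + 1) (b : Fin 4 → Fin 4 → k)
    (hL : ∀ v ∈ Submodule.span k {b 2, b 3}, eval v f = 0)
    (h₀₁ : pol f 1 (b 0) (b 1) = 0) (h₀₂ : pol f 1 (b 0) (b 2) = 0)
    (h₀₃ : pol f 1 (b 0) (b 3) ≠ 0) (h₂₁ : pol f 1 (b 2) (b 1) ≠ 0)
    (hroot : ∀ s : k, pol f i (b 0) (b 1 + s • b 2) = 0 → eval (b 1 + s • b 2) f ≠ 0) :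
    eval (b 0) (Polynomial.resultant (tangentPol f i b) (tangentQuot f n b) i n) ≠ 0 := by
  set c := pol f 1 (b 0) (b 3) with hc
  have hvec : ∀ t : k, c • b 1 + (c * t) • b 2 +
      (-(pol f 1 (b 0) (b 1) + pol f 1 (b 0) (b 2) * t)) • b 3 = c • (b 1 + t • b 2) := by
    intro t
    rw [h₀₁, h₀₂]
    module
  have hP₀ : ∀ t, ((tangentPol f i b).map (eval (b 0))).eval t =
      c ^ i * pol f i (b 0) (b 1 + t • b 2) := by
    intro t
    rw [eval_tangentPol, ← hc, hvec, pol_smul_right]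
  have hQ₀ : (tangentQuot f n b).map (eval (b 0)) =
      Polynomial.C (c ^ n) * linePoly f (b 1) (b 2) := by
    refine Polynomial.funext fun t => ?_
    apply mul_left_cancel₀ h₀₃
    have h1 := mul_eval_tangentQuot hf b hL (b 0) t
    have h2 := aeval_smul_of_isHomogeneous (R := k) hf c (b 1 + t • b 2)
    rw [aeval_eq_eval] at h2
    rw [← hc, hvec, h2] at h1
    rw [h1, Polynomial.eval_mul, Polynomial.eval_C, eval_linePoly, aeval_eq_eval]
    ring
  have hcn : c ^ n ≠ 0 := pow_ne_zero _ h₀₃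
  have hcoeff : (linePoly f (b 1) (b 2)).coeff n ≠ 0 := by
    have h := pol_swap hf (b 1) (b 2) (j := n) (by omega)
    rw [show n + 1 - n = 1 by omega] at h
    rw [← pol, h]
    exact h₂₁
  have hQn : ((tangentQuot f n b).map (eval (b 0))).coeff n ≠ 0 := by
    rw [hQ₀, Polynomial.coeff_C_mul]
    exact mul_ne_zero hcn hcoeff
  have hdeg : ((tangentQuot f n b).map (eval (b 0))).natDegree = n :=
    le_antisymm (Polynomial.natDegree_map_le.trans (natDegree_tangentQuot_le hf b))
      (Polynomial.le_natDegree_of_ne_zero hQn)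
  have hne := Polynomial.resultant_ne_zero_of_forall (P := (tangentPol f i b).map (eval (b 0)))
    (Q := (tangentQuot f n b).map (eval (b 0)))
    (Polynomial.natDegree_map_le.trans (natDegree_tangentPol_le hf hin b)) (by
      intro h0
      rw [h0, Polynomial.coeff_zero] at hQn
      exact hQn rfl) (fun t ht => by
      rw [hP₀] at ht
      have := hroot t ((mul_eq_zero.1 ht).resolve_left (pow_ne_zero _ h₀₃))
      rw [hQ₀, Polynomial.eval_mul, Polynomial.eval_C, eval_linePoly, aeval_eq_eval]
      exact mul_ne_zero hcn this)
  rwa [hdeg, Polynomial.resultant_map_map] at hne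

theorem eval_resultant_tangentPol_eq_zero [Infinite k] (hf : f.IsHomogeneous (n + 1))
    {i : ℕ} (hi : i ≠ 0)
    (hin : i ≤ n + 1) (b : Module.Basis (Fin 4) k (Fin 4 → k))
    (hL : ∀ v ∈ Submodule.span k {b 2, b 3}, eval v f = 0) {M : Submodule k (Fin 4 → k)}
    (hM : IsLineOn f M) (hdis : M ⊓ Submodule.span k {b 2, b 3} = ⊥) {v : Fin 4 → k} (hv : v ∈ M)
    (hv₃ : pol f 1 v (b 3) ≠ 0) :
    eval v (Polynomial.resultant (tangentPol f i b) (tangentQuot f n b) i n) = 0 := by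
  obtain ⟨-, s, -, δ, -, hm, -⟩ := exists_basis_of_disjoint b hM.1 hdis
  have h1 := hM.pol_eq_zero hv hm 1
  rw [pol_one_add, pol_one_add, pol_one_smul, pol_one_smul] at h1
  have hvec : pol f 1 v (b 3) • b 1 + (pol f 1 v (b 3) * s) • b 2 +
      (-(pol f 1 v (b 1) + pol f 1 v (b 2) * s)) • b 3 =
      pol f 1 v (b 3) • (b 1 + s • b 2 + δ • b 3) := by
    have : -(pol f 1 v (b 1) + pol f 1 v (b 2) * s) = δ * pol f 1 v (b 3) := by
      linear_combination -h1
    rw [this]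
    module
  refine Polynomial.map_resultant_eq_zero (eval v) (natDegree_tangentPol_le hf hin b)
    (natDegree_tangentQuot_le hf b) hi (t := s) ?_ ?_
  · rw [eval_tangentPol, hvec, pol_smul_right, hM.pol_eq_zero hv hm, mul_zero]
  · apply mul_left_cancel₀ hv₃
    rw [mul_eval_tangentQuot hf b hL, hvec, mul_zero]
    exact hM.2 _ (M.smul_mem _ hm)

theorem card_skew_lines_le_of_frame [IsAlgClosed k] (hf : IsSmoothSurface f (n + 1)) {i : ℕ}
    (hi : i ≠ 0) (hin : i ≤ n + 1) (b : Module.Basis (Fin 4) k (Fin 4 → k))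
    (hL : ∀ v ∈ Submodule.span k {b 2, b 3}, eval v f = 0)
    (h₀ : eval (b 0) f = 0) (h₀₁ : pol f 1 (b 0) (b 1) = 0) (h₀₂ : pol f 1 (b 0) (b 2) = 0)
    (h₀₃ : pol f 1 (b 0) (b 3) ≠ 0) (h₂₁ : pol f 1 (b 2) (b 1) ≠ 0)
    (hroot : ∀ s : k, pol f i (b 0) (b 1 + s • b 2) = 0 → eval (b 1 + s • b 2) f ≠ 0)
    (T : Finset (Submodule k (Fin 4 → k))) (hT : ∀ M ∈ T, IsLineOn f M)
    (hdis : ∀ M ∈ T, M ⊓ Submodule.span k {b 2, b 3} = ⊥)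
    (hT₃ : ∀ M ∈ T, ∃ x ∈ M, pol f 1 x (b 3) ≠ 0) :
    T.card ≤ n * (n * (n + 1 - i + i * n)) := by
  have hhom := hf.2.1
  have hβhom : (polPoly f 1 (b 3)).IsHomogeneous n := isHomogeneous_polPoly hhom (by omega) (b 3)
  have hβ₃ : polPoly f 1 (b 3) ≠ 0 := by
    intro h
    apply h₀₃
    rw [← eval_polPoly, h, map_zero]
  obtain ⟨R, hR⟩ := pow_dvd_resultant_tangentPol hhom hin b hβ₃
  have hR₀ : eval (b 0) R ≠ 0 := by
    have := eval_resultant_tangentPol_ne_zero hhom hin b hL h₀₁ h₀₂ h₀₃ h₂₁ hroot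
    rw [hR, map_mul] at this
    exact right_ne_zero_of_mul this
  have hRf : ¬ f ∣ R := by
    rintro ⟨g, rfl⟩
    rw [map_mul, h₀, zero_mul] at hR₀
    exact hR₀ rfl
  have hdegR : R.totalDegree ≤ n * (n + 1 - i + i * n) := by
    have hR0 : R ≠ 0 := by rintro rfl; simp at hR₀
    have h1 := totalDegree_resultant_tangentPol_le hhom hin b
    have h2 : (polPoly f 1 (b 3) ^ (i * n)).totalDegree = n * (i * n) :=
      (hβhom.pow _).totalDegree (pow_ne_zero _ hβ₃)
    rw [hR, totalDegree_mul_of_isDomain (pow_ne_zero _ hβ₃) hR0, h2] at h1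
    have h3 : n * (i * n) = i * (n * n) := by ring
    omega
  refine (card_skew_lines_le b hhom (hf.prime (by omega)) hRf hL T hT hdis ?_).trans ?_
  · intro M hM x hx _
    obtain ⟨w, hw, hw₃⟩ := hT₃ M hM
    refine eval_eq_zero_of_eval_mul_eq_zero hβhom (fun v hv => ?_) hw
      (by rwa [eval_polPoly]) hx
    rw [eval_polPoly]
    by_cases hv₃ : pol f 1 v (b 3) = 0
    · rw [hv₃, mul_zero]
    have hres := eval_resultant_tangentPol_eq_zero hhom hi hin b hL (hT M hM) (hdis M hM) hv hv₃
    rw [hR, map_mul, map_pow, eval_polPoly] at hres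
    rw [(mul_eq_zero.1 hres).resolve_left (pow_ne_zero _ hv₃), zero_mul]
  · rw [Nat.add_sub_cancel]
    exact Nat.mul_le_mul_left _ hdegR

end EliminationBound

section PolarVanishing

variable {k : Type*} [Field k] {f : MvPolynomial (Fin 4) k} {d : ℕ}

theorem IsLineOn.exists_mem_ne_zero {M : Submodule k (Fin 4 → k)} (hM : IsLineOn f M) :
    ∃ x ∈ M, x ≠ 0 := by
  apply Submodule.exists_mem_ne_zero_of_ne_bot
  rintro rfl
  have := hM.1
  simp at this

/-- The middle polar forms of a smooth surface with many lines skew to a given one vanish. -/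
theorem pol_eq_zero_of_many_skew_lines [IsAlgClosed k] (hf : IsSmoothSurface f d) (hd : 3 < d)
    (hfin : {W | IsLineOn f W}.Finite) {L : Submodule k (Fin 4 → k)} (hL : IsLineOn f L)
    (T : Finset (Submodule k (Fin 4 → k))) (hTcard : (d - 1) ^ 4 ≤ T.card)
    (hT : ∀ M ∈ T, IsLineOn f M ∧ M ⊓ L = ⊥) {i : ℕ} (hi : 2 ≤ i) (hid : i + 2 ≤ d)
    (x v : Fin 4 → k) : pol f i x v = 0 := by
  classical
  induction i using Nat.strong_induction_on generalizing x v with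
  | _ i ih =>
  by_contra hne
  have hlow : ∀ j, 2 ≤ j → j < i → ∀ x v : Fin 4 → k, pol f j x v = 0 := fun j hj hji x v =>
    ih j hji hj (by omega) x v
  obtain ⟨n, rfl⟩ : ∃ n, d = n + 1 := ⟨d - 1, by omega⟩
  rw [Nat.add_sub_cancel] at hTcard
  have hpt : ∀ M ∈ T, ∃ x ∈ M, x ≠ 0 := fun M hM => (hT M hM).1.exists_mem_ne_zero
  choose! w hwM hw0 using hpt
  obtain ⟨l₁, l₀, hl, -, hl₁⟩ := Submodule.exists_span_pair_eq hL.1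
    (T.image fun M => LinearMap.ker (polarForm f (w M))) (by
      intro P hP hle
      obtain ⟨M, hM, rfl⟩ := Finset.mem_image.1 hP
      exact hf.polarForm_ne_zero (hw0 M hM) ((hT M hM).1.2 _ (hwM M hM))
        (polarForm_eq_zero_of_sup_eq_top
          (finrank_sup_of_inf_eq_bot (hT M hM).1.1 hL.1 (hT M hM).2)
          ((hT M hM).1.le_ker_polarForm (hwM M hM)) hle))
  have hwl : ∀ M ∈ T, pol f 1 (w M) l₁ ≠ 0 := by
    intro M hM h
    refine hl₁ _ (Finset.mem_image_of_mem _ hM) ?_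
    rwa [LinearMap.mem_ker, polarForm_apply]
  have hTpos : 0 < T.card := lt_of_lt_of_le (pow_pos (by omega) 4) hTcard
  obtain ⟨M₀, hM₀⟩ := Finset.card_pos.1 hTpos
  obtain ⟨x₁, v₁, hx₁, hv₁, hxv⟩ := exists_tangent_pol_ne_zero hf hd hL T (by simpa) hT hi
    (by omega) ⟨x, v, hne⟩
  obtain ⟨x₀, hx₀, hxl, hxW, hv⟩ := exists_base_point hf hd hfin (by omega) hx₁ hv₁ hxv
    ((hT M₀ hM₀).1.2 _ (hwM M₀ hM₀)) (hwl M₀ hM₀)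
  rw [Set.pair_comm] at hl
  obtain ⟨b, hb₃, hbL, h₀, h₀₁, h₀₂, h₀₃, h₂₁, hroot⟩ :=
    exists_frame hf hL (by omega) hlow hl hx₀ hxl hxW hv
  have hcard := card_skew_lines_le_of_frame hf (by omega) (by omega) b
    (fun v hv => hL.2 v (hbL ▸ hv)) h₀ h₀₁ h₀₂ h₀₃ h₂₁ hroot T (fun M hM => (hT M hM).1)
    (fun M hM => by rw [hbL]; exact (hT M hM).2)
    (fun M hM => ⟨w M, hwM M hM, by rw [hb₃]; exact hwl M hM⟩)
  have hlt : n + 1 - i + i * n < n * n := by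
    obtain ⟨j, rfl⟩ : ∃ j, n = i + 1 + j := ⟨n - i - 1, by omega⟩
    have : i + 1 + j + 1 - i = j + 2 := by omega
    rw [this]
    nlinarith
  have h4 : n * (n * (n + 1 - i + i * n)) < n ^ 4 := by
    have hn : 0 < n := by omega
    calc n * (n * (n + 1 - i + i * n)) < n * (n * (n * n)) := by gcongr
      _ = n ^ 4 := by ring
  omega

end PolarVanishing

section FrobeniusForm

variable {k : Type*} [Field k] {f : MvPolynomial (Fin 4) k} {d : ℕ}

theorem eval_add_of_pol_eq_zero (hf : f.IsHomogeneous d) (hd : 3 < d)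
    (hpol : ∀ i (x v : Fin 4 → k), 2 ≤ i → i + 2 ≤ d → pol f i x v = 0) (x v : Fin 4 → k) :
    eval (x + v) f = eval x f + pol f 1 x v + pol f 1 v x + eval v f := by
  have h := aeval_add_smul hf x v 1
  obtain ⟨m, rfl⟩ : ∃ m, d = m + 4 := ⟨d - 4, by omega⟩
  simp only [one_pow, mul_one, one_smul] at h
  rw [Finset.sum_range_succ, Finset.sum_range_succ, Finset.sum_range_succ',
    Finset.sum_range_succ', Finset.sum_eq_zero, pol_zero, pol_top hf,
    pol_swap hf x v (by omega : m + 3 ≤ m + 4)] at h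
  · simp only [aeval_eq_eval] at h
    have e : m + 4 - (m + 3) = 1 := by omega
    rw [e] at h
    rw [h]; simp only [zero_add]; ring
  · intro i hi
    rw [Finset.mem_range] at hi
    exact hpol _ _ _ (by omega) (by omega)

theorem exists_pow_ne_pow [IsAlgClosed k] {a b : ℕ} (h : a ≠ b) : ∃ s : k, s ^ a ≠ s ^ b := by
  by_contra! hcon
  have : (Polynomial.X ^ a : Polynomial k) = Polynomial.X ^ b :=
    Polynomial.funext fun s => by simpa using hcon s
  exact h (by simpa using congrArg Polynomial.natDegree this)

theorem pol_one_add_left_of_pol_eq_zero [IsAlgClosed k] (hf : f.IsHomogeneous d) (hd : 3 < d)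
    (hpol : ∀ i (x v : Fin 4 → k), 2 ≤ i → i + 2 ≤ d → pol f i x v = 0) (x v u : Fin 4 → k) :
    pol f 1 (x + v) u = pol f 1 x u + pol f 1 v u := by
  have hadd := eval_add_of_pol_eq_zero hf hd hpol
  have hcyc : ∀ x v u : Fin 4 → k, pol f 1 (x + v) u - pol f 1 x u - pol f 1 v u =
      pol f 1 (v + u) x - pol f 1 v x - pol f 1 u x := by
    intro x v u
    have h1 := hadd (x + v) u
    have h2 := hadd x (v + u)
    rw [hadd x v, pol_one_add] at h1
    rw [hadd v u, pol_one_add, ← add_assoc] at h2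
    linear_combination h2 - h1
  have hsmul : ∀ (s : k) (x v u : Fin 4 → k),
      pol f 1 (x + v) (s • u) - pol f 1 x (s • u) - pol f 1 v (s • u) =
        s * (pol f 1 (x + v) u - pol f 1 x u - pol f 1 v u) := by
    intro s x v u
    simp only [pol_one_smul]; ring
  obtain ⟨s, hs⟩ := exists_pow_ne_pow (k := k) (ne_of_gt hd)
  have e1 : pol f 1 (s • x + s • v) (s • u) - pol f 1 (s • x) (s • u) - pol f 1 (s • v) (s • u) =
      s ^ 3 * (pol f 1 (x + v) u - pol f 1 x u - pol f 1 v u) := by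
    rw [hsmul, hcyc, hsmul, hcyc, hsmul, hcyc]; ring
  have hd1 : d = (d - 1) + 1 := by omega
  have e2 : pol f 1 (s • x + s • v) (s • u) - pol f 1 (s • x) (s • u) - pol f 1 (s • v) (s • u) =
      s ^ d * (pol f 1 (x + v) u - pol f 1 x u - pol f 1 v u) := by
    rw [← smul_add]
    simp only [pol_one_smul, pol_smul_left hf _ _ _ (by omega : 1 ≤ d)]
    conv_rhs => rw [hd1, pow_succ]
    ring
  rw [e1] at e2
  have : (s ^ d - s ^ 3) * (pol f 1 (x + v) u - pol f 1 x u - pol f 1 v u) = 0 := by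
    linear_combination -e2
  rcases mul_eq_zero.1 this with h | h
  · exact absurd (sub_eq_zero.1 h) hs
  · linear_combination h

/-- If the `q`-th power map of an algebraically closed field is additive, with `1 < q`, then the
characteristic is a prime `p` and `q` is a power of `p`. -/
theorem exists_eq_prime_pow_of_add_pow [IsAlgClosed k] {q : ℕ} (hq : 1 < q)
    (h : ∀ s t : k, (s + t) ^ q = s ^ q + t ^ q) :
    ∃ p e : ℕ, p.Prime ∧ CharP k p ∧ 1 ≤ e ∧ q = p ^ e := by
  have key : ∀ m : ℕ, 1 < m → (∀ s : k, (s + 1) ^ m = s ^ m + 1) → (m : k) = 0 := by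
    intro m hm h
    have : ((Polynomial.X + 1) ^ m : Polynomial k) = Polynomial.X ^ m + 1 :=
      Polynomial.funext fun s => by simpa using h s
    have h1 := congrArg (fun g => Polynomial.coeff g 1) this
    simp only [Polynomial.coeff_X_add_one_pow, Nat.choose_one_right, Polynomial.coeff_add,
      Polynomial.coeff_X_pow, Polynomial.coeff_one] at h1
    rw [h1, if_neg (by omega), if_neg one_ne_zero, add_zero]
  have hq0 : (q : k) = 0 := key q hq fun s => by rw [h, one_pow]
  obtain ⟨p, hp⟩ := CharP.exists k
  have hp0 : p ≠ 0 := by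
    rintro rfl
    rw [CharP.cast_eq_zero_iff k 0, zero_dvd_iff] at hq0
    omega
  have hpp : p.Prime := (CharP.char_is_prime_or_zero k p).resolve_right hp0
  obtain ⟨e, m, hm, hqe⟩ := Nat.exists_eq_pow_mul_and_not_dvd (n := q) (by omega) p hpp.ne_one
  have : Fact p.Prime := ⟨hpp⟩
  have hm1 : m = 1 := by
    by_contra hne
    have hm0 : m ≠ 0 := by rintro rfl; simp at hm
    refine hm ((CharP.cast_eq_zero_iff k p m).1 (key m (by omega) fun s => ?_))
    obtain ⟨t, rfl⟩ := IsAlgClosed.exists_pow_nat_eq s (pow_pos hpp.pos e)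
    have := h t 1
    rw [hqe, pow_mul, pow_mul, add_pow_char_pow] at this
    simpa using this
  refine ⟨p, e, hpp, hp, ?_, by rw [hqe, hm1, mul_one]⟩
  rw [Nat.one_le_iff_ne_zero]
  rintro rfl
  rw [hqe, hm1] at hq
  simp at hq

theorem pol_one_self_eq_mul_eval (hf : f.IsHomogeneous d) (x : Fin 4 → k) :
    pol f 1 x x = d * eval x f := by
  have h := congrArg (eval x) hf.sum_X_mul_pderiv
  rw [pol_one_eq_sum]
  simpa [aeval_eq_eval] using h

/-- A smooth surface whose middle polar forms vanish is defined by a nondegenerate Frobenius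
form. -/
theorem exists_frobenius_form [IsAlgClosed k] (hf : IsSmoothSurface f d) (hd : 3 < d)
    (hpol : ∀ i (x v : Fin 4 → k), 2 ≤ i → i + 2 ≤ d → pol f i x v = 0) :
    ∃ p e : ℕ, p.Prime ∧ CharP k p ∧ 1 ≤ e ∧ d = p ^ e + 1 ∧
      (∀ x v u : Fin 4 → k, pol f 1 (x + v) u = pol f 1 x u + pol f 1 v u) ∧
      (∀ (c : k) (x u : Fin 4 → k), pol f 1 (c • x) u = c ^ p ^ e * pol f 1 x u) ∧
      ∀ x : Fin 4 → k, eval x f = pol f 1 x x := by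
  have hadd := pol_one_add_left_of_pol_eq_zero hf.2.1 hd hpol
  have hsm := fun (c : k) (x u : Fin 4 → k) => pol_smul_left hf.2.1 x u c (by omega : 1 ≤ d)
  have hf0 : eval 0 f = 0 := eval_zero_of_isHomogeneous hf.2.1 (by omega)
  obtain ⟨x, hx, hfx, -⟩ := exists_common_zero (by norm_num) f f hf0 hf0
  obtain ⟨u, hu⟩ := hf.exists_pol_ne_zero hx (by simpa [aeval_eq_eval] using hfx)
  obtain ⟨p, e, hp, hc, he, hq⟩ := exists_eq_prime_pow_of_add_pow (k := k) (q := d - 1) (by omega)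
    fun s t => by
      apply mul_right_cancel₀ hu
      rw [← hsm, add_smul, hadd, hsm, hsm, add_mul]
  rw [hq] at hsm
  have hde : d = p ^ e + 1 := by omega
  refine ⟨p, e, hp, hc, he, hde, hadd, hsm, fun x => ?_⟩
  have : (p : k) = 0 := CharP.cast_eq_zero k p
  rw [pol_one_self_eq_mul_eval hf.2.1, hde]
  push_cast
  rw [this, zero_pow (by omega), zero_add, one_mul]

end FrobeniusForm

section SemilinearFixedVectors

/-- The coefficients of a fixed vector of a Frobenius-semilinear map, in the cyclic basis generated
by a vector, as polynomials in the last coefficient. -/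
noncomputable def cyclicCoeff {K : Type*} [Field K] (Q : ℕ) (a : ℕ → K) : ℕ → Polynomial K
  | 0 => Polynomial.C (a 0) * Polynomial.X ^ Q
  | i + 1 => cyclicCoeff Q a i ^ Q + Polynomial.C (a (i + 1)) * Polynomial.X ^ Q

variable {K : Type*} [Field K] {Q : ℕ} {a : ℕ → K}

theorem X_pow_dvd_cyclicCoeff (hQ : Q ≠ 0) (i : ℕ) : Polynomial.X ^ Q ∣ cyclicCoeff Q a i := by
  induction i with
  | zero => exact dvd_mul_left _ _
  | succ i ih => exact dvd_add (dvd_pow ih hQ) (dvd_mul_left _ _)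

theorem eq_zero_of_cyclicCoeff_eq_zero (hQ : 1 < Q) {i : ℕ} (h : cyclicCoeff Q a i = 0) :
    ∀ j ≤ i, a j = 0 := by
  induction i with
  | zero =>
    intro j hj
    obtain rfl : j = 0 := by omega
    simpa [cyclicCoeff] using h
  | succ i ih =>
    rw [cyclicCoeff] at h
    have hcoeff : (cyclicCoeff Q a i ^ Q).coeff Q = 0 := by
      obtain ⟨g, hg⟩ := X_pow_dvd_cyclicCoeff (a := a) (by omega : Q ≠ 0) i
      rw [hg, mul_pow, ← pow_mul, Polynomial.coeff_X_pow_mul', if_neg]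
      have : Q * 1 < Q * Q := Nat.mul_lt_mul_of_pos_left hQ (by omega)
      omega
    have ha : a (i + 1) = 0 := by
      have := congrArg (fun p => Polynomial.coeff p Q) h
      simpa [hcoeff] using this
    rw [ha, map_zero, zero_mul, add_zero] at h
    intro j hj
    rcases Nat.lt_or_ge i j with hij | hij
    · obtain rfl : j = i + 1 := by omega
      exact ha
    · exact ih (pow_eq_zero_iff (by omega) |>.1 h) j hij

theorem exists_eval_cyclicCoeff_eq [IsAlgClosed K] (hQ : 1 < Q) {i j : ℕ} (hj : j ≤ i)
    (ha : a j ≠ 0) : ∃ t ≠ 0, (cyclicCoeff Q a i).eval t = t := by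
  obtain ⟨g, hg⟩ := X_pow_dvd_cyclicCoeff (a := a) (by omega : Q ≠ 0) i
  have hg0 : g ≠ 0 := by
    rintro rfl
    exact ha (eq_zero_of_cyclicCoeff_eq_zero hQ (by simpa using hg) j hj)
  obtain ⟨m, rfl⟩ : ∃ m, Q = m + 2 := ⟨Q - 2, by omega⟩
  have hdeg : 0 < (Polynomial.X ^ (m + 1) * g).natDegree := by
    rw [Polynomial.natDegree_mul (by simp) hg0, Polynomial.natDegree_X_pow]
    omega
  obtain ⟨t, ht⟩ := IsAlgClosed.exists_root (Polynomial.X ^ (m + 1) * g - Polynomial.C 1) (by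
    rw [Polynomial.degree_sub_C (Polynomial.natDegree_pos_iff_degree_pos.1 hdeg)]
    exact (Polynomial.natDegree_pos_iff_degree_pos.1 hdeg).ne')
  have ht1 : t ^ (m + 1) * g.eval t = 1 := by
    simpa [sub_eq_zero] using ht
  refine ⟨t, ?_, ?_⟩
  · rintro rfl
    simp at ht1
  · rw [hg]
    simp only [Polynomial.eval_mul, Polynomial.eval_pow, Polynomial.eval_X]
    linear_combination t * ht1

variable {τ : K →+* K} {V : Type*} [AddCommGroup V] [Module K V] [FiniteDimensional K V]

/-- A Frobenius-semilinear injective endomorphism of a nonzero finite-dimensional space over an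
algebraically closed field has a nonzero fixed vector. -/
theorem exists_semilinear_fixed_vector [IsAlgClosed K] [Nontrivial V] (hQ : 1 < Q)
    (hτ : ∀ x, τ x = x ^ Q) (Φ : V →ₛₗ[τ] V) (hΦ : Function.Injective Φ) :
    ∃ w ≠ 0, Φ w = w := by
  obtain ⟨v, hv⟩ := exists_ne (0 : V)
  have hne : ∀ i, Φ^[i] v ≠ 0 := by
    intro i h
    induction i with
    | zero => exact hv h
    | succ i ih =>
      rw [Function.iterate_succ_apply'] at h
      exact ih (hΦ (by rw [h, map_zero]))
  let U : ℕ → Submodule K V := fun r =>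
    Submodule.span K ((fun i => Φ^[i] v) '' (Finset.range r : Set ℕ))
  have hex : ∃ r, Φ^[r] v ∈ U r := by
    obtain ⟨r, hr⟩ := monotone_stabilizes_iff_noetherian.2
      (inferInstance : IsNoetherian K V) ⟨U, fun a b hab => Submodule.span_mono
        (Set.image_mono (by exact_mod_cast Finset.range_mono hab))⟩
    refine ⟨r, ?_⟩
    have := hr (r + 1) (by omega)
    change U r = U (r + 1) at this
    rw [this]
    exact Submodule.subset_span ⟨r, by simp, rfl⟩
  classical
  obtain ⟨hr, hmin⟩ := And.intro (Nat.find_spec hex) fun m => Nat.find_min (m := m) hex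
  generalize Nat.find hex = r at hr hmin
  obtain ⟨m, rfl⟩ : ∃ m, r = m + 1 := by
    refine ⟨r - 1, ?_⟩
    have : r ≠ 0 := by
      rintro rfl
      simp only [U] at hr
      simp at hr
      exact hv hr
    omega
  obtain ⟨a, ha⟩ := (Submodule.mem_span_image_finset_iff_exists_fun' K).1 hr
  obtain ⟨j, hj, haj⟩ : ∃ j ≤ m, a j ≠ 0 := by
    by_contra! hcon
    apply hne (m + 1)
    rw [← ha]
    exact Finset.sum_eq_zero fun i hi => by
      rw [hcon i (by rw [Finset.mem_range] at hi; omega), zero_smul]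
  obtain ⟨t, ht, hteq⟩ := exists_eval_cyclicCoeff_eq (a := a) hQ hj haj
  refine ⟨∑ i ∈ Finset.range (m + 1), (cyclicCoeff Q a i).eval t • Φ^[i] v, ?_, ?_⟩
  · intro h
    rw [Finset.sum_range_succ, hteq] at h
    apply hmin m (by omega)
    have : Φ^[m] v = -(t⁻¹ • ∑ i ∈ Finset.range m, (cyclicCoeff Q a i).eval t • Φ^[i] v) := by
      rw [eq_neg_of_add_eq_zero_left h, smul_neg, smul_smul, inv_mul_cancel₀ ht, one_smul, neg_neg]
    rw [this]
    exact neg_mem (Submodule.smul_mem _ _ (Submodule.sum_mem _ fun i hi =>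
      Submodule.smul_mem _ _ (Submodule.subset_span ⟨i, by simpa using hi, rfl⟩)))
  · rw [map_sum]
    simp only [LinearMap.map_smulₛₗ, hτ]
    simp only [← Function.iterate_succ_apply' Φ]
    rw [Finset.sum_range_succ, hteq, ← ha, Finset.smul_sum, Finset.sum_range_succ',
      Finset.sum_range_succ']
    rw [← add_assoc, ← Finset.sum_add_distrib]
    congr 1
    · refine Finset.sum_congr rfl fun i _ => ?_
      rw [smul_smul, ← add_smul, cyclicCoeff]
      simp only [Polynomial.eval_add, Polynomial.eval_mul, Polynomial.eval_pow, Polynomial.eval_C,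
        Polynomial.eval_X, mul_comm (a _)]
    · rw [smul_smul, cyclicCoeff]
      simp only [Polynomial.eval_mul, Polynomial.eval_pow, Polynomial.eval_C, Polynomial.eval_X,
        mul_comm (a _)]

/-- The fixed vectors of a Frobenius-semilinear injective endomorphism span. -/
theorem span_semilinear_fixed_vectors [IsAlgClosed K] (hQ : 1 < Q)
    (hτ : ∀ x, τ x = x ^ Q) (Φ : V →ₛₗ[τ] V) (hΦ : Function.Injective Φ) :
    Submodule.span K {v | Φ v = v} = ⊤ := by
  set U := Submodule.span K {v | Φ v = v} with hU
  by_contra hne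
  have : Nontrivial (V ⧸ U) := Submodule.Quotient.nontrivial_iff.2 hne
  have hle : U ≤ U.comap Φ := Submodule.span_le.2 fun v hv => by
    have hv' : Φ v = v := hv
    simpa [hv'] using Submodule.subset_span hv
  have hsurj : ∀ y ∈ U, ∃ z ∈ U, Φ z = y := by
    intro y hy
    induction hy using Submodule.span_induction with
    | mem x hx => exact ⟨x, Submodule.subset_span hx, hx⟩
    | zero => exact ⟨0, zero_mem _, map_zero _⟩
    | add x y _ _ hx hy =>
      obtain ⟨z, hz, rfl⟩ := hx
      obtain ⟨z', hz', rfl⟩ := hy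
      exact ⟨z + z', add_mem hz hz', map_add _ _ _⟩
    | smul c x _ hx =>
      obtain ⟨z, hz, rfl⟩ := hx
      obtain ⟨b, rfl⟩ := IsAlgClosed.exists_pow_nat_eq c (by omega : 0 < Q)
      exact ⟨b • z, Submodule.smul_mem _ _ hz, by rw [LinearMap.map_smulₛₗ, hτ]⟩
  have hlang : ∀ y ∈ U, ∀ c : K, ∃ z ∈ U, Φ z - z = c • y := by
    intro y hy
    induction hy using Submodule.span_induction with
    | mem x hx =>
      intro c
      have hx' : Φ x = x := hx
      obtain ⟨b, hb⟩ := IsAlgClosed.exists_root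
        (Polynomial.X ^ Q - Polynomial.X - Polynomial.C c) (by
          rw [Polynomial.degree_sub_C, Polynomial.degree_sub_eq_left_of_degree_lt]
          · simp; omega
          · simp; omega
          · rw [Polynomial.degree_sub_eq_left_of_degree_lt]
            · simp; omega
            · simp; omega)
      refine ⟨b • x, Submodule.smul_mem _ _ (Submodule.subset_span hx), ?_⟩
      rw [LinearMap.map_smulₛₗ, hτ, hx', ← sub_smul]
      congr 1
      simpa [sub_eq_zero] using hb
    | zero => exact fun c => ⟨0, zero_mem _, by simp⟩
    | add x y _ _ hx hy =>
      intro c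
      obtain ⟨z, hz, h⟩ := hx c
      obtain ⟨z', hz', h'⟩ := hy c
      exact ⟨z + z', add_mem hz hz', by rw [smul_add, ← h, ← h', map_add]; abel⟩
    | smul b x _ hx => exact fun c => by rw [smul_smul]; exact hx _
  obtain ⟨w, hw, hfix⟩ := exists_semilinear_fixed_vector hQ hτ (U.mapQ U Φ hle) (by
    rw [injective_iff_map_eq_zero]
    intro x hx
    obtain ⟨x, rfl⟩ := U.mkQ_surjective x
    rw [Submodule.mkQ_apply, Submodule.mapQ_apply, Submodule.Quotient.mk_eq_zero] at hx
    obtain ⟨z, hz, hzx⟩ := hsurj _ hx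
    rw [Submodule.mkQ_apply, Submodule.Quotient.mk_eq_zero, ← hΦ hzx]
    exact hz)
  obtain ⟨w, rfl⟩ := U.mkQ_surjective w
  rw [Submodule.mkQ_apply, Submodule.mapQ_apply, Submodule.Quotient.eq] at hfix
  obtain ⟨z, hz, hzw⟩ := hlang _ hfix 1
  apply hw
  rw [Submodule.mkQ_apply, Submodule.Quotient.mk_eq_zero]
  have : w - z ∈ U := Submodule.subset_span (by
    change Φ (w - z) = w - z
    rw [map_sub]
    rw [one_smul] at hzw
    rw [sub_eq_sub_iff_sub_eq_sub, hzw])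
  simpa using add_mem this hz

end SemilinearFixedVectors

section HermitianForm

variable {K : Type*} [Field K] {q : ℕ} {σ : K →+* K}
  {V : Type*} [AddCommGroup V] [Module K V]

/-- `v` is Hermitian for a `q`-Frobenius-sesquilinear form. -/
def IsHermitianVector (q : ℕ) (B : V →ₛₗ[σ] V →ₗ[K] K) (v : V) : Prop :=
  ∀ u, B u v = B v u ^ q

variable {B : V →ₛₗ[σ] V →ₗ[K] K}

theorem IsHermitianVector.add (hσ : ∀ x, σ x = x ^ q) {v w : V} (hv : IsHermitianVector q B v)
    (hw : IsHermitianVector q B w) : IsHermitianVector q B (v + w) := by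
  intro u
  rw [map_add, map_add, LinearMap.add_apply, hv, hw, ← hσ (_ + _), map_add, hσ, hσ]

theorem IsHermitianVector.smul (hσ : ∀ x, σ x = x ^ q) {v : V} (hv : IsHermitianVector q B v)
    {c : K} (hc : c ^ (q * q) = c) : IsHermitianVector q B (c • v) := by
  intro u
  rw [map_smul, LinearMap.map_smulₛₗ, LinearMap.smul_apply, hv, hσ, smul_eq_mul, smul_eq_mul,
    mul_pow, ← pow_mul, hc]

theorem IsHermitianVector.apply_pow {v w : V} (hv : IsHermitianVector q B v)
    (hw : IsHermitianVector q B w) : B v w ^ (q * q) = B v w := by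
  rw [pow_mul, ← hv, ← hw]

theorem span_isHermitianVector [IsAlgClosed K] [FiniteDimensional K V] (hq : 1 < q)
    (hσ : ∀ x, σ x = x ^ q) (hl : ∀ v, (∀ u, B v u = 0) → v = 0)
    (hr : ∀ v, (∀ u, B u v = 0) → v = 0) :
    Submodule.span K {v | IsHermitianVector q B v} = ⊤ := by
  let b := Module.finBasis K V
  let M : V →ₗ[K] (Fin (Module.finrank K V) → K) := LinearMap.pi fun i => B (b i)
  have hspan : ∀ u, u ∈ Submodule.span K (Set.range b) := fun u => by rw [b.span_eq]; trivial
  have hM : Function.Injective M := by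
    rw [injective_iff_map_eq_zero]
    intro v hv
    refine hr v fun u => ?_
    induction hspan u using Submodule.span_induction with
    | mem x hx =>
      obtain ⟨i, rfl⟩ := hx
      exact congrFun hv i
    | zero => simp
    | add x y _ _ hx hy => simp [hx, hy]
    | smul c x _ hx => simp [hx]
  let e : V ≃ₗ[K] (Fin (Module.finrank K V) → K) :=
    LinearEquiv.ofInjectiveOfFinrankEq M hM (by simp)
  have he : ∀ v i, e v i = B (b i) v := fun v i => rfl
  let Φ : V →ₛₗ[σ.comp σ] V :=
    { toFun := fun v => e.symm fun i => B v (b i) ^ q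
      map_add' := fun v w => by
        rw [← map_add]
        congr 1
        ext i
        simp only [map_add, LinearMap.add_apply, Pi.add_apply]
        rw [← hσ, map_add, hσ, hσ]
      map_smul' := fun c v => by
        rw [← map_smul]
        congr 1
        ext i
        simp only [LinearMap.map_smulₛₗ, LinearMap.smul_apply, smul_eq_mul, Pi.smul_apply, hσ,
          RingHom.comp_apply, mul_pow] }
  have hΦ : ∀ v u, B u (Φ v) = B v u ^ q := by
    intro v u
    induction hspan u using Submodule.span_induction with
    | mem x hx =>
      obtain ⟨i, rfl⟩ := hx
      rw [← he]
      exact congrFun (e.apply_symm_apply _) i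
    | zero => simp [show q ≠ 0 by omega]
    | add x y _ _ hx hy =>
      rw [map_add, map_add, LinearMap.add_apply, hx, hy, ← hσ (_ + _), map_add, hσ, hσ]
    | smul c x _ hx =>
      rw [LinearMap.map_smulₛₗ, LinearMap.smul_apply, hx, map_smul, hσ, smul_eq_mul, smul_eq_mul,
        mul_pow]
  have hinj : Function.Injective Φ := by
    rw [injective_iff_map_eq_zero]
    intro v hv
    refine hl v fun u => ?_
    have := hΦ v u
    rw [hv, map_zero] at this
    exact (pow_eq_zero_iff (by omega)).1 this.symm
  rw [eq_top_iff, ← span_semilinear_fixed_vectors (Q := q * q) (by nlinarith)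
    (fun x => by rw [RingHom.comp_apply, hσ, hσ, pow_mul]) Φ hinj]
  refine Submodule.span_mono fun v hv u => ?_
  have hv' : Φ v = v := hv
  rw [← hΦ v u, hv']

theorem exists_isHermitianVector_apply_self_ne_zero [IsAlgClosed K] (hq : 1 < q)
    (hσ : ∀ x, σ x = x ^ q) {v w : V} (hv : IsHermitianVector q B v)
    (hw : IsHermitianVector q B w) (h : B v w ≠ 0) :
    ∃ c : K, c ^ (q * q) = c ∧
      (B v v ≠ 0 ∨ B w w ≠ 0 ∨ B (v + c • w) (v + c • w) ≠ 0) := by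
  obtain ⟨x, hx⟩ := IsAlgClosed.exists_root
    (Polynomial.X ^ q + Polynomial.X - Polynomial.C (1 : K)) (by
      rw [Polynomial.degree_sub_C, Polynomial.degree_add_eq_left_of_degree_lt]
      · simp; omega
      · simp; omega
      · rw [Polynomial.degree_add_eq_left_of_degree_lt]
        · simp; omega
        · simp; omega)
  have hx1 : x ^ q + x = 1 := by simpa [sub_eq_zero] using hx
  have hx2 : x ^ (q * q) = x := by
    have := congrArg σ hx1
    rw [map_add, map_one, hσ, hσ, ← pow_mul] at this
    linear_combination this - hx1
  refine ⟨x / B v w, by rw [div_pow, hx2, hv.apply_pow hw], ?_⟩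
  by_contra! hcon
  obtain ⟨h1, h2, h3⟩ := hcon
  simp only [map_add, LinearMap.add_apply, LinearMap.map_smulₛₗ, LinearMap.smul_apply, map_smul,
    smul_eq_mul, h1, h2, hσ, mul_zero, add_zero, zero_add, hv w] at h3
  rw [← mul_pow, div_mul_cancel₀ _ h] at h3
  exact one_ne_zero (by linear_combination h3 - hx1)

theorem IsHermitianVector.exists_smul_apply_self_eq_one [IsAlgClosed K] (hq : 1 < q)
    (hσ : ∀ x, σ x = x ^ q) {v : V} (hv : IsHermitianVector q B v) (h : B v v ≠ 0) :
    ∃ c : K, IsHermitianVector q B (c • v) ∧ B (c • v) (c • v) = 1 := by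
  obtain ⟨c, hc⟩ := IsAlgClosed.exists_pow_nat_eq (B v v)⁻¹ (by omega : 0 < q + 1)
  have hc0 : c ≠ 0 := by
    rintro rfl
    rw [zero_pow (by omega)] at hc
    exact inv_ne_zero h hc.symm
  refine ⟨c, hv.smul hσ ?_, ?_⟩
  · apply mul_right_cancel₀ (pow_ne_zero q hc0)
    have : (c ^ (q + 1)) ^ q = c ^ (q + 1) := by rw [hc, inv_pow, ← hv v]
    rw [← pow_succ', ← this]
    ring
  · rw [map_smul, LinearMap.map_smulₛₗ, LinearMap.smul_apply, hσ, smul_eq_mul, smul_eq_mul,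
      ← mul_assoc, ← pow_succ', hc, inv_mul_cancel₀ h]

/-- A nondegenerate Frobenius-sesquilinear form over an algebraically closed field admits
orthonormal families of Hermitian vectors of every size up to the dimension. -/
theorem exists_orthonormal_isHermitianVector [IsAlgClosed K] [FiniteDimensional K V] (hq : 1 < q)
    (hσ : ∀ x, σ x = x ^ q) (hl : ∀ v, (∀ u, B v u = 0) → v = 0)
    (hr : ∀ v, (∀ u, B u v = 0) → v = 0) (m : ℕ) (hm : m ≤ Module.finrank K V) :
    ∃ e : Fin m → V, (∀ i, IsHermitianVector q B (e i)) ∧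
      ∀ i j, B (e i) (e j) = if i = j then 1 else 0 := by
  have hspan := span_isHermitianVector hq hσ hl hr
  induction m with
  | zero => exact ⟨Fin.elim0, fun i => i.elim0, fun i => i.elim0⟩
  | succ m ih =>
    obtain ⟨e, he, heq⟩ := ih (by omega)
    have hneg : (-1 : K) ^ (q * q) = -1 := by
      rw [pow_mul, ← hσ, ← hσ, map_neg, map_neg, map_one, map_one]
    have hsum : ∀ (s : Finset (Fin m)) (c : Fin m → K), (∀ i, c i ^ (q * q) = c i) →
        IsHermitianVector q B (∑ i ∈ s, c i • e i) := by
      intro s c hc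
      induction s using Finset.cons_induction with
      | empty => intro u; simp [show q ≠ 0 by omega]
      | cons i s hi ih =>
        rw [Finset.sum_cons]
        exact ((he i).smul hσ (hc i)).add hσ ih
    have hpr : ∀ h, IsHermitianVector q B h →
        IsHermitianVector q B (h + (-1 : K) • ∑ i, B (e i) h • e i) := fun h hh =>
      hh.add hσ ((hsum _ _ fun i => (he i).apply_pow hh).smul hσ hneg)
    have horth : ∀ h j, B (e j) (h + (-1 : K) • ∑ i, B (e i) h • e i) = 0 := by
      intro h j
      simp [heq]
    obtain ⟨g, hg, hge, hgg⟩ : ∃ g, IsHermitianVector q B g ∧ (∀ j, B (e j) g = 0) ∧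
        B g g ≠ 0 := by
      by_contra! hcon
      have hiso : ∀ g h, IsHermitianVector q B g → IsHermitianVector q B h →
          (∀ j, B (e j) g = 0) → (∀ j, B (e j) h = 0) → B g h = 0 := by
        intro g h hg hh hge hhe
        by_contra hne
        obtain ⟨c, hc, h1 | h1 | h1⟩ :=
          exists_isHermitianVector_apply_self_ne_zero hq hσ hg hh hne
        · exact h1 (hcon g hg hge)
        · exact h1 (hcon h hh hhe)
        · exact h1 (hcon _ (hg.add hσ (hh.smul hσ hc)) fun j => by simp [hge, hhe])
      have hzero : ∀ h, IsHermitianVector q B h → h ∈ Submodule.span K (Set.range e) := by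
        intro h hh
        have hz : h + (-1 : K) • ∑ i, B (e i) h • e i = 0 := by
          have hP := hpr h hh
          have hPe := horth h
          generalize h + (-1 : K) • ∑ i, B (e i) h • e i = P at hP hPe ⊢
          refine hl _ fun u => ?_
          have hu : u ∈ Submodule.span K {v | IsHermitianVector q B v} := by rw [hspan]; trivial
          induction hu using Submodule.span_induction with
          | mem x hx =>
            have h1 := hiso _ _ hP (hpr x hx) hPe (horth x)
            rw [map_add, map_smul, map_sum, Finset.sum_eq_zero, smul_zero, add_zero] at h1
            · exact h1
            · intro i _
              rw [map_smul, he i, hPe, zero_pow (by omega), smul_zero]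
          | zero => simp
          | add x y _ _ hx hy => rw [map_add, hx, hy, add_zero]
          | smul c x _ hx => rw [map_smul, hx, smul_zero]
        have : h = ∑ i, B (e i) h • e i := by
          rwa [neg_one_smul, ← sub_eq_add_neg, sub_eq_zero] at hz
        rw [this]
        exact Submodule.sum_mem _ fun i _ =>
          Submodule.smul_mem _ _ (Submodule.subset_span ⟨i, rfl⟩)
      have htop : Submodule.span K (Set.range e) = ⊤ := by
        rw [eq_top_iff, ← hspan]
        exact Submodule.span_le.2 hzero
      have hcard := finrank_range_le_card (R := K) e
      rw [Set.finrank, htop, finrank_top, Fintype.card_fin] at hcard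
      omega
    obtain ⟨c, hcH, hc1⟩ := hg.exists_smul_apply_self_eq_one hq hσ hgg
    refine ⟨Fin.cons (c • g) e, Fin.cases hcH he, ?_⟩
    have h1 : ∀ j, B (c • g) (e j) = 0 := by
      intro j
      rw [he j, map_smul, hge, smul_zero, zero_pow (by omega)]
    have h2 : ∀ j, B (e j) (c • g) = 0 := by
      intro j
      rw [map_smul, hge, smul_zero]
    intro i j
    refine Fin.cases ?_ (fun i => ?_) i <;> refine Fin.cases ?_ (fun j => ?_) j
    · simpa using hc1
    · simpa [(Fin.succ_ne_zero j).symm] using h1 j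
    · simpa using h2 i
    · simpa using heq i j

end HermitianForm

theorem separatingRight_of_separatingLeft {K : Type*} [Field K] [IsAlgClosed K] {q : ℕ}
    {σ : K →+* K} {V : Type*} [AddCommGroup V] [Module K V] [FiniteDimensional K V]
    {B : V →ₛₗ[σ] V →ₗ[K] K} (hq : q ≠ 0) (hσ : ∀ x, σ x = x ^ q)
    (hl : ∀ v, (∀ u, B v u = 0) → v = 0) (v : V) (hv : ∀ u, B u v = 0) : v = 0 := by
  let b := Module.finBasis K V
  let N : Matrix (Fin (Module.finrank K V)) (Fin (Module.finrank K V)) K :=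
    Matrix.of fun i j => B (b i) (b j)
  by_contra hne
  have hdet : N.det = 0 := by
    refine Matrix.exists_mulVec_eq_zero_iff.1 ⟨b.repr v, ?_, ?_⟩
    · intro h
      exact hne (b.repr.map_eq_zero_iff.1 (DFunLike.coe_injective h))
    · ext i
      have := hv (b i)
      rw [← b.sum_repr v, map_sum] at this
      simpa [N, Matrix.mulVec, dotProduct, mul_comm] using this
  obtain ⟨y, hy, hyN⟩ := Matrix.exists_vecMul_eq_zero_iff.2 hdet
  choose x hx using fun i => IsAlgClosed.exists_pow_nat_eq (y i) (Nat.pos_of_ne_zero hq)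
  have hzero : ∑ i, x i • b i = 0 := by
    refine hl _ fun u => ?_
    rw [← b.sum_repr u, map_sum]
    refine Finset.sum_eq_zero fun j _ => ?_
    rw [map_smul, map_sum, LinearMap.sum_apply]
    have := congrFun hyN j
    simp only [LinearMap.map_smulₛₗ, LinearMap.smul_apply, hσ, hx]
    simp only [N, Matrix.vecMul, dotProduct, Matrix.of_apply, Pi.zero_apply] at this
    simp only [smul_eq_mul, this, mul_zero]
  apply hy
  ext i
  rw [← hx, Fintype.linearIndependent_iff.1 b.linearIndependent x hzero i, zero_pow hq,
    Pi.zero_apply]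

theorem maximal_lines_implies_extremal {k : Type*} [Field k] [IsAlgClosed k] (d : ℕ) (hd : 3 < d)
    (f : MvPolynomial (Fin 4) k) (hf : IsSmoothSurface f d)
    (hcount : {W : Submodule k (Fin 4 → k) | IsLineOn f W}.ncard =
      d ^ 2 * (d ^ 2 - 3 * d + 3)) :
    ∃ p e : ℕ, p.Prime ∧ CharP k p ∧ 1 ≤ e ∧ d = p ^ e + 1 ∧
      ∃ (A : Matrix (Fin 4) (Fin 4) k) (c : k), IsUnit A ∧ c ≠ 0 ∧
        ∀ v : Fin 4 → k,
          MvPolynomial.eval (A.mulVec v) f =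
            c * (v 0 ^ (p ^ e + 1) + v 1 ^ (p ^ e + 1) +
                 v 2 ^ (p ^ e + 1) + v 3 ^ (p ^ e + 1)) := by
  obtain ⟨hfin, L, hL, T, hTcard, hT⟩ := exists_many_skew_lines hd hf hcount
  obtain ⟨p, e, hp, hchar, he, hde, hadd, hsmul, hself⟩ := exists_frobenius_form hf hd
    fun i x v hi hid => pol_eq_zero_of_many_skew_lines hf hd hfin hL T hTcard hT hi hid x v
  refine ⟨p, e, hp, hchar, he, hde, ?_⟩
  have : Fact p.Prime := ⟨hp⟩
  have hσ : ∀ x, iterateFrobenius k p e x = x ^ p ^ e := fun x => iterateFrobenius_def p e x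
  let B : (Fin 4 → k) →ₛₗ[iterateFrobenius k p e] (Fin 4 → k) →ₗ[k] k :=
    { toFun := polarForm f
      map_add' := fun x y => LinearMap.ext fun u => hadd x y u
      map_smul' := fun c x => LinearMap.ext fun u => by
        rw [LinearMap.smul_apply, hσ]
        exact hsmul c x u }
  have hl : ∀ v, (∀ u, B v u = 0) → v = 0 := by
    intro v hv
    by_contra hne
    obtain ⟨u, hu⟩ := hf.exists_pol_ne_zero hne (by
      rw [aeval_eq_eval]; exact (hself v).trans (hv v))
    exact hu (hv u)
  have hq : 1 < p ^ e := Nat.one_lt_pow (by omega) hp.one_lt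
  obtain ⟨w, -, hw⟩ := exists_orthonormal_isHermitianVector hq hσ hl
    (separatingRight_of_separatingLeft (by omega) hσ hl) 4 (by simp)
  have hmul : ∀ v : Fin 4 → k, (Matrix.of fun i j => w j i).mulVec v = ∑ j, v j • w j := by
    intro v
    ext i
    simp [Matrix.mulVec, dotProduct, mul_comm]
  have hB : ∀ (v : Fin 4 → k) j, B (w j) (∑ i, v i • w i) = v j := by
    intro v j
    simp [hw]
  refine ⟨Matrix.of fun i j => w j i, 1, ?_, one_ne_zero, fun v => ?_⟩
  · rw [← Matrix.mulVec_injective_iff_isUnit]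
    intro v v' h
    simp only [hmul] at h
    ext j
    rw [← hB v j, h, hB]
  · rw [hmul, hself]
    change B (∑ j, v j • w j) (∑ j, v j • w j) = _
    rw [map_sum B, LinearMap.sum_apply]
    simp only [LinearMap.map_smulₛₗ, LinearMap.smul_apply, hB, hσ, smul_eq_mul, ← pow_succ]
    rw [Fin.sum_univ_four, one_mul]
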